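/- Let n ≥ 2 be fixed and let (X_d)_{d≥1} be a unitarily invariant sequence of random positive semidefinite matrices X_d ∈ M_n(ℂ) ⊗ M_d(ℂ) converging strongly to a compactly supported probability measure μ with supp(μ) ⊆ [A,B] ⊆ [0,∞), mean m and variance σ². If (n²+n−1)A > B + m(n²−2) + 2σ√(n²−2), then almost surely, for all sufficiently large d, X_d ∈ SEP_{n,d}; in particular lim_{d→∞} P(X_d ∈ SEP_{n,d}) = 1. -/

import Mathlib

open MeasureTheory Filter Topology Polynomial Matrix Kronecker
open scoped ComplexOrder

noncomputable section

/-- Measurable space structure on matrices (entrywise). -/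
instance matMS (m n : Type*) : MeasurableSpace (Matrix m n ℂ) :=
  inferInstanceAs (MeasurableSpace (m → n → ℂ))

/-- The ℓ²→ℓ² operator norm of a complex square matrix. -/
def opNorm {N : Type*} [Fintype N] [DecidableEq N] (X : Matrix N N ℂ) : ℝ :=
  ‖Matrix.toEuclideanCLM (𝕜 := ℂ) (n := N) X‖

/-- Application of a real polynomial to a complex square matrix. -/
def polyApply {N : Type*} [Fintype N] [DecidableEq N] (P : Polynomial ℝ)
    (X : Matrix N N ℂ) : Matrix N N ℂ :=
  Polynomial.aeval X (P.map (algebraMap ℝ ℂ))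

/-- The (topological) support of a measure on ℝ: points all of whose open
neighbourhoods have positive measure. -/
def msupport (μ : Measure ℝ) : Set ℝ :=
  {x | ∀ U : Set ℝ, IsOpen U → x ∈ U → 0 < μ U}

/-- Strong convergence of a sequence of random matrices `X d ∈ M_n(ℂ) ⊗ M_d(ℂ)`
towards a compactly supported probability measure `μ`: almost surely, for every
real polynomial `P`, the normalized traces of `P(X d)` converge to `∫ P dμ` and the
operator norms of `P(X d)` converge to `sup {|P(x)| : x ∈ supp μ}`. -/
def StrongConv {Ω : Type*} [MeasurableSpace Ω] (ℙ : Measure Ω) (n : ℕ)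
    (X : (d : ℕ) → Ω → Matrix (Fin n × Fin d) (Fin n × Fin d) ℂ)
    (μ : Measure ℝ) : Prop :=
  ∀ᵐ ω ∂ℙ, ∀ P : Polynomial ℝ,
    Tendsto (fun d : ℕ => ((n : ℂ) * (d : ℂ))⁻¹ * (polyApply P (X d ω)).trace) atTop
      (𝓝 ((∫ x, P.eval x ∂μ : ℝ) : ℂ)) ∧
    Tendsto (fun d : ℕ => opNorm (polyApply P (X d ω))) atTop
      (𝓝 (sSup ((fun x => |P.eval x|) '' msupport μ)))

/-- Unitary invariance of a sequence of random matrices: for every `d` and every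
unitary `U`, the random matrix `U (X d) U*` has the same distribution as `X d`. -/
def UnitInv {Ω : Type*} [MeasurableSpace Ω] (ℙ : Measure Ω) (n : ℕ)
    (X : (d : ℕ) → Ω → Matrix (Fin n × Fin d) (Fin n × Fin d) ℂ) : Prop :=
  ∀ d : ℕ, ∀ U : Matrix (Fin n × Fin d) (Fin n × Fin d) ℂ,
    U ∈ unitary (Matrix (Fin n × Fin d) (Fin n × Fin d) ℂ) →
    Measure.map (fun ω => U * X d ω * star U) ℙ = Measure.map (X d) ℙ

/-- The separable cone `SEP_{n,d}`. -/
def SEP (n d : ℕ) : Set (Matrix (Fin n × Fin d) (Fin n × Fin d) ℂ) :=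
  {X | ∃ (k : ℕ) (A : Fin k → Matrix (Fin n) (Fin n) ℂ)
      (B : Fin k → Matrix (Fin d) (Fin d) ℂ),
    (∀ i, (A i).PosSemidef) ∧ (∀ i, (B i).PosSemidef) ∧ X = ∑ i, A i ⊗ₖ B i}

/-- The partial transpose on `M_n(ℂ) ⊗ M_d(ℂ)`: transposition of the first factor. -/
def ptrans {n d : ℕ} (X : Matrix (Fin n × Fin d) (Fin n × Fin d) ℂ) :
    Matrix (Fin n × Fin d) (Fin n × Fin d) ℂ :=
  fun p q => X (q.1, p.2) (p.1, q.2)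

/-- The PPT cone `PPT_{n,d}`: positive semidefinite matrices with positive
semidefinite partial transpose. -/
def PPT (n d : ℕ) : Set (Matrix (Fin n × Fin d) (Fin n × Fin d) ℂ) :=
  {X | X.PosSemidef ∧ (ptrans X).PosSemidef}

section Separability

/-! ### A separability criterion -/

section SepCriterion

variable {n : ℕ} {ι : Type*} [Fintype ι] [DecidableEq ι]

/-- Partial trace over the first tensor factor. -/
def trOne (X : Matrix (Fin n × ι) (Fin n × ι) ℂ) : Matrix ι ι ℂ :=
  fun a b => ∑ i, X (i, a) (i, b)

/-- The map `X ↦ n • (1 ⊗ Tr₁ X) - X`. -/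
def Theta (X : Matrix (Fin n × ι) (Fin n × ι) ℂ) : Matrix (Fin n × ι) (Fin n × ι) ℂ :=
  (n : ℂ) • ((1 : Matrix (Fin n) (Fin n) ℂ) ⊗ₖ trOne X) - X

lemma SEP_zero {d : ℕ} : (0 : Matrix (Fin n × Fin d) (Fin n × Fin d) ℂ) ∈ SEP n d :=
  ⟨0, Fin.elim0, Fin.elim0, fun i => i.elim0, fun i => i.elim0, by simp⟩

lemma SEP_kronecker {d : ℕ} {A : Matrix (Fin n) (Fin n) ℂ} {B : Matrix (Fin d) (Fin d) ℂ}
    (hA : A.PosSemidef) (hB : B.PosSemidef) : A ⊗ₖ B ∈ SEP n d :=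
  ⟨1, fun _ => A, fun _ => B, fun _ => hA, fun _ => hB, by simp⟩

lemma SEP_add {d : ℕ} {X Y : Matrix (Fin n × Fin d) (Fin n × Fin d) ℂ}
    (hX : X ∈ SEP n d) (hY : Y ∈ SEP n d) : X + Y ∈ SEP n d := by
  obtain ⟨k, A, B, hA, hB, rfl⟩ := hX
  obtain ⟨l, A', B', hA', hB', rfl⟩ := hY
  refine ⟨k + l, Fin.append A A', Fin.append B B', ?_, ?_, ?_⟩
  · intro i
    refine Fin.addCases (fun i => ?_) (fun i => ?_) i <;> simp [hA, hA']
  · intro i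
    refine Fin.addCases (fun i => ?_) (fun i => ?_) i <;> simp [hB, hB']
  · simp [Fin.sum_univ_add]

lemma SEP_sum {d : ℕ} {κ : Type*} (s : Finset κ)
    (F : κ → Matrix (Fin n × Fin d) (Fin n × Fin d) ℂ) (h : ∀ i ∈ s, F i ∈ SEP n d) :
    ∑ i ∈ s, F i ∈ SEP n d := by
  classical
  induction s using Finset.induction_on with
  | empty => simpa using SEP_zero
  | insert a s ha ih =>
    rw [Finset.sum_insert ha]
    exact SEP_add (h a (by simp)) (ih fun i hi => h i (by simp [hi]))

/-- The fourth roots of unity, indexed by `ZMod 4`. -/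
def phase (x : ZMod 4) : ℂ := Complex.I ^ x.val

lemma phase_add_one (x : ZMod 4) : phase (x + 1) = Complex.I * phase x := by
  unfold phase
  have h4 : Complex.I ^ 4 = 1 := Complex.I_pow_four
  rw [← pow_succ', Complex.I_pow_eq_pow_mod, Complex.I_pow_eq_pow_mod (x.val + 1), ZMod.val_add]
  congr 1
  revert x; decide

lemma phase_mul_conj (x : ZMod 4) : phase x * star (phase x) = 1 := by
  unfold phase
  rw [star_pow, ← mul_pow]
  simp

lemma phase_single (θ : Fin n → ZMod 4) (c k : Fin n) :
    phase ((θ + (Pi.single c 1 : Fin n → ZMod 4)) k) = (if k = c then Complex.I else 1) * phase (θ k) := by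
  by_cases h : k = c
  · subst h; simp [phase_add_one]
  · simp [h]

lemma phase_shift (i j k l c : Fin n) :
    (∑ θ : Fin n → ZMod 4, star (phase (θ i)) * phase (θ j) * (phase (θ k) * star (phase (θ l))))
     = (star (if i = c then Complex.I else 1) * (if j = c then Complex.I else 1) *
        ((if k = c then Complex.I else 1) * star (if l = c then Complex.I else 1))) *
      ∑ θ : Fin n → ZMod 4,
        star (phase (θ i)) * phase (θ j) * (phase (θ k) * star (phase (θ l))) := by
  conv_lhs => rw [← Equiv.sum_comp (Equiv.addRight (Pi.single c (1 : ZMod 4)))]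
  rw [Finset.mul_sum]
  refine Finset.sum_congr rfl fun θ _ => ?_
  simp only [Equiv.coe_addRight, phase_single, star_mul']
  ring

lemma phase_sum (i j k l : Fin n) :
    (∑ θ : Fin n → ZMod 4, star (phase (θ i)) * phase (θ j) * (phase (θ k) * star (phase (θ l))))
     = if (if i = j then k = l else (k = i ∧ l = j)) then (4 : ℂ) ^ n else 0 := by
  have h1 : ∀ z : ℂ, Complex.I * z = z → z = 0 := by
    intro z hz
    have h : (Complex.I - 1) * z = 0 := by linear_combination hz
    rcases mul_eq_zero.1 h with h | h
    · exfalso; have := congrArg Complex.re h; simp at this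
    · exact h
  have h2 : ∀ z : ℂ, -Complex.I * z = z → z = 0 := by
    intro z hz
    have h : (Complex.I + 1) * z = 0 := by linear_combination -hz
    rcases mul_eq_zero.1 h with h | h
    · exfalso; have := congrArg Complex.re h; simp at this
    · exact h
  have h3 : ∀ z : ℂ, -z = z → z = 0 := by
    intro z hz; linear_combination (-1/2 : ℂ) * hz
  have e : ∀ x, star (phase x) * phase x = 1 := fun x => by rw [mul_comm, phase_mul_conj]
  by_cases hij : i = j
  · subst hij
    simp only [if_true]
    by_cases hkl : k = l
    · subst hkl
      simp only [e, phase_mul_conj]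
      simp
    · have := phase_shift i i k l k
      rw [if_neg hkl]
      rw [if_neg (Ne.symm hkl)] at this
      by_cases hik : i = k
      · simp [hik] at this
        exact h1 _ (by simpa [hik] using this.symm)
      · simp [hik] at this
        exact h1 _ (by simpa using this.symm)
  · simp only [if_neg hij]
    by_cases hk : k = i
    · subst hk
      by_cases hl : l = j
      · subst hl
        rw [if_pos ⟨rfl, rfl⟩]
        have : ∀ θ : Fin n → ZMod 4, star (phase (θ k)) * phase (θ l) *
            (phase (θ k) * star (phase (θ l))) = 1 := by
          intro θ
          linear_combination (phase (θ l) * star (phase (θ l))) * e (θ k) + phase_mul_conj (θ l)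
        simp only [this]
        simp
      · rw [if_neg (by tauto)]
        have := phase_shift k j k l j
        simp only [if_neg hij, if_neg hl] at this
        simp at this
        exact h1 _ (by simpa using this.symm)
    · rw [if_neg (by tauto)]
      have := phase_shift i j k l i
      simp only [if_neg hk, if_neg (Ne.symm hij)] at this
      by_cases hl : l = i
      · simp [hl] at this
        exact h3 _ (by simpa [hl] using this.symm)
      · simp [hl] at this
        exact h2 _ (by simpa using this.symm)

/-- The compression of a block matrix by a vector of phases. -/
def phaseRow (d : ℕ) (θ : Fin n → ZMod 4) : Matrix (Fin d) (Fin n × Fin d) ℂ :=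
  fun a p => if a = p.2 then phase (θ p.1) else 0

lemma phaseRow_compress {d : ℕ} (θ : Fin n → ZMod 4)
    (Y : Matrix (Fin n × Fin d) (Fin n × Fin d) ℂ) (a b : Fin d) :
    (phaseRow d θ * Y * (phaseRow d θ)ᴴ) a b =
      ∑ k, ∑ l, phase (θ k) * star (phase (θ l)) * Y (k, a) (l, b) := by
  simp only [Matrix.mul_apply, phaseRow, conjTranspose_apply, Fintype.sum_prod_type]
  rw [Finset.sum_comm]
  simp [apply_ite star, Finset.sum_mul]
  rw [Finset.sum_comm]
  refine Finset.sum_congr rfl fun k _ => Finset.sum_congr rfl fun l _ => ?_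
  ring

lemma SEP_of_add_trOne {d : ℕ} {Y : Matrix (Fin n × Fin d) (Fin n × Fin d) ℂ}
    (hY : Y.PosSemidef) : Y + (1 : Matrix (Fin n) (Fin n) ℂ) ⊗ₖ trOne Y ∈ SEP n d := by
  have key : Y + (1 : Matrix (Fin n) (Fin n) ℂ) ⊗ₖ trOne Y =
      ∑ θ : Fin n → ZMod 4, (((4 : ℂ) ^ n)⁻¹ •
        vecMulVec (star fun k => phase (θ k)) (star (star fun k => phase (θ k)))) ⊗ₖ
          (phaseRow d θ * Y * (phaseRow d θ)ᴴ) +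
      ∑ i : Fin n, (Matrix.diagonal (Pi.single i (1 : ℂ))) ⊗ₖ
          (Y.submatrix (fun a => (i, a)) (fun a => (i, a))) := by
    ext ⟨i, a⟩ ⟨j, b⟩
    rw [Matrix.add_apply, Matrix.add_apply, Matrix.sum_apply, Matrix.sum_apply]
    simp only [kroneckerMap_apply, phaseRow_compress, Matrix.smul_apply, vecMulVec_apply,
      Pi.star_apply, star_star, smul_eq_mul]
    have : ∀ θ : Fin n → ZMod 4, ((4 : ℂ) ^ n)⁻¹ * (star (phase (θ i)) * phase (θ j)) *
        ∑ k, ∑ l, phase (θ k) * star (phase (θ l)) * Y (k, a) (l, b) =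
        ∑ k, ∑ l, ((4 : ℂ) ^ n)⁻¹ * Y (k, a) (l, b) *
          (star (phase (θ i)) * phase (θ j) * (phase (θ k) * star (phase (θ l)))) := by
      intro θ
      rw [Finset.mul_sum]
      refine Finset.sum_congr rfl fun k _ => ?_
      rw [Finset.mul_sum]
      refine Finset.sum_congr rfl fun l _ => ?_
      ring
    simp only [this]
    rw [Finset.sum_comm]
    simp_rw [Finset.sum_comm (s := (Finset.univ : Finset (Fin n → ZMod 4))), ← Finset.mul_sum,
      phase_sum]
    have h4 : ((4 : ℂ) ^ n) ≠ 0 := by positivity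
    by_cases hij : i = j
    · subst hij
      simp [trOne, Matrix.diagonal, Pi.single_apply]
      rw [add_comm]
      congr 1
      refine Finset.sum_congr rfl fun k _ => ?_
      field_simp
    · simp [hij, Matrix.diagonal, ite_and]
      field_simp
  rw [key]
  refine SEP_add (SEP_sum _ _ fun θ _ => SEP_kronecker ?_ ?_)
    (SEP_sum _ _ fun i _ => SEP_kronecker ?_ ?_)
  · exact (posSemidef_vecMulVec_self_star _).smul (by positivity)
  · exact hY.mul_mul_conjTranspose_same _
  · exact PosSemidef.diagonal fun k => by
      by_cases h : k = i <;> simp [h]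
  · exact hY.submatrix _

/-- If `a ≤ X`, `Θ(X) ≤ b` and `b ≤ (n² + n - 1) a`, then `X` is separable. -/
theorem SEP_of_Theta_le (hn : 1 ≤ n) {d : ℕ} {X : Matrix (Fin n × Fin d) (Fin n × Fin d) ℂ}
    {a b : ℝ} (ha : (X - (a : ℂ) • 1).PosSemidef) (hb : ((b : ℂ) • 1 - Theta X).PosSemidef)
    (hab : b ≤ ((n : ℝ) ^ 2 + n - 1) * a) : X ∈ SEP n d := by
  have hn' : (n : ℂ) ≠ 0 := by exact_mod_cast (by omega : n ≠ 0)
  have hn1 : (n : ℂ) + 1 ≠ 0 := by exact_mod_cast (by omega : n + 1 ≠ 0)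
  set Y : Matrix (Fin n × Fin d) (Fin n × Fin d) ℂ :=
    X - ((n : ℂ) + 1)⁻¹ • ((1 : Matrix (Fin n) (Fin n) ℂ) ⊗ₖ trOne X) with hYdef
  have hYeq : Y = (((n : ℝ) * (n + 1))⁻¹ : ℂ) •
      ((((n : ℝ) ^ 2 + n - 1 : ℝ) : ℂ) • (X - (a : ℂ) • 1) + ((b : ℂ) • 1 - Theta X) +
        (((((n : ℝ) ^ 2 + n - 1) * a - b : ℝ) : ℂ)) •
          (1 : Matrix (Fin n × Fin d) (Fin n × Fin d) ℂ)) := by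
    ext p q
    simp only [hYdef, Theta, Matrix.sub_apply, Matrix.add_apply, Matrix.smul_apply, smul_eq_mul]
    push_cast
    field_simp
    ring
  have hY : Y.PosSemidef := by
    rw [hYeq]
    refine PosSemidef.smul (((PosSemidef.smul ha ?_).add hb).add
      (PosSemidef.smul PosSemidef.one ?_)) ?_
    · have : (1 : ℝ) ≤ n := by exact_mod_cast hn
      exact Complex.zero_le_real.2 (by nlinarith)
    · exact Complex.zero_le_real.2 (by linarith)
    · have : (0 : ℂ) ≤ (((n : ℝ) * (n + 1))⁻¹ : ℝ) := Complex.zero_le_real.2 (by positivity)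
      simpa using this
  have hX : X = Y + (1 : Matrix (Fin n) (Fin n) ℂ) ⊗ₖ trOne Y := by
    have h1 : trOne Y = ((n : ℂ) + 1)⁻¹ • trOne X := by
      ext a b
      simp only [hYdef, trOne, Matrix.sub_apply, Matrix.smul_apply, kroneckerMap_apply,
        Matrix.one_apply_eq, smul_eq_mul, one_mul, Finset.sum_sub_distrib, Finset.sum_const,
        Finset.card_univ, Fintype.card_fin, nsmul_eq_mul]
      field_simp
      ring
    rw [h1, kronecker_smul, hYdef]
    abel
  rw [hX]
  exact SEP_of_add_trOne hY

end SepCriterion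

open scoped Matrix.Norms.L2Operator

/-! ### Haar integration over the unitary group -/


section Haar

variable {J : Type*} [Fintype J] [DecidableEq J]

instance matBorelSpace : BorelSpace (Matrix J J ℂ) :=
  inferInstanceAs (BorelSpace (J → J → ℂ))

instance unitaryBorelSpace : BorelSpace (unitaryGroup J ℂ) :=
  inferInstanceAs (BorelSpace {x : Matrix J J ℂ // x ∈ unitaryGroup J ℂ})

instance unitaryCompactSpace : CompactSpace (unitaryGroup J ℂ) := by
  have h : IsCompact (unitaryGroup J ℂ : Set (Matrix J J ℂ)) := by
    refine Metric.isCompact_of_isClosed_isBounded (isClosed_unitary) ?_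
    refine (Metric.isBounded_closedBall (x := (0 : Matrix J J ℂ)) (r := ‖(1 : Matrix J J ℂ)‖)).subset fun U hU => ?_
    rw [mem_closedBall_zero_iff]
    have := CStarRing.norm_mem_unitary_mul (1 : Matrix J J ℂ) hU
    rw [mul_one] at this
    exact this.le
  exact isCompact_iff_compactSpace.1 h

/-- Normalized Haar measure on the unitary group. -/
def uHaar (J : Type*) [Fintype J] [DecidableEq J] : Measure (unitaryGroup J ℂ) :=
  Measure.haarMeasure ⊤

instance : IsProbabilityMeasure (uHaar J) :=
  ⟨by
    have := Measure.haarMeasure_self (K₀ := (⊤ : TopologicalSpace.PositiveCompacts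
      (unitaryGroup J ℂ)))
    simpa [uHaar] using this⟩

instance : (uHaar J).IsMulLeftInvariant :=
  inferInstanceAs (Measure.haarMeasure ⊤).IsMulLeftInvariant

instance : (uHaar J).IsOpenPosMeasure :=
  inferInstanceAs (Measure.haarMeasure ⊤).IsOpenPosMeasure

lemma uHaar_integrable {V : Type*} [NormedAddCommGroup V] {f : unitaryGroup J ℂ → V}
    (hf : Continuous f) : Integrable f (uHaar J) :=
  haveI : IsFiniteMeasureOnCompacts (uHaar J) := inferInstance
  hf.integrable_of_hasCompactSupport (HasCompactSupport.of_compactSpace f)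

/-- The one-parameter group generated by a skew-adjoint matrix. -/
def expU (K : skewAdjoint (Matrix J J ℂ)) (t : ℝ) : unitaryGroup J ℂ :=
  ⟨NormedSpace.exp (t • (K : Matrix J J ℂ)),
    letI := NormedAlgebra.restrictScalars ℚ ℂ (Matrix J J ℂ)
    NormedSpace.exp_mem_unitary_of_mem_skewAdjoint (skewAdjoint.smul_mem t K.2)⟩

lemma coe_expU (K : skewAdjoint (Matrix J J ℂ)) (t : ℝ) :
    (expU K t : Matrix J J ℂ) = NormedSpace.exp (t • (K : Matrix J J ℂ)) := rfl

lemma expU_add (K : skewAdjoint (Matrix J J ℂ)) (s t : ℝ) :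
    expU K (s + t) = expU K s * expU K t := by
  let := NormedAlgebra.restrictScalars ℚ ℂ (Matrix J J ℂ)
  apply Subtype.ext
  rw [Submonoid.coe_mul, coe_expU, coe_expU, coe_expU, add_smul]
  exact NormedSpace.exp_add_of_commute ((Commute.refl _).smul_left s |>.smul_right t)

lemma expU_zero (K : skewAdjoint (Matrix J J ℂ)) : expU K 0 = 1 := by
  apply Subtype.ext; simp [coe_expU]

lemma star_expU (K : skewAdjoint (Matrix J J ℂ)) (t : ℝ) :
    star (expU K t : Matrix J J ℂ) = NormedSpace.exp (t • (-(K : Matrix J J ℂ))) := by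
  rw [coe_expU, NormedSpace.star_exp]
  congr 1
  have : star (K : Matrix J J ℂ) = -K := K.2
  rw [star_smul, this]; simp

variable {V W : Type*} [NormedAddCommGroup V] [NormedSpace ℂ V]
  [NormedAddCommGroup W] [NormedSpace ℂ W]

/-- `HasD M D` says that the continuous map `M` on the unitary group has derivative
`D U K` at `U` along the right-invariant vector field generated by each skew-adjoint `K`, and
that `D` is continuous in `U` and complex linear in `K`. -/
structure HasD (M : unitaryGroup J ℂ → V) (D : unitaryGroup J ℂ → Matrix J J ℂ → V) : Prop where
  cont : Continuous M
  dcont : ∀ K, Continuous fun U => D U K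
  map_add : ∀ U K L, D U (K + L) = D U K + D U L
  map_smul : ∀ U (c : ℂ) K, D U (c • K) = c • D U K
  deriv : ∀ U (K : skewAdjoint (Matrix J J ℂ)),
    HasDerivAt (fun t : ℝ => M (expU K t * U)) (D U K) 0

namespace HasD

lemma deriv_at {M : unitaryGroup J ℂ → V} {D} (h : HasD M D) (U : unitaryGroup J ℂ)
    (K : skewAdjoint (Matrix J J ℂ)) (s : ℝ) :
    HasDerivAt (fun t : ℝ => M (expU K t * U)) (D (expU K s * U) K) s := by
  have h1 := h.deriv (expU K s * U) K
  have h2 : (fun t : ℝ => M (expU K t * U)) = fun t => (fun t : ℝ => M (expU K t *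
      (expU K s * U))) (t - s) := by
    funext t
    simp only [← mul_assoc, ← expU_add, sub_add_cancel]
  rw [h2]
  have h3 : HasDerivAt (fun t : ℝ => M (expU K t * (expU K s * U))) (D (expU K s * U) K) (s - s) :=
    by simpa using h1
  exact h3.comp_sub_const s s

lemma const (c : V) : HasD (fun _ : unitaryGroup J ℂ => c) (fun _ _ => 0) where
  cont := continuous_const
  dcont _ := continuous_const
  map_add := by simp
  map_smul := by simp
  deriv _ _ := hasDerivAt_const _ _

lemma add {M N : unitaryGroup J ℂ → V} {D E} (hM : HasD M D) (hN : HasD N E) :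
    HasD (fun U => M U + N U) (fun U K => D U K + E U K) where
  cont := hM.cont.add hN.cont
  dcont K := (hM.dcont K).add (hN.dcont K)
  map_add U K L := by simp only [hM.map_add, hN.map_add]; abel
  map_smul U c K := by simp only [hM.map_smul, hN.map_smul, smul_add]
  deriv U K := (hM.deriv U K).add (hN.deriv U K)

lemma clm (L : V →L[ℂ] W) {M : unitaryGroup J ℂ → V} {D} (hM : HasD M D) :
    HasD (fun U => L (M U)) (fun U K => L (D U K)) where
  cont := L.continuous.comp hM.cont
  dcont K := L.continuous.comp (hM.dcont K)
  map_add U K L := by simp only [hM.map_add, _root_.map_add]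
  map_smul U c K := by simp only [hM.map_smul, _root_.map_smul]
  deriv U K := (L.restrictScalars ℝ).hasFDerivAt.comp_hasDerivAt (0 : ℝ) (hM.deriv U K)

lemma lin [FiniteDimensional ℂ V] (L : V →ₗ[ℂ] W) {M : unitaryGroup J ℂ → V} {D}
    (hM : HasD M D) : HasD (fun U => L (M U)) (fun U K => L (D U K)) :=
  hM.clm (LinearMap.toContinuousLinearMap L)

lemma smul (c : ℂ) {M : unitaryGroup J ℂ → V} {D} (hM : HasD M D) :
    HasD (fun U => c • M U) (fun U K => c • D U K) :=
  hM.clm (c • ContinuousLinearMap.id ℂ V)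

lemma neg {M : unitaryGroup J ℂ → V} {D} (hM : HasD M D) :
    HasD (fun U => -M U) (fun U K => -D U K) :=
  hM.clm (-ContinuousLinearMap.id ℂ V)

lemma sub {M N : unitaryGroup J ℂ → V} {D E} (hM : HasD M D) (hN : HasD N E) :
    HasD (fun U => M U - N U) (fun U K => D U K - E U K) := by
  simpa only [sub_eq_add_neg] using hM.add hN.neg

lemma sum {κ : Type*} (s : Finset κ) {M : κ → unitaryGroup J ℂ → V}
    {D : κ → unitaryGroup J ℂ → Matrix J J ℂ → V}
    (h : ∀ i ∈ s, HasD (M i) (D i)) :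
    HasD (fun U => ∑ i ∈ s, M i U) (fun U K => ∑ i ∈ s, D i U K) := by
  classical
  induction s using Finset.induction_on with
  | empty => simpa using const 0
  | insert a s ha ih =>
    simp only [Finset.sum_insert ha]
    exact (h a (by simp)).add (ih fun i hi => h i (by simp [hi]))

lemma mul {R : Type*} [NormedRing R] [NormedAlgebra ℂ R] {M N : unitaryGroup J ℂ → R} {D E}
    (hM : HasD M D) (hN : HasD N E) :
    HasD (fun U => M U * N U) (fun U K => D U K * N U + M U * E U K) where
  cont := hM.cont.mul hN.cont
  dcont K := ((hM.dcont K).mul hN.cont).add (hM.cont.mul (hN.dcont K))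
  map_add U K L := by simp only [hM.map_add, hN.map_add, add_mul, mul_add]; abel
  map_smul U c K := by
    simp only [hM.map_smul, hN.map_smul, smul_add, smul_mul_assoc, mul_smul_comm]
  deriv U K := by
    have := (hM.deriv U K).mul (hN.deriv U K)
    simp only [expU_zero, one_mul] at this
    exact this

lemma congr {M : unitaryGroup J ℂ → V} {D D'} (h : HasD M D) (h' : ∀ U K, D U K = D' U K) :
    HasD M D' := by
  obtain rfl : D = D' := by funext U K; exact h' U K
  exact h

lemma congr_left {M M' : unitaryGroup J ℂ → V} {D} (h : HasD M D) (h' : ∀ U, M U = M' U) :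
    HasD M' D := by
  obtain rfl : M = M' := funext h'
  exact h

lemma inverse {R : Type*} [NormedRing R] [NormedAlgebra ℂ R] [HasSummableGeomSeries R]
    {M : unitaryGroup J ℂ → R} {D}
    (hM : HasD M D) (hu : ∀ U, IsUnit (M U)) :
    HasD (fun U => Ring.inverse (M U))
      (fun U K => -(Ring.inverse (M U) * D U K * Ring.inverse (M U))) := by
  have hc : Continuous fun U => Ring.inverse (M U) := by
    rw [continuous_iff_continuousAt]
    intro U
    obtain ⟨u, hu⟩ := hu U
    have := NormedRing.inverse_continuousAt u
    rw [hu] at this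
    exact ContinuousAt.comp (f := M) this hM.cont.continuousAt
  refine ⟨hc, fun K => ((hc.mul (hM.dcont K)).mul hc).neg, ?_, ?_, ?_⟩
  · intro U K L; simp only [hM.map_add, mul_add, add_mul, neg_add]
  · intro U c K; simp only [hM.map_smul, mul_smul_comm, smul_mul_assoc, smul_neg]
  · intro U K
    obtain ⟨u, hu⟩ := hu U
    have h1 := hM.deriv U K
    have h2 := hasFDerivAt_ringInverse (𝕜 := ℝ) u
    have h3 : M (expU K 0 * U) = u := by rw [expU_zero, one_mul, hu]
    rw [← h3] at h2
    have h4 := h2.comp_hasDerivAt (0 : ℝ) h1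
    have h5 : -(Ring.inverse (M U) * D U K * Ring.inverse (M U)) =
        (-((ContinuousLinearMap.mulLeftRight ℝ R) ↑u⁻¹) ↑u⁻¹) (D U K) := by
      simp [← hu]
    rw [h5]
    exact h4

end HasD

/-- Conjugation of a fixed matrix by a unitary. -/
def conjU (P : Matrix J J ℂ) (U : unitaryGroup J ℂ) : Matrix J J ℂ :=
  (U : Matrix J J ℂ) * P * star (U : Matrix J J ℂ)

lemma hasD_conjU (P : Matrix J J ℂ) :
    HasD (conjU P) (fun U K => K * conjU P U - conjU P U * K) := by
  have hc : Continuous (conjU P) := by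
    unfold conjU
    exact (continuous_subtype_val.mul continuous_const).mul continuous_subtype_val.star
  refine ⟨hc, fun K => (continuous_const.mul hc).sub (hc.mul continuous_const), ?_, ?_, ?_⟩
  · intro U K L; simp only [add_mul, mul_add]; abel
  · intro U c K; simp only [smul_mul_assoc, mul_smul_comm, smul_sub]
  · intro U K
    have h1 := hasDerivAt_exp_smul_const (𝕂 := ℝ) (K : Matrix J J ℂ) 0
    have h2 := hasDerivAt_exp_smul_const (𝕂 := ℝ) (-K : Matrix J J ℂ) 0
    have h3 := (h1.mul_const (conjU P U)).mul h2
    have h4 : (fun t : ℝ => conjU P (expU K t * U)) = fun t : ℝ =>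
        NormedSpace.exp (t • (K : Matrix J J ℂ)) * conjU P U *
          NormedSpace.exp (t • (-K : Matrix J J ℂ)) := by
      funext t
      simp only [conjU, Submonoid.coe_mul, star_mul, star_expU, ← coe_expU, mul_assoc]
    rw [h4]
    simp only [zero_smul, NormedSpace.exp_zero, one_mul, mul_one, mul_neg, ← sub_eq_add_neg] at h3
    exact h3

lemma exists_skew_decomp (K : Matrix J J ℂ) :
    ∃ A B : skewAdjoint (Matrix J J ℂ), K = (A : Matrix J J ℂ) + Complex.I • (B : Matrix J J ℂ) := by
  refine ⟨⟨(2⁻¹ : ℂ) • (K - star K), ?_⟩, ⟨(-(Complex.I * 2⁻¹) : ℂ) • (K + star K), ?_⟩, ?_⟩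
  · rw [skewAdjoint.mem_iff]
    simp [star_smul, ← smul_neg]
  · rw [skewAdjoint.mem_iff]
    simp [star_smul, add_comm]
  · simp only [smul_smul]
    have : Complex.I * -(Complex.I * 2⁻¹) = (2⁻¹ : ℂ) := by
      linear_combination (-2⁻¹ : ℂ) * Complex.I_mul_I
    rw [this]
    module

lemma HasD.integral_skew {f : unitaryGroup J ℂ → ℂ} {D} (h : HasD f D)
    (K : skewAdjoint (Matrix J J ℂ)) : ∫ U, D U K ∂(uHaar J) = 0 := by
  have hF : ∀ t : ℝ, ∫ U, f (expU K t * U) ∂(uHaar J) = ∫ U, f U ∂(uHaar J) := fun t =>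
    integral_mul_left_eq_self f (expU K t)
  obtain ⟨C, hC⟩ := (isCompact_univ.image (h.dcont K)).isBounded.exists_norm_le
  have key := hasDerivAt_integral_of_dominated_loc_of_deriv_le (μ := uHaar J) (𝕜 := ℝ)
    (bound := fun _ => C) (F := fun t U => f (expU K t * U))
    (F' := fun t U => D (expU K t * U) K) (x₀ := 0) (s := Set.univ) univ_mem
    (Eventually.of_forall fun t => (h.cont.comp (continuous_const.mul
      continuous_id)).aestronglyMeasurable)
    (uHaar_integrable (h.cont.comp (continuous_const.mul continuous_id)))
    ((h.dcont K).comp (continuous_const.mul continuous_id)).aestronglyMeasurable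
    (ae_of_all _ fun U t _ => hC _ ⟨_, Set.mem_univ _, rfl⟩)
    (integrable_const _)
    (ae_of_all _ fun U t _ => h.deriv_at U K t)
  have h2 := key.2
  simp only [hF, expU_zero, one_mul] at h2
  exact h2.unique (hasDerivAt_const _ _)

/-- The Schwinger–Dyson equation: derivatives integrate to zero. -/
theorem HasD.integral_eq_zero {f : unitaryGroup J ℂ → ℂ} {D} (h : HasD f D)
    (K : Matrix J J ℂ) : ∫ U, D U K ∂(uHaar J) = 0 := by
  obtain ⟨A, B, rfl⟩ := exists_skew_decomp K
  have hB : Integrable (fun U => Complex.I • D U (B : Matrix J J ℂ)) (uHaar J) :=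
    (uHaar_integrable (h.dcont _)).smul Complex.I
  simp only [h.map_add, h.map_smul]
  rw [integral_add (uHaar_integrable (h.dcont _)) hB, integral_smul, h.integral_skew,
    h.integral_skew]
  simp

end Haar

/-! ### Integration by parts and constancy -/


section Parts

variable {J : Type*} [Fintype J] [DecidableEq J]

lemma exists_expU_eq (U : unitaryGroup J ℂ) : ∃ K : skewAdjoint (Matrix J J ℂ), expU K 1 = U := by
  have hs := (Unitary.argSelfAdjoint (A := Matrix J J ℂ) U).2
  refine ⟨⟨Complex.I • (Unitary.argSelfAdjoint (A := Matrix J J ℂ) U : Matrix J J ℂ), ?_⟩, ?_⟩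
  · rw [skewAdjoint.mem_iff, star_smul, hs]
    simp
  · apply Subtype.ext
    rw [coe_expU, one_smul]
    have hc : ContinuousOn Complex.arg (spectrum ℂ (U : Matrix J J ℂ)) := by
      rw [continuousOn_iff_continuous_domRestrict]
      have := (Matrix.finite_spectrum (U : Matrix J J ℂ)).to_subtype
      exact continuous_of_discreteTopology
    have hc' : ContinuousOn (fun x => (Complex.arg x : ℂ)) (spectrum ℂ (U : Matrix J J ℂ)) :=
      Complex.continuous_ofReal.comp_continuousOn hc
    have hU : IsStarNormal (U : Matrix J J ℂ) := by
      constructor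
      have h1 := Unitary.star_mul_self_of_mem U.2
      have h2 := Unitary.mul_star_self_of_mem U.2
      rw [commute_iff_eq, h1, h2]
    change NormedSpace.exp (Complex.I • cfc (fun x => (Complex.arg x : ℂ)) (U : Matrix J J ℂ)) = _
    rw [← CFC.exp_eq_normedSpace_exp (𝕜 := ℂ),
      ← cfc_comp_smul .., ← cfc_comp' ..]
    conv_rhs => rw [← cfc_id' ℂ (U : Matrix J J ℂ)]
    refine cfc_congr fun y hy ↦ ?_
    have hy₁ : ‖y‖ = 1 := spectrum.norm_eq_one_of_unitary U.2 hy
    have hl : Complex.I * y.arg = Complex.log y :=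
      Complex.ext (by simp [Complex.log_re, hy₁]) (by simp [Complex.log_im])
    have hy0 : y ≠ 0 := by rintro rfl; simp at hy₁
    simpa [← Complex.exp_eq_exp_ℂ, hl] using Complex.exp_log hy0

lemma HasD.eq_const {f : unitaryGroup J ℂ → ℂ} {D} (h : HasD f D)
    (h0 : ∀ U K, D U K = 0) (U : unitaryGroup J ℂ) : f U = f 1 := by
  obtain ⟨K, rfl⟩ := exists_expU_eq U
  have h1 : ∀ s, HasDerivAt (fun t : ℝ => f (expU K t * 1)) 0 s := fun s => by
    simpa [h0] using h.deriv_at 1 K s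
  have h2 := is_const_of_deriv_eq_zero (fun s => (h1 s).differentiableAt) (fun s => (h1 s).deriv) 1 0
  simpa [expU_zero] using h2

lemma HasD.conj {f : unitaryGroup J ℂ → ℂ} {D} (h : HasD f D) :
    HasD (fun U => starRingEnd ℂ (f U)) (fun U K => -starRingEnd ℂ (D U (star K))) where
  cont := Complex.continuous_conj.comp h.cont
  dcont K := (Complex.continuous_conj.comp (h.dcont _)).neg
  map_add U K L := by simp only [star_add, h.map_add, _root_.map_add, neg_add]
  map_smul U c K := by
    simp only [star_smul, h.map_smul, smul_eq_mul, _root_.map_mul, mul_neg]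
    simp
  deriv U K := by
    have h1 : star (K : Matrix J J ℂ) = (-1 : ℂ) • (K : Matrix J J ℂ) := by
      have : star (K : Matrix J J ℂ) = -K := K.2
      simp [this]
    rw [h1, h.map_smul]
    have := (Complex.conjCLE.toContinuousLinearMap.hasFDerivAt).comp_hasDerivAt (0 : ℝ)
      (h.deriv U K)
    have h2 : -starRingEnd ℂ ((-1 : ℂ) • D U (K : Matrix J J ℂ)) =
        Complex.conjCLE.toContinuousLinearMap (D U K) := by simp
    rw [h2]
    exact this

/-- Integration by parts on the unitary group. -/
lemma HasD.integral_parts {f g : unitaryGroup J ℂ → ℂ} {D E} (hf : HasD f D) (hg : HasD g E)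
    (K : Matrix J J ℂ) :
    ∫ U, starRingEnd ℂ (D U (star K)) * g U ∂(uHaar J) =
      ∫ U, starRingEnd ℂ (f U) * E U K ∂(uHaar J) := by
  have h := (hf.conj.mul hg).integral_eq_zero K
  have c1 : Continuous fun U => starRingEnd ℂ (D U (star K)) * g U :=
    (Complex.continuous_conj.comp (hf.dcont _)).mul hg.cont
  have c2 : Continuous fun U => starRingEnd ℂ (f U) * E U K :=
    (Complex.continuous_conj.comp hf.cont).mul (hg.dcont _)
  have h2 : ∀ U, -starRingEnd ℂ (D U (star K)) * g U + starRingEnd ℂ (f U) * E U K =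
    starRingEnd ℂ (f U) * E U K - starRingEnd ℂ (D U (star K)) * g U := fun U => by ring
  simp only [h2] at h
  rw [integral_sub (uHaar_integrable c2) (uHaar_integrable c1), sub_eq_zero] at h
  exact h.symm

lemma eq_zero_of_integral_norm_sq {f : unitaryGroup J ℂ → ℂ} (hf : Continuous f)
    (h : ∫ U, ‖f U‖ ^ 2 ∂(uHaar J) = 0) (U : unitaryGroup J ℂ) : f U = 0 := by
  have h1 := (integral_eq_zero_iff_of_nonneg (fun U => sq_nonneg ‖f U‖)
    (uHaar_integrable (hf.norm.pow 2))).1 h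
  have h2 := (Continuous.ae_eq_iff_eq (uHaar J) (hf.norm.pow 2) continuous_zero).1 h1
  have := congrFun h2 U
  simpa using this

lemma integral_conj_mul_self {f : unitaryGroup J ℂ → ℂ} :
    ∫ U, starRingEnd ℂ (f U) * f U ∂(uHaar J) = ((∫ U, ‖f U‖ ^ 2 ∂(uHaar J) : ℝ) : ℂ) := by
  rw [← integral_complex_ofReal]
  congr 1
  funext U
  rw [Complex.conj_mul']
  push_cast
  rfl

end Parts

/-! ### A spectral gap for polynomials on the adjoint orbit -/


section Gap

variable {J : Type*} [Fintype J] [DecidableEq J]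

/-- Polynomials in the entries of the matrices `U E U*`, where `E` runs over matrix units. -/
abbrev PolyU (J : Type*) := MvPolynomial ((J × J) × J × J) ℂ

/-- Evaluation of a polynomial at a unitary. -/
def evU (p : PolyU J) (U : unitaryGroup J ℂ) : ℂ :=
  MvPolynomial.aeval (fun v : (J × J) × J × J =>
    conjU (Matrix.single v.1.1 v.1.2 1) U v.2.1 v.2.2) p

/-- The generic matrix attached to a matrix unit. -/
def genericMat (c : J × J) : Matrix J J (PolyU J) := fun a b => MvPolynomial.X (c, a, b)

/-- A scalar matrix viewed as a matrix of constant polynomials. -/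
def cmat (K : Matrix J J ℂ) : Matrix J J (PolyU J) := K.map MvPolynomial.C

/-- The derivation of `PolyU J` induced by the vector field generated by `K`. -/
def pder (K : Matrix J J ℂ) : Derivation ℂ (PolyU J) (PolyU J) :=
  MvPolynomial.mkDerivation ℂ fun v =>
    (cmat K * genericMat v.1 - genericMat v.1 * cmat K) v.2.1 v.2.2

lemma pder_X (K : Matrix J J ℂ) (v : (J × J) × J × J) : pder K (MvPolynomial.X v) =
    (cmat K * genericMat v.1 - genericMat v.1 * cmat K)
      v.2.1 v.2.2 :=
  MvPolynomial.mkDerivation_X ..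

lemma pder_generic (K : Matrix J J ℂ) (c : J × J) : (genericMat c).map (pder K) =
    cmat K * genericMat c - genericMat c * cmat K := by
  ext1 a b
  exact pder_X K (c, a, b)

lemma pder_C (K : Matrix J J ℂ) (c : ℂ) : pder K (MvPolynomial.C c) = 0 :=
  Derivation.map_algebraMap _ _

lemma map_C_mul_pder (K L : Matrix J J ℂ) (M : Matrix J J (PolyU J)) :
    (cmat L * M).map (pder K) = cmat L * M.map (pder K) := by
  ext1 a b
  simp [Matrix.mul_apply, pder_C, cmat]

lemma mul_map_C_pder (K L : Matrix J J ℂ) (M : Matrix J J (PolyU J)) :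
    (M * cmat L).map (pder K) = M.map (pder K) * cmat L := by
  ext1 a b
  simp [Matrix.mul_apply, pder_C, cmat, mul_comm]

lemma pder_add (K L : Matrix J J ℂ) : pder (K + L) = pder K + pder L := by
  refine MvPolynomial.derivation_ext fun v => ?_
  have : cmat (K + L) = cmat K +
    cmat L := by ext1; simp [cmat]
  rw [Derivation.add_apply, pder_X, pder_X, pder_X, this, add_mul, mul_add, ← Matrix.add_apply]
  have e : cmat K * genericMat v.1 + cmat L * genericMat v.1 -
      (genericMat v.1 * cmat K + genericMat v.1 * cmat L) =
      cmat K * genericMat v.1 - genericMat v.1 * cmat K +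
        (cmat L * genericMat v.1 - genericMat v.1 * cmat L) := by abel
  rw [e]

lemma pder_smul (c : ℂ) (K : Matrix J J ℂ) : pder (c • K) = c • pder K := by
  refine MvPolynomial.derivation_ext fun v => ?_
  have : cmat (c • K) = c • cmat K := by
    ext1; simp [cmat, MvPolynomial.smul_eq_C_mul]
  rw [Derivation.smul_apply, pder_X, pder_X, this, ← Matrix.smul_apply, smul_sub, smul_mul_assoc,
    mul_smul_comm]

lemma pder_neg (K : Matrix J J ℂ) : pder (-K) = -pder K := by
  rw [← neg_one_smul ℂ K, pder_smul]
  ext1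
  simp

lemma pder_sub (K L : Matrix J J ℂ) : pder (K - L) = pder K - pder L := by
  rw [sub_eq_add_neg, pder_add, pder_neg, ← sub_eq_add_neg]

lemma pder_zero : pder (0 : Matrix J J ℂ) = 0 := by
  have := pder_smul 0 (0 : Matrix J J ℂ)
  simpa using this

lemma pder_sum {κ : Type*} (s : Finset κ) (K : κ → Matrix J J ℂ) (p : PolyU J) :
    pder (∑ i ∈ s, K i) p = ∑ i ∈ s, pder (K i) p := by
  classical
  induction s using Finset.induction_on with
  | empty => simp [pder_zero]
  | insert a s ha ih => rw [Finset.sum_insert ha, Finset.sum_insert ha, pder_add,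
      Derivation.add_apply, ih]

lemma pder_one : pder (1 : Matrix J J ℂ) = 0 := by
  refine MvPolynomial.derivation_ext fun v => ?_
  have e : cmat (1 : Matrix J J ℂ) = 1 := Matrix.map_one _ (map_zero _) (map_one _)
  rw [pder_X, e]
  simp

lemma pder_commutator (K L : Matrix J J ℂ) (p : PolyU J) :
    pder K (pder L p) - pder L (pder K p) = -pder (K * L - L * K) p := by
  have h : ⁅pder K, pder L⁆ = -pder (K * L - L * K) := by
    refine MvPolynomial.derivation_ext fun v => ?_
    rw [Derivation.commutator_apply, Derivation.neg_apply]
    have e1 : ∀ K L : Matrix J J ℂ, pder K (pder L (MvPolynomial.X v)) =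
        (cmat L * (cmat K * genericMat v.1 -
          genericMat v.1 * cmat K) - (cmat K * genericMat v.1 -
          genericMat v.1 * cmat K) * cmat L) v.2.1 v.2.2 := by
      intro K L
      rw [pder_X, Matrix.sub_apply, map_sub]
      have h1 := congrFun (congrFun (map_C_mul_pder K L (genericMat v.1)) v.2.1) v.2.2
      have h2 := congrFun (congrFun (mul_map_C_pder K L (genericMat v.1)) v.2.1) v.2.2
      rw [pder_generic] at h1 h2
      rw [Matrix.sub_apply, ← h1, ← h2]
      rfl
    have e2 : cmat (K * L - L * K) =
        cmat K * cmat L -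
          cmat L * cmat K := by
      unfold cmat
      rw [← Matrix.map_mul, ← Matrix.map_mul, ← Matrix.map_sub _ (fun a b => map_sub _ a b)]
    rw [e1, e1, pder_X, e2, ← Matrix.sub_apply, ← Matrix.neg_apply]
    have e : ∀ k l g : Matrix J J (PolyU J), l * (k * g - g * k) - (k * g - g * k) * l -
        (k * (l * g - g * l) - (l * g - g * l) * k) =
        -((k * l - l * k) * g - g * (k * l - l * k)) := by
      intro k l g
      noncomm_ring
    rw [e]
  rw [← Derivation.commutator_apply, h, Derivation.neg_apply]

lemma evU_add (p q : PolyU J) (U) : evU (p + q) U = evU p U + evU q U := map_add ..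
lemma evU_sub (p q : PolyU J) (U) : evU (p - q) U = evU p U - evU q U := map_sub ..
lemma evU_mul (p q : PolyU J) (U) : evU (p * q) U = evU p U * evU q U := map_mul ..
lemma evU_zero (U) : evU (0 : PolyU J) U = 0 := map_zero _
lemma evU_C (c : ℂ) (U) : evU (MvPolynomial.C c : PolyU J) U = c := by simp [evU]
lemma evU_X (v) (U) : evU (MvPolynomial.X v : PolyU J) U =
    conjU (Matrix.single v.1.1 v.1.2 1) U v.2.1 v.2.2 := by simp [evU]
lemma evU_sum {κ : Type*} (s : Finset κ) (p : κ → PolyU J) (U) :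
    evU (∑ i ∈ s, p i) U = ∑ i ∈ s, evU (p i) U := map_sum ..

lemma evU_map_C_mul (K : Matrix J J ℂ) (v : (J × J) × J × J) (U : unitaryGroup J ℂ) :
    evU (pder K (MvPolynomial.X v)) U =
      (K * conjU (Matrix.single v.1.1 v.1.2 1) U - conjU (Matrix.single v.1.1 v.1.2 1) U * K)
        v.2.1 v.2.2 := by
  rw [pder_X]
  simp [Matrix.mul_apply, genericMat, cmat, evU_sub, evU_sum, evU_mul, evU_C, evU_X]

lemma hasD_evU (p : PolyU J) : HasD (evU p) (fun U K => evU (pder K p) U) := by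
  induction p using MvPolynomial.induction_on with
  | C c =>
    refine ((HasD.const c).congr_left fun U => (evU_C c U).symm).congr fun U K => ?_
    rw [pder_C, evU_zero]
  | add p q hp hq =>
    refine ((hp.add hq).congr_left fun U => (evU_add p q U).symm).congr fun U K => ?_
    rw [map_add, evU_add]
  | mul_X p v hp =>
    have hX : HasD (evU (MvPolynomial.X v : PolyU J))
        (fun U K => evU (pder K (MvPolynomial.X v)) U) := by
      refine (((hasD_conjU (Matrix.single v.1.1 v.1.2 1)).lin
        (Matrix.entryLinearMap ℂ ℂ v.2.1 v.2.2)).congr_left fun U => ?_).congr fun U K => ?_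
      · rw [evU_X]; rfl
      · rw [evU_map_C_mul]; rfl
    refine ((hp.mul hX).congr_left fun U => (evU_mul p _ U).symm).congr fun U K => ?_
    rw [Derivation.leibniz, evU_add, smul_eq_mul, smul_eq_mul, evU_mul, evU_mul]
    ring

/-- The matrix unit derivations. -/
def pdu (a b : J) : Derivation ℂ (PolyU J) (PolyU J) := pder (Matrix.single a b 1)

/-- The Casimir operator. -/
def casimir : PolyU J →ₗ[ℂ] PolyU J :=
  ∑ a : J, ∑ b : J, (pdu b a : PolyU J →ₗ[ℂ] PolyU J) ∘ₗ (pdu a b : PolyU J →ₗ[ℂ] PolyU J)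

lemma casimir_apply (p : PolyU J) : casimir p = ∑ a : J, ∑ b : J, pdu b a (pdu a b p) := by
  simp [casimir]

lemma pdu_commutator (a b c d : J) (p : PolyU J) :
    pdu a b (pdu c d p) - pdu c d (pdu a b p) =
      (if d = a then pdu c b p else 0) - (if b = c then pdu a d p else 0) := by
  unfold pdu
  rw [pder_commutator, pder_sub, Derivation.sub_apply, neg_sub]
  congr 1
  · split_ifs with h
    · subst h; simp
    · rw [Matrix.single_mul_single_of_ne _ _ _ _ h, pder_zero]; simp
  · split_ifs with h
    · subst h; simp
    · rw [Matrix.single_mul_single_of_ne _ _ _ _ h, pder_zero]; simp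

lemma casimir_pdu (c d : J) (p : PolyU J) : casimir (pdu c d p) = pdu c d (casimir p) := by
  rw [casimir_apply, casimir_apply, map_sum, ← sub_eq_zero, ← Finset.sum_sub_distrib]
  simp only [map_sum, ← Finset.sum_sub_distrib]
  have e : ∀ a b, pdu b a (pdu a b (pdu c d p)) - pdu c d (pdu b a (pdu a b p)) =
      (pdu b a (if d = a then pdu c b p else 0) - pdu b a (if b = c then pdu a d p else 0)) +
      ((if d = b then pdu c a (pdu a b p) else 0) - (if a = c then pdu b d (pdu a b p) else 0)) := by
    intro a b
    rw [← map_sub, ← pdu_commutator a b c d p, ← pdu_commutator b a c d, map_sub]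
    abel
  simp only [e, apply_ite (pdu _ _), map_zero]
  simp only [Finset.sum_add_distrib, Finset.sum_sub_distrib]
  rw [Finset.sum_comm (f := fun a b => if d = a then pdu b a (pdu c b p) else 0),
    Finset.sum_comm (f := fun a b => if a = c then pdu b d (pdu a b p) else 0)]
  simp

end Gap

/-! ### The Poincaré inequality on the adjoint orbit -/


section Bochner

variable {J : Type*} [Fintype J] [DecidableEq J]

lemma continuous_evU (p : PolyU J) : Continuous (evU p) := (hasD_evU p).cont

/-- The `L²` inner product of two polynomials. -/
def ipU (p q : PolyU J) : ℂ := ∫ U, (starRingEnd ℂ) (evU p U) * evU q U ∂uHaar J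

/-- The squared `L²` norm of a polynomial. -/
def nrmU (p : PolyU J) : ℝ := ∫ U, ‖evU p U‖ ^ 2 ∂uHaar J

lemma ipU_self (p : PolyU J) : ipU p p = (nrmU p : ℂ) :=
  integral_conj_mul_self

lemma nrmU_nonneg (p : PolyU J) : 0 ≤ nrmU p := integral_nonneg fun _ => by positivity

lemma ipU_pdu (a b : J) (p q : PolyU J) : ipU (pdu b a p) q = ipU p (pdu a b q) := by
  have h := HasD.integral_parts (hasD_evU p) (hasD_evU q) (Matrix.single a b 1)
  have e : star (Matrix.single a b (1 : ℂ)) = Matrix.single b a 1 := by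
    rw [Matrix.star_eq_conjTranspose, Matrix.conjTranspose_single]; simp
  rw [e] at h
  exact h

lemma ipU_sum_right {κ : Type*} (s : Finset κ) (p : PolyU J) (q : κ → PolyU J) :
    ipU p (∑ i ∈ s, q i) = ∑ i ∈ s, ipU p (q i) := by
  unfold ipU
  rw [← integral_finsetSum]
  · simp [evU_sum, Finset.mul_sum]
  · intro i _
    exact uHaar_integrable ((continuous_evU p).star.mul (continuous_evU (q i)))

lemma ipU_sum_left {κ : Type*} (s : Finset κ) (p : κ → PolyU J) (q : PolyU J) :
    ipU (∑ i ∈ s, p i) q = ∑ i ∈ s, ipU (p i) q := by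
  unfold ipU
  rw [← integral_finsetSum]
  · simp [evU_sum, Finset.sum_mul]
  · intro i _
    exact uHaar_integrable ((continuous_evU (p i)).star.mul (continuous_evU q))

lemma ipU_casimir_right (p q : PolyU J) :
    ipU p (casimir q) = ∑ a, ∑ b, ipU (pdu a b p) (pdu a b q) := by
  rw [casimir_apply]
  simp only [ipU_sum_right, ipU_pdu]

lemma ipU_casimir_left (p q : PolyU J) :
    ipU (casimir p) q = ∑ a, ∑ b, ipU (pdu a b p) (pdu a b q) := by
  rw [casimir_apply]
  simp only [ipU_sum_left, ipU_pdu]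

lemma nrmU_casimir (u : PolyU J) :
    nrmU (casimir u) = ∑ a, ∑ b, ∑ c, ∑ d, nrmU (pdu c d (pdu a b u)) := by
  have h : ipU (casimir u) (casimir u) =
      ∑ a, ∑ b, ∑ c, ∑ d, ipU (pdu c d (pdu a b u)) (pdu c d (pdu a b u)) := by
    rw [ipU_casimir_right]
    simp only [← casimir_pdu, ipU_casimir_left]
  simp only [ipU_self] at h
  exact_mod_cast h

lemma sum_norm_sq_commutator (t : J → J → ℂ) (ht : ∑ a, t a a = 0) :
    ∑ a, ∑ b, ∑ c, ∑ d, ‖(if d = a then t c b else 0) - (if b = c then t a d else 0)‖ ^ 2 =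
      2 * Fintype.card J * ∑ a, ∑ b, ‖t a b‖ ^ 2 := by
  have e : ∀ a b c d, ‖(if d = a then t c b else 0) - (if b = c then t a d else 0)‖ ^ 2 =
      (if d = a then ‖t c b‖ ^ 2 else 0) -
        2 * (if d = a then (if b = c then (starRingEnd ℂ (t c b) * t a d).re else 0) else 0) +
        (if b = c then ‖t a d‖ ^ 2 else 0) := by
    intro a b c d
    rw [@norm_sub_sq ℂ]
    split_ifs <;> simp [mul_comm]
  simp only [e, Finset.sum_add_distrib, Finset.sum_sub_distrib, ← Finset.mul_sum]
  have h2 : ∑ a, ∑ b, (starRingEnd ℂ (t b b) * t a a).re = 0 := by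
    simp only [← Complex.re_sum, ← Finset.sum_mul, ← map_sum, ht]
    simp
  have h3 : ∀ a b c : J, ∑ d, (if b = c then ‖t a d‖ ^ 2 else 0) =
      if b = c then ∑ d, ‖t a d‖ ^ 2 else 0 := by
    intro a b c
    split_ifs <;> simp
  simp only [h3, Finset.sum_ite_eq', Finset.sum_ite_eq, Finset.mem_univ, if_true, h2,
    Finset.sum_const, Finset.card_univ, nsmul_eq_mul, ← Finset.mul_sum]
  rw [Finset.sum_comm (f := fun a b => ‖t b a‖ ^ 2)]
  ring

lemma sum_pdu_diag (u : PolyU J) : ∑ a, pdu a a u = 0 := by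
  unfold pdu
  rw [← pder_sum]
  have : ∑ a : J, Matrix.single a a (1 : ℂ) = 1 := by
    simpa using (Matrix.sum_single_one (m := J) (α := ℂ))
  rw [this, pder_one]
  rfl

lemma norm_sub_sq_le_two (x y : ℂ) : ‖x - y‖ ^ 2 ≤ 2 * ‖x‖ ^ 2 + 2 * ‖y‖ ^ 2 := by
  have := norm_sub_le x y
  nlinarith [sq_nonneg (‖x‖ - ‖y‖), norm_nonneg (x - y), norm_nonneg x, norm_nonneg y]

/-- The spectral gap inequality for the Casimir operator. -/
lemma gap_casimir (u : PolyU J) :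
    (Fintype.card J : ℝ) / 2 * ∑ a, ∑ b, nrmU (pdu a b u) ≤ nrmU (casimir u) := by
  have hintg : ∀ p : PolyU J, Integrable (fun U => ‖evU p U‖ ^ 2) (uHaar J) := fun p =>
    uHaar_integrable ((continuous_evU p).norm.pow 2)
  have key : ∀ U, 2 * Fintype.card J * ∑ a, ∑ b, ‖evU (pdu a b u) U‖ ^ 2 ≤
      4 * ∑ a, ∑ b, ∑ c, ∑ d, ‖evU (pdu c d (pdu a b u)) U‖ ^ 2 := by
    intro U
    rw [← sum_norm_sq_commutator]
    · have h4 : ∑ a, ∑ b, ∑ c, ∑ d, (2 * ‖evU (pdu a b (pdu c d u)) U‖ ^ 2 +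
          2 * ‖evU (pdu c d (pdu a b u)) U‖ ^ 2) =
          4 * ∑ a, ∑ b, ∑ c, ∑ d, ‖evU (pdu c d (pdu a b u)) U‖ ^ 2 := by
        simp only [Finset.sum_add_distrib, ← Finset.mul_sum]
        have : ∑ a, ∑ b, ∑ c, ∑ d, ‖evU (pdu a b (pdu c d u)) U‖ ^ 2 =
            ∑ a, ∑ b, ∑ c, ∑ d, ‖evU (pdu c d (pdu a b u)) U‖ ^ 2 := by
          simp only [← Fintype.sum_prod_type']
          rw [← (Equiv.prodAssoc J J (J × J)).sum_comp, ← (Equiv.prodAssoc J J (J × J)).sum_comp,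
            ← (Equiv.prodComm (J × J) (J × J)).sum_comp]
          rfl
        rw [this]; ring
      rw [← h4]
      gcongr with a _ b _ c _ d _
      refine le_trans (le_of_eq ?_) (norm_sub_sq_le_two _ _)
      rw [← evU_sub, pdu_commutator, evU_sub]
      split_ifs <;> simp [evU_zero]
    · rw [← evU_sum, sum_pdu_diag, evU_zero]
  have hI := integral_mono (μ := uHaar J) (f := fun U => 2 * (Fintype.card J : ℝ) *
      ∑ a, ∑ b, ‖evU (pdu a b u) U‖ ^ 2)
    (g := fun U => 4 * ∑ a, ∑ b, ∑ c, ∑ d, ‖evU (pdu c d (pdu a b u)) U‖ ^ 2)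
    (by
      refine Integrable.const_mul ?_ _
      exact integrable_finsetSum _ fun a _ => integrable_finsetSum _ fun b _ => hintg _)
    (by
      refine Integrable.const_mul ?_ _
      exact integrable_finsetSum _ fun a _ => integrable_finsetSum _ fun b _ =>
        integrable_finsetSum _ fun c _ => integrable_finsetSum _ fun d _ => hintg _)
    key
  rw [integral_const_mul, integral_const_mul] at hI
  have e1 : ∫ U, ∑ a, ∑ b, ‖evU (pdu a b u) U‖ ^ 2 ∂uHaar J = ∑ a, ∑ b, nrmU (pdu a b u) := by
    rw [integral_finsetSum _ fun a _ => integrable_finsetSum _ fun b _ => hintg _]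
    simp only [integral_finsetSum _ fun b _ => hintg _]
    rfl
  have e2 : ∫ U, ∑ a, ∑ b, ∑ c, ∑ d, ‖evU (pdu c d (pdu a b u)) U‖ ^ 2 ∂uHaar J =
      nrmU (casimir u) := by
    rw [nrmU_casimir, integral_finsetSum _ fun a _ => integrable_finsetSum _ fun b _ =>
        integrable_finsetSum _ fun c _ => integrable_finsetSum _ fun d _ => hintg _]
    refine Finset.sum_congr rfl fun a _ => ?_
    rw [integral_finsetSum _ fun b _ =>
        integrable_finsetSum _ fun c _ => integrable_finsetSum _ fun d _ => hintg _]
    refine Finset.sum_congr rfl fun b _ => ?_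
    rw [integral_finsetSum _ fun c _ => integrable_finsetSum _ fun d _ => hintg _]
    refine Finset.sum_congr rfl fun c _ => ?_
    rw [integral_finsetSum _ fun d _ => hintg _]
    rfl
  rw [e1, e2] at hI
  linarith

end Bochner

section Decomp

variable {J : Type*} [Fintype J] [DecidableEq J]

lemma exists_stable_submodule (p : PolyU J) : ∃ W : Submodule ℂ (PolyU J), W.FG ∧ p ∈ W ∧
    ∀ K, ∀ q ∈ W, pder K q ∈ W := by
  induction p using MvPolynomial.induction_on with
  | C c =>
    refine ⟨Submodule.span ℂ {1}, Submodule.fg_span (Set.finite_singleton _), ?_, ?_⟩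
    · rw [Submodule.mem_span_singleton]
      exact ⟨c, by rw [MvPolynomial.smul_eq_C_mul, mul_one]⟩
    · intro K q hq
      obtain ⟨a, rfl⟩ := Submodule.mem_span_singleton.1 hq
      simp
  | add p q hp hq =>
    obtain ⟨W, h1, h2, h3⟩ := hp
    obtain ⟨W', h1', h2', h3'⟩ := hq
    refine ⟨W ⊔ W', h1.sup h1', Submodule.add_mem_sup h2 h2', ?_⟩
    intro K r hr
    obtain ⟨x, hx, y, hy, rfl⟩ := Submodule.mem_sup.1 hr
    rw [map_add]
    exact Submodule.add_mem_sup (h3 K x hx) (h3' K y hy)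
  | mul_X p v hp =>
    obtain ⟨W, h1, h2, h3⟩ := hp
    let W' : Submodule ℂ (PolyU J) := Submodule.span ℂ (Set.range MvPolynomial.X)
    have hX : ∀ v, (MvPolynomial.X v : PolyU J) ∈ W' := fun v =>
      Submodule.subset_span ⟨v, rfl⟩
    have h3' : ∀ K, ∀ q ∈ W', pder K q ∈ W' := by
      intro K q hq
      induction hq using Submodule.span_induction with
      | mem x hx =>
        obtain ⟨v, rfl⟩ := hx
        rw [pder_X, Matrix.sub_apply, Matrix.mul_apply, Matrix.mul_apply]
        refine sub_mem (sum_mem fun i _ => ?_) (sum_mem fun i _ => ?_)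
        · have := W'.smul_mem (K v.2.1 i) (hX (v.1, i, v.2.2))
          rwa [MvPolynomial.smul_eq_C_mul] at this
        · have := W'.smul_mem (K i v.2.2) (hX (v.1, v.2.1, i))
          rwa [MvPolynomial.smul_eq_C_mul, mul_comm] at this
      | zero => simp
      | add x y _ _ hx hy => rw [map_add]; exact add_mem hx hy
      | smul a x _ hx => rw [Derivation.map_smul]; exact W'.smul_mem a hx
    refine ⟨W * W', h1.mul (Submodule.fg_span (Set.finite_range _)),
      Submodule.mul_mem_mul h2 (hX v), ?_⟩
    intro K q hq
    induction hq using Submodule.mul_induction_on' with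
    | mem_mul_mem m hm n hn =>
      rw [Derivation.leibniz, smul_eq_mul, smul_eq_mul, mul_comm n]
      exact add_mem (Submodule.mul_mem_mul hm (h3' K n hn)) (Submodule.mul_mem_mul (h3 K m hm) hn)
    | add x _ y _ hx hy => rw [map_add]; exact add_mem hx hy

lemma nrmU_eq_zero {p : PolyU J} (h : nrmU p = 0) (U) : evU p U = 0 :=
  eq_zero_of_integral_norm_sq (continuous_evU p) h U

lemma ipU_right_zero {p q : PolyU J} (h : ∀ U, evU q U = 0) : ipU p q = 0 := by
  simp [ipU, h]

lemma evU_casimir_null {q : PolyU J} (h : ∀ U, evU (casimir (casimir q)) U = 0) (U) :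
    evU (casimir q) U = 0 := by
  refine nrmU_eq_zero ?_ U
  have h1 : ipU (casimir q) (casimir q) = ipU q (casimir (casimir q)) := by
    rw [ipU_casimir_left, ipU_casimir_right]
  rw [ipU_right_zero h, ipU_self] at h1
  exact_mod_cast h1

lemma evU_pdu_null {q : PolyU J} (h : ∀ U, evU (casimir q) U = 0) (a b : J) (U) :
    evU (pdu a b q) U = 0 := by
  have h1 := ipU_casimir_right q q
  rw [ipU_right_zero h] at h1
  simp only [ipU_self] at h1
  have h2 : ∑ a, ∑ b, nrmU (pdu a b q) = 0 := by exact_mod_cast h1.symm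
  refine nrmU_eq_zero ?_ U
  rw [Finset.sum_eq_zero_iff_of_nonneg
    fun _ _ => Finset.sum_nonneg fun _ _ => nrmU_nonneg _] at h2
  have h3 := h2 a (Finset.mem_univ _)
  rw [Finset.sum_eq_zero_iff_of_nonneg fun _ _ => nrmU_nonneg _] at h3
  exact h3 b (Finset.mem_univ _)

lemma pder_eq_sum_pdu (K : Matrix J J ℂ) (p : PolyU J) :
    pder K p = ∑ a, ∑ b, K a b • pdu a b p := by
  conv_lhs => rw [Matrix.matrix_eq_sum_single K]
  rw [pder_sum]
  refine Finset.sum_congr rfl fun a _ => ?_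
  rw [pder_sum]
  refine Finset.sum_congr rfl fun b _ => ?_
  have : Matrix.single a b (K a b) = K a b • Matrix.single a b 1 := by
    rw [Matrix.smul_single, smul_eq_mul, mul_one]
  rw [this, pder_smul]
  rfl

lemma evU_smul (c : ℂ) (p : PolyU J) (U) : evU (c • p) U = c * evU p U := by
  rw [MvPolynomial.smul_eq_C_mul, evU_mul, evU_C]

lemma evU_const_of_casimir_null {q : PolyU J} (h : ∀ U, evU (casimir q) U = 0) (U) :
    evU q U = evU q 1 := by
  refine (hasD_evU q).eq_const (fun V K => ?_) U
  rw [pder_eq_sum_pdu]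
  simp [evU_sum, evU_smul, evU_pdu_null h]

/-- Every polynomial is, modulo constant functions, in the range of the Casimir operator. -/
lemma exists_casimir_eq (p : PolyU J) : ∃ (c : ℂ) (u : PolyU J),
    ∀ U, evU p U = c + evU (casimir u) U := by
  obtain ⟨W, hfg, hp, hst⟩ := exists_stable_submodule p
  have hc : ∀ q ∈ W, casimir q ∈ W := by
    intro q hq
    rw [casimir_apply]
    exact sum_mem fun a _ => sum_mem fun b _ => hst _ _ (hst _ _ hq)
  have : Module.Finite ℂ W := Module.Finite.iff_fg.2 hfg
  let f : Module.End ℂ W := casimir.restrict hc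
  have hf : ∀ x : W, ((f x : W) : PolyU J) = casimir (x : PolyU J) := fun x => rfl
  have hfm : ∀ (m : ℕ) (x : W), (((f ^ m) x : W) : PolyU J) = (casimir^[m]) (x : PolyU J) := by
    intro m
    induction m with
    | zero => intro x; rfl
    | succ m ih => intro x; rw [pow_succ, Module.End.mul_apply, ih, hf, Function.iterate_succ_apply]
  obtain ⟨m, hm, hm1⟩ := ((LinearMap.eventually_isCompl_ker_pow_range_pow f).and
    (eventually_ge_atTop 1)).exists
  have htop : (⟨p, hp⟩ : W) ∈ LinearMap.ker (f ^ m) ⊔ LinearMap.range (f ^ m) := by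
    rw [hm.sup_eq_top]; trivial
  obtain ⟨p0, hp0, w, ⟨x, rfl⟩, hsum⟩ := Submodule.mem_sup.1 htop
  have hnull : ∀ k : ℕ, (∀ U, evU (casimir^[k + 1] (p0 : PolyU J)) U = 0) →
      ∀ U, evU (casimir (p0 : PolyU J)) U = 0 := by
    intro k
    induction k with
    | zero => intro h; exact h
    | succ k ih =>
      intro h
      refine ih fun U => ?_
      rw [Function.iterate_succ_apply']
      refine evU_casimir_null (fun V => ?_) U
      have := h V
      rwa [Function.iterate_succ_apply', Function.iterate_succ_apply'] at this
  obtain ⟨k, rfl⟩ : ∃ k, m = k + 1 := ⟨m - 1, by omega⟩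
  have h0 : ∀ U, evU (casimir (p0 : PolyU J)) U = 0 := by
    refine hnull k fun U => ?_
    rw [← hfm, LinearMap.mem_ker.1 hp0]
    exact evU_zero U
  refine ⟨evU (p0 : PolyU J) 1, casimir^[k] (x : PolyU J), fun U => ?_⟩
  have e : p = (p0 : PolyU J) + casimir (casimir^[k] (x : PolyU J)) := by
    rw [← Function.iterate_succ_apply' (f := casimir), ← hfm]
    exact (congrArg Subtype.val hsum).symm
  conv_lhs => rw [e]
  rw [evU_add, evU_const_of_casimir_null h0]

/-- The complex conjugate of a polynomial function is a polynomial function. -/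
lemma exists_conj_evU (p : PolyU J) : ∃ q : PolyU J, ∀ U, evU q U = starRingEnd ℂ (evU p U) := by
  induction p using MvPolynomial.induction_on with
  | C c => exact ⟨MvPolynomial.C (starRingEnd ℂ c), fun U => by rw [evU_C, evU_C]⟩
  | add p q hp hq =>
    obtain ⟨p', hp'⟩ := hp
    obtain ⟨q', hq'⟩ := hq
    exact ⟨p' + q', fun U => by rw [evU_add, evU_add, hp', hq', map_add]⟩
  | mul_X p v hp =>
    obtain ⟨p', hp'⟩ := hp
    refine ⟨p' * MvPolynomial.X ((v.1.2, v.1.1), v.2.2, v.2.1), fun U => ?_⟩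
    rw [evU_mul, evU_mul, hp', map_mul, evU_X, evU_X]
    congr 1
    have : conjU (Matrix.single v.1.2 v.1.1 1) U = star (conjU (Matrix.single v.1.1 v.1.2 1) U) := by
      simp [conjU, Matrix.star_eq_conjTranspose, Matrix.conjTranspose_mul, mul_assoc]
    simp only [this]
    rfl

end Decomp

section Poincare

variable {J : Type*} [Fintype J] [DecidableEq J]

lemma continuous_conjU (A : Matrix J J ℂ) : Continuous (conjU A) := (hasD_conjU A).cont

/-- Continuous functions of the adjoint action are uniform limits of polynomials. -/
lemma exists_evU_approx {f : unitaryGroup J ℂ → ℂ} (hf : Continuous f)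
    (hinv : ∀ U V, (∀ A, conjU A U = conjU A V) → f U = f V) {ε : ℝ} (hε : 0 < ε) :
    ∃ p : PolyU J, ∀ U, ‖f U - evU p U‖ ≤ ε := by
  let Φ : unitaryGroup J ℂ → ((J × J) → Matrix J J ℂ) := fun U c =>
    conjU (Matrix.single c.1 c.2 1) U
  have hΦ : Continuous Φ := continuous_pi fun c => continuous_conjU _
  have hfΦ : ∀ U V, Φ U = Φ V → f U = f V := by
    intro U V h
    refine hinv U V fun A => ?_
    have e : ∀ W, conjU A W = ∑ a, ∑ b, A a b • conjU (Matrix.single a b 1) W := by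
      intro W
      have hA : A = ∑ a, ∑ b, A a b • Matrix.single a b (1 : ℂ) := by
        conv_lhs => rw [Matrix.matrix_eq_sum_single A]
        simp [Matrix.smul_single]
      conv_lhs => rw [hA]
      simp only [conjU, Finset.mul_sum, Finset.sum_mul, mul_smul_comm, smul_mul_assoc]
    rw [e, e]
    refine Finset.sum_congr rfl fun a _ => Finset.sum_congr rfl fun b _ => ?_
    rw [show conjU (Matrix.single a b 1) U = conjU (Matrix.single a b 1) V from congrFun h (a, b)]
  let Q : C(unitaryGroup J ℂ, Set.range Φ) :=
    ⟨Set.rangeFactorization Φ, hΦ.subtype_mk _⟩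
  have hQs : Function.Surjective Q := Set.rangeFactorization_surjective
  have hQ : IsQuotientMap Q := (Q.continuous.isClosedMap).isQuotientMap Q.continuous hQs
  have : CompactSpace (Set.range Φ) := isCompact_iff_compactSpace.1 (isCompact_range hΦ)
  have hfac : Function.FactorsThrough (⟨f, hf⟩ : C(unitaryGroup J ℂ, ℂ)) Q := by
    intro U V h
    exact hfΦ U V (congrArg Subtype.val h)
  let F : C(Set.range Φ, ℂ) := hQ.lift ⟨f, hf⟩ hfac
  have hF : ∀ U, F (Q U) = f U := by
    intro U
    exact congrArg (fun g : C(unitaryGroup J ℂ, ℂ) => g U) (hQ.lift_comp ⟨f, hf⟩ hfac)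
  let S : StarSubalgebra ℂ C(Set.range Φ, ℂ) :=
    { carrier := {g | ∃ p : PolyU J, ∀ U, g (Q U) = evU p U}
      mul_mem' := by
        rintro g h ⟨p, hp⟩ ⟨q, hq⟩
        exact ⟨p * q, fun U => by rw [evU_mul, ← hp, ← hq]; rfl⟩
      add_mem' := by
        rintro g h ⟨p, hp⟩ ⟨q, hq⟩
        exact ⟨p + q, fun U => by rw [evU_add, ← hp, ← hq]; rfl⟩
      algebraMap_mem' := fun c => ⟨MvPolynomial.C c, fun U => by rw [evU_C]; rfl⟩
      star_mem' := by
        rintro g ⟨p, hp⟩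
        obtain ⟨q, hq⟩ := exists_conj_evU p
        exact ⟨q, fun U => by rw [hq, ← hp]; rfl⟩ }
  have hS : S.SeparatesPoints := by
    intro x y hxy
    obtain ⟨U, rfl⟩ := hQs x
    obtain ⟨V, rfl⟩ := hQs y
    have h1 : Φ U ≠ Φ V := fun h => hxy (Subtype.ext h)
    obtain ⟨c, hc⟩ := Function.ne_iff.1 h1
    obtain ⟨a, ha⟩ := Function.ne_iff.1 hc
    obtain ⟨b, hb⟩ := Function.ne_iff.1 ha
    refine ⟨fun w => w.1 c a b, ⟨⟨fun w => w.1 c a b, ?_⟩, ⟨MvPolynomial.X (c, a, b), fun W => ?_⟩,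
      rfl⟩, hb⟩
    · have h2 : Continuous fun M : Matrix J J ℂ => M a b :=
        LinearMap.continuous_of_finiteDimensional (Matrix.entryLinearMap ℂ ℂ a b)
      exact h2.comp ((continuous_apply c).comp continuous_subtype_val)
    · rw [evU_X]; rfl
  have htop := ContinuousMap.starSubalgebra_topologicalClosure_eq_top_of_separatesPoints S hS
  have hmem : F ∈ S.topologicalClosure := by rw [htop]; trivial
  have hmem' : F ∈ closure (S : Set C(Set.range Φ, ℂ)) := hmem
  obtain ⟨g, ⟨p, hp⟩, hg⟩ := Metric.mem_closure_iff.1 hmem' ε hε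
  refine ⟨p, fun U => ?_⟩
  rw [← hF, ← hp, ← dist_eq_norm]
  exact (ContinuousMap.dist_apply_le_dist _).trans hg.le

lemma integral_evU_casimir (u : PolyU J) : ∫ U, evU (casimir u) U ∂uHaar J = 0 := by
  simp only [casimir_apply, evU_sum]
  have hi : ∀ p : PolyU J, Integrable (evU p) (uHaar J) := fun p =>
    uHaar_integrable (continuous_evU p)
  rw [integral_finsetSum _ fun a _ => integrable_finsetSum _ fun b _ => hi _]
  refine Finset.sum_eq_zero fun a _ => ?_
  rw [integral_finsetSum _ fun b _ => hi _]
  exact Finset.sum_eq_zero fun b _ => (hasD_evU (pdu a b u)).integral_eq_zero _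

lemma integral_conj_mul_casimir {f : unitaryGroup J ℂ → ℂ} {D} (hf : HasD f D) (u : PolyU J) :
    ∫ U, starRingEnd ℂ (f U) * evU (casimir u) U ∂uHaar J =
      ∑ a, ∑ b, ∫ U, starRingEnd ℂ (D U (Matrix.single a b 1)) * evU (pdu a b u) U ∂uHaar J := by
  simp only [casimir_apply, evU_sum, Finset.mul_sum]
  have hi : ∀ p : PolyU J, Integrable (fun U => starRingEnd ℂ (f U) * evU p U) (uHaar J) := fun p =>
    uHaar_integrable (hf.cont.star.mul (continuous_evU p))
  rw [integral_finsetSum _ fun a _ => integrable_finsetSum _ fun b _ => hi _]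
  refine Finset.sum_congr rfl fun a _ => ?_
  rw [integral_finsetSum _ fun b _ => hi _]
  refine Finset.sum_congr rfl fun b _ => ?_
  have h := HasD.integral_parts hf (hasD_evU (pdu a b u)) (Matrix.single b a 1)
  have e : star (Matrix.single b a (1 : ℂ)) = Matrix.single a b 1 := by
    rw [Matrix.star_eq_conjTranspose, Matrix.conjTranspose_single]; simp
  rw [e] at h
  exact h.symm

/-- The Poincaré inequality for functions on the unitary group factoring through the adjoint
action. -/
theorem poincare [Nonempty J] {f : unitaryGroup J ℂ → ℂ} {D} (hf : HasD f D)
    (hinv : ∀ U V, (∀ A, conjU A U = conjU A V) → f U = f V) :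
    ∫ U, ‖f U - ∫ V, f V ∂uHaar J‖ ^ 2 ∂uHaar J ≤
      2 / Fintype.card J * ∑ a, ∑ b, ∫ U, ‖D U (Matrix.single a b 1)‖ ^ 2 ∂uHaar J := by
  set c0 := ∫ V, f V ∂uHaar J with hc0
  set S := ∑ a, ∑ b, ∫ U, ‖D U (Matrix.single a b 1)‖ ^ 2 ∂uHaar J with hS
  set N : ℝ := (Fintype.card J : ℝ) with hN
  have hNpos : 0 < N := by rw [hN]; exact_mod_cast Fintype.card_pos
  have hf0 : HasD (fun U => f U - c0) D := by
    refine (hf.sub (HasD.const c0)).congr fun U K => ?_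
    simp
  refine le_of_forall_pos_le_add fun δ hδ => ?_
  obtain ⟨ε, hε, hεδ⟩ : ∃ ε : ℝ, 0 < ε ∧ 4 * ε ^ 2 ≤ δ := by
    refine ⟨Real.sqrt (δ / 4), by positivity, ?_⟩
    rw [Real.sq_sqrt (by positivity)]; linarith
  obtain ⟨p, hp⟩ := exists_evU_approx hf0.cont (fun U V h => by rw [hinv U V h]) hε
  obtain ⟨c, u, hcu⟩ := exists_casimir_eq p
  have hif : Integrable f (uHaar J) := uHaar_integrable hf.cont
  have hiu : Integrable (evU (casimir u)) (uHaar J) := uHaar_integrable (continuous_evU _)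
  have hc : ‖c‖ ≤ ε := by
    have e : ∫ U, ((f U - c0) - evU p U) ∂uHaar J = -c := by
      have e1 : ∀ U, (f U - c0) - evU p U = f U - (c0 + c) - evU (casimir u) U := by
        intro U; rw [hcu]; ring
      simp only [e1]
      have hi1 : Integrable (fun U => f U - (c0 + c)) (uHaar J) := hif.sub (integrable_const _)
      rw [integral_sub hi1 hiu, integral_sub hif (integrable_const _),
        integral_evU_casimir, ← hc0]
      simp
    have h2 := norm_integral_le_of_norm_le_const (μ := uHaar J) (C := ε)
      (f := fun U => (f U - c0) - evU p U) (Eventually.of_forall hp)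
    rw [e] at h2
    simpa using h2
  have hclose : ∀ U, ‖(f U - c0) - evU (casimir u) U‖ ≤ 2 * ε := by
    intro U
    have e1 : (f U - c0) - evU (casimir u) U = ((f U - c0) - evU p U) + c := by
      rw [hcu]; ring
    rw [e1]
    have := norm_add_le ((f U - c0) - evU p U) c
    linarith [hp U]
  have hpt : ∀ U, ‖f U - c0‖ ^ 2 ≤ 4 * ε ^ 2 +
      2 * (starRingEnd ℂ (f U - c0) * evU (casimir u) U).re - ‖evU (casimir u) U‖ ^ 2 := by
    intro U
    have h1 := @norm_sub_sq ℂ ℂ _ _ _ (f U - c0) (evU (casimir u) U)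
    have h2 : RCLike.re (inner ℂ (f U - c0) (evU (casimir u) U)) =
        (starRingEnd ℂ (f U - c0) * evU (casimir u) U).re := by
      simp [mul_comm]
    rw [h2] at h1
    have h3 : ‖(f U - c0) - evU (casimir u) U‖ ^ 2 ≤ (2 * ε) ^ 2 :=
      pow_le_pow_left₀ (norm_nonneg _) (hclose U) 2
    linarith
  have hcc : Continuous fun U => starRingEnd ℂ (f U - c0) * evU (casimir u) U :=
    hf0.cont.star.mul (continuous_evU _)
  have hire : Integrable (fun U => (starRingEnd ℂ (f U - c0) * evU (casimir u) U).re) (uHaar J) :=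
    uHaar_integrable (Complex.continuous_re.comp hcc)
  have hinr : Integrable (fun U => ‖evU (casimir u) U‖ ^ 2) (uHaar J) :=
    uHaar_integrable ((continuous_evU _).norm.pow 2)
  have hI := integral_mono (μ := uHaar J) (uHaar_integrable (hf0.cont.norm.pow 2))
    (((integrable_const _).add (hire.const_mul 2)).sub hinr) hpt
  simp only [Pi.add_apply, Pi.sub_apply, Pi.pow_apply] at hI
  have e3 : ∫ U, (4 * ε ^ 2 + 2 * (starRingEnd ℂ (f U - c0) * evU (casimir u) U).re -
      ‖evU (casimir u) U‖ ^ 2) ∂uHaar J = 4 * ε ^ 2 +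
      2 * ∫ U, (starRingEnd ℂ (f U - c0) * evU (casimir u) U).re ∂uHaar J - nrmU (casimir u) := by
    have hi1 : Integrable (fun U => 4 * ε ^ 2 +
        2 * (starRingEnd ℂ (f U - c0) * evU (casimir u) U).re) (uHaar J) :=
      (integrable_const _).add (hire.const_mul 2)
    rw [integral_sub hi1 hinr,
      integral_add (integrable_const _) (hire.const_mul 2), integral_const_mul 2, integral_const]
    simp only [nrmU, probReal_univ, one_smul]
  have hre : ∫ U, (starRingEnd ℂ (f U - c0) * evU (casimir u) U).re ∂uHaar J ≤
      S / N + 1 / 2 * nrmU (casimir u) := by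
    have h1 : ∫ U, (starRingEnd ℂ (f U - c0) * evU (casimir u) U).re ∂uHaar J =
        (∫ U, starRingEnd ℂ (f U - c0) * evU (casimir u) U ∂uHaar J).re :=
      integral_re (𝕜 := ℂ) (uHaar_integrable hcc)
    rw [h1, integral_conj_mul_casimir hf0, Complex.re_sum]
    have h2 : ∀ a b, (∫ U, starRingEnd ℂ (D U (Matrix.single a b 1)) *
        evU (pdu a b u) U ∂uHaar J).re ≤
        1 / N * (∫ U, ‖D U (Matrix.single a b 1)‖ ^ 2 ∂uHaar J) +
          N / 4 * nrmU (pdu a b u) := by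
      intro a b
      have hi1 : Integrable (fun U => ‖D U (Matrix.single a b 1)‖ ^ 2) (uHaar J) :=
        uHaar_integrable ((hf.dcont _).norm.pow 2)
      have hi2 : Integrable (fun U => ‖evU (pdu a b u) U‖ ^ 2) (uHaar J) :=
        uHaar_integrable ((continuous_evU _).norm.pow 2)
      unfold nrmU
      rw [← integral_const_mul, ← integral_const_mul, ← integral_add (hi1.const_mul _)
        (hi2.const_mul _)]
      refine (Complex.re_le_norm _).trans ((norm_integral_le_integral_norm _).trans ?_)
      refine integral_mono (uHaar_integrable ((hf.dcont _).star.mul (continuous_evU _)).norm)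
        ((hi1.const_mul _).add (hi2.const_mul _)) fun U => ?_
      simp only [norm_mul, RCLike.norm_conj, Pi.add_apply]
      set x := ‖D U (Matrix.single a b 1)‖
      set y := ‖evU (pdu a b u) U‖
      have h5 : 1 / N * x ^ 2 + N / 4 * y ^ 2 - x * y = 1 / N * (x - N / 2 * y) ^ 2 := by
        field_simp; ring
      have h6 : 0 ≤ 1 / N * (x - N / 2 * y) ^ 2 := by positivity
      linarith
    calc ∑ a, (∑ b, ∫ U, starRingEnd ℂ (D U (Matrix.single a b 1)) *
        evU (pdu a b u) U ∂uHaar J).re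
        ≤ ∑ a, ∑ b, (1 / N * (∫ U, ‖D U (Matrix.single a b 1)‖ ^ 2 ∂uHaar J) +
          N / 4 * nrmU (pdu a b u)) := by
          refine Finset.sum_le_sum fun a _ => ?_
          rw [Complex.re_sum]
          exact Finset.sum_le_sum fun b _ => h2 a b
      _ = S / N + 1 / 2 * (N / 2 * ∑ a, ∑ b, nrmU (pdu a b u)) := by
          simp only [Finset.sum_add_distrib, ← Finset.mul_sum, ← hS]
          ring
      _ ≤ _ := by
          have := gap_casimir u
          gcongr
  rw [e3] at hI
  have : 2 / N * S = 2 * (S / N) := by ring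
  rw [this]
  linarith

end Poincare

/-! ### Normalized traces, resolvents and the map `Theta` -/


section Basics

variable {J : Type*} [Fintype J] [DecidableEq J]

/-- The normalized trace. -/
def ntr (M : Matrix J J ℂ) : ℂ := (Fintype.card J : ℂ)⁻¹ * M.trace

lemma ntr_add (M N : Matrix J J ℂ) : ntr (M + N) = ntr M + ntr N := by
  simp [ntr, Matrix.trace_add, mul_add]

lemma ntr_sub (M N : Matrix J J ℂ) : ntr (M - N) = ntr M - ntr N := by
  simp [ntr, Matrix.trace_sub, mul_sub]

lemma ntr_smul (c : ℂ) (M : Matrix J J ℂ) : ntr (c • M) = c * ntr M := by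
  simp [ntr, Matrix.trace_smul]; ring

lemma ntr_sum {κ : Type*} (s : Finset κ) (M : κ → Matrix J J ℂ) :
    ntr (∑ i ∈ s, M i) = ∑ i ∈ s, ntr (M i) := by
  simp [ntr, Matrix.trace_sum, Finset.mul_sum]

lemma ntr_mul_comm (M N : Matrix J J ℂ) : ntr (M * N) = ntr (N * M) := by
  simp [ntr, Matrix.trace_mul_comm M N]

lemma ntr_one [Nonempty J] : ntr (1 : Matrix J J ℂ) = 1 := by
  simp [ntr]

/-- The normalized trace as a linear map. -/
def ntrL : Matrix J J ℂ →ₗ[ℂ] ℂ where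
  toFun := ntr
  map_add' := ntr_add
  map_smul' := ntr_smul

lemma sum_norm_sq_col_le (M : Matrix J J ℂ) (b : J) : ∑ a, ‖M a b‖ ^ 2 ≤ ‖M‖ ^ 2 := by
  have h := Matrix.l2_opNorm_mulVec M (EuclideanSpace.single b (1 : ℂ))
  rw [show ‖EuclideanSpace.single b (1 : ℂ)‖ = 1 by simp, mul_one] at h
  have h2 := pow_le_pow_left₀ (norm_nonneg _) h 2
  rw [EuclideanSpace.norm_sq_eq] at h2
  refine le_trans (le_of_eq ?_) h2
  refine Finset.sum_congr rfl fun a _ => ?_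
  simp

lemma sum_norm_sq_le (M : Matrix J J ℂ) : ∑ a, ∑ b, ‖M a b‖ ^ 2 ≤ Fintype.card J * ‖M‖ ^ 2 := by
  rw [Finset.sum_comm]
  calc ∑ b, ∑ a, ‖M a b‖ ^ 2 ≤ ∑ _b : J, ‖M‖ ^ 2 := Finset.sum_le_sum fun b _ =>
        sum_norm_sq_col_le M b
    _ = _ := by simp

lemma norm_coe_unitary_le (U : unitaryGroup J ℂ) : ‖(U : Matrix J J ℂ)‖ ≤ 1 := by
  have h := CStarRing.norm_star_mul_self (x := (U : Matrix J J ℂ))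
  rw [Unitary.star_mul_self_of_mem U.2] at h
  have h1 := CStarRing.norm_star_mul_self (x := (1 : Matrix J J ℂ))
  rw [star_one, one_mul] at h1
  have h2 : ‖(1 : Matrix J J ℂ)‖ ≤ 1 := by nlinarith [norm_nonneg (1 : Matrix J J ℂ)]
  nlinarith [norm_nonneg (U : Matrix J J ℂ)]

lemma norm_conjU (A : Matrix J J ℂ) (U : unitaryGroup J ℂ) : ‖conjU A U‖ = ‖A‖ := by
  unfold conjU
  rw [CStarRing.norm_mul_mem_unitary _ (Unitary.star_mem U.2), CStarRing.norm_mem_unitary_mul _ U.2]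

lemma trace_conjU (A : Matrix J J ℂ) (U : unitaryGroup J ℂ) : (conjU A U).trace = A.trace := by
  unfold conjU
  rw [Matrix.trace_mul_comm, ← mul_assoc, Unitary.star_mul_self_of_mem U.2, one_mul]

lemma ntr_conjU (A : Matrix J J ℂ) (U : unitaryGroup J ℂ) : ntr (conjU A U) = ntr A := by
  rw [ntr, trace_conjU, ntr]

lemma conjU_mul (A B : Matrix J J ℂ) (U : unitaryGroup J ℂ) :
    conjU (A * B) U = conjU A U * conjU B U := by
  unfold conjU
  calc (U : Matrix J J ℂ) * (A * B) * star (U : Matrix J J ℂ)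
      = U * A * 1 * (B * star (U : Matrix J J ℂ)) := by simp only [mul_one, mul_assoc]
    _ = _ := by
      rw [← Unitary.star_mul_self_of_mem U.2]; simp only [mul_assoc]

lemma conjU_one (U : unitaryGroup J ℂ) : conjU (1 : Matrix J J ℂ) U = 1 := by
  unfold conjU
  rw [mul_one, Unitary.mul_star_self_of_mem U.2]

lemma conjU_smul (c : ℂ) (A : Matrix J J ℂ) (U : unitaryGroup J ℂ) :
    conjU (c • A) U = c • conjU A U := by
  simp [conjU]

lemma conjU_sub (A B : Matrix J J ℂ) (U : unitaryGroup J ℂ) :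
    conjU (A - B) U = conjU A U - conjU B U := by
  simp [conjU, mul_sub, sub_mul]

lemma conjU_isHermitian {A : Matrix J J ℂ} (hA : A.IsHermitian) (U : unitaryGroup J ℂ) :
    (conjU A U).IsHermitian := by
  unfold conjU
  exact Matrix.isHermitian_mul_mul_conjTranspose _ hA

/-- The resolvent. -/
def resM (z : ℂ) (H : Matrix J J ℂ) : Matrix J J ℂ := Ring.inverse (z • 1 - H)

/-- The diagonalization of a Hermitian matrix. -/
lemma eq_conjU_diagonal {H : Matrix J J ℂ} (hH : H.IsHermitian) :
    H = conjU (diagonal fun i => (hH.eigenvalues i : ℂ)) hH.eigenvectorUnitary := by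
  have h := hH.spectral_theorem
  rw [Unitary.conjStarAlgAut_apply] at h
  exact h

lemma resM_eq_of_mul {z : ℂ} {H G : Matrix J J ℂ} (h : (z • 1 - H) * G = 1) :
    IsUnit (z • 1 - H) ∧ resM z H = G := by
  have h2 : G * (z • 1 - H) = 1 := mul_eq_one_comm.1 h
  let u : (Matrix J J ℂ)ˣ := ⟨z • 1 - H, G, h, h2⟩
  exact ⟨⟨u, rfl⟩, Ring.inverse_unit u⟩

lemma resM_spectral {H : Matrix J J ℂ} (hH : H.IsHermitian) {z : ℂ}
    (hz : ∀ i, z - hH.eigenvalues i ≠ 0) :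
    IsUnit (z • 1 - H) ∧ resM z H =
      conjU (diagonal fun i => 1 / (z - hH.eigenvalues i : ℂ)) hH.eigenvectorUnitary := by
  apply resM_eq_of_mul
  have h1 : z • 1 - H = conjU (diagonal fun i => (z - hH.eigenvalues i : ℂ))
      hH.eigenvectorUnitary := by
    conv_lhs => rw [eq_conjU_diagonal hH, ← conjU_one hH.eigenvectorUnitary, ← conjU_smul,
      ← conjU_sub]
    congr 1
    rw [Matrix.smul_one_eq_diagonal, Matrix.diagonal_sub]
  rw [h1, ← conjU_mul, Matrix.diagonal_mul_diagonal]
  have : (diagonal fun i => (z - hH.eigenvalues i : ℂ) * (1 / (z - hH.eigenvalues i : ℂ))) = 1 := by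
    rw [← Matrix.diagonal_one]
    congr 1
    funext i
    rw [mul_one_div, div_self (hz i)]
  rw [this, conjU_one]

lemma im_sub_ofReal_ne {z : ℂ} (hz : z.im ≠ 0) (x : ℝ) : z - x ≠ 0 := by
  intro h
  apply hz
  have := congrArg Complex.im h
  simpa using this

lemma isUnit_resolvent {H : Matrix J J ℂ} (hH : H.IsHermitian) {z : ℂ} (hz : z.im ≠ 0) :
    IsUnit (z • 1 - H) := (resM_spectral hH fun i => im_sub_ofReal_ne hz _).1

lemma resM_mul {H : Matrix J J ℂ} (hH : H.IsHermitian) {z : ℂ} (hz : z.im ≠ 0) :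
    resM z H * (z • 1 - H) = 1 := Ring.inverse_mul_cancel _ (isUnit_resolvent hH hz)

lemma mul_resM {H : Matrix J J ℂ} (hH : H.IsHermitian) {z : ℂ} (hz : z.im ≠ 0) :
    (z • 1 - H) * resM z H = 1 := Ring.mul_inverse_cancel _ (isUnit_resolvent hH hz)

lemma norm_resM_le {H : Matrix J J ℂ} (hH : H.IsHermitian) {z : ℂ} (hz : 0 < z.im) :
    ‖resM z H‖ ≤ 1 / z.im := by
  rw [(resM_spectral hH fun i => im_sub_ofReal_ne hz.ne' _).2, norm_conjU,
    Matrix.l2_opNorm_diagonal, pi_norm_le_iff_of_nonneg (by positivity)]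
  intro i
  rw [norm_div, norm_one]
  refine one_div_le_one_div_of_le hz ?_
  have := Complex.abs_im_le_norm (z - hH.eigenvalues i)
  rw [Complex.sub_im, Complex.ofReal_im, sub_zero, abs_of_pos hz] at this
  exact this

lemma ntr_resM {H : Matrix J J ℂ} (hH : H.IsHermitian) {z : ℂ} (hz : z.im ≠ 0) :
    ntr (resM z H) = (Fintype.card J : ℂ)⁻¹ * ∑ i, 1 / (z - hH.eigenvalues i : ℂ) := by
  rw [(resM_spectral hH fun i => im_sub_ofReal_ne hz _).2, ntr_conjU, ntr, Matrix.trace_diagonal]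

lemma abs_eigenvalues_le {H : Matrix J J ℂ} (hH : H.IsHermitian) (i : J) :
    |hH.eigenvalues i| ≤ ‖H‖ := by
  have h := eq_conjU_diagonal hH
  have h2 : ‖H‖ = ‖fun i => (hH.eigenvalues i : ℂ)‖ := by
    conv_lhs => rw [h]
    rw [norm_conjU, Matrix.l2_opNorm_diagonal]
  rw [h2]
  have := norm_le_pi_norm (fun i => (hH.eigenvalues i : ℂ)) i
  simpa using this

end Basics

section ThetaAlg

variable {n : ℕ} {ι : Type*} [Fintype ι] [DecidableEq ι]

/-- The matrix units of the first tensor factor. -/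
def eU (i j : Fin n) : Matrix (Fin n × ι) (Fin n × ι) ℂ := Matrix.single i j (1 : ℂ) ⊗ₖ 1

/-- Left factors in the expansion of `Theta`. -/
def tL : Option (Fin n × Fin n) → Matrix (Fin n × ι) (Fin n × ι) ℂ
  | none => 1
  | some q => eU q.1 q.2

/-- Right factors in the expansion of `Theta`. -/
def tR : Option (Fin n × Fin n) → Matrix (Fin n × ι) (Fin n × ι) ℂ
  | none => 1
  | some q => eU q.2 q.1

/-- Coefficients in the expansion of `Theta`. -/
def tc : Option (Fin n × Fin n) → ℂ
  | none => -1
  | some _ => n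

lemma eU_mul (i j k l : Fin n) : (eU i j : Matrix (Fin n × ι) (Fin n × ι) ℂ) * eU k l =
    if j = k then eU i l else 0 := by
  unfold eU
  rw [← Matrix.mul_kronecker_mul, mul_one]
  split_ifs with h
  · subst h; simp
  · rw [Matrix.single_mul_single_of_ne _ _ _ _ h, Matrix.zero_kronecker]

lemma star_eU (i j : Fin n) : star (eU i j : Matrix (Fin n × ι) (Fin n × ι) ℂ) = eU j i := by
  unfold eU
  rw [Matrix.star_eq_conjTranspose, Matrix.conjTranspose_kronecker]
  simp

lemma sum_eU_diag : ∑ i : Fin n, (eU i i : Matrix (Fin n × ι) (Fin n × ι) ℂ) = 1 := by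
  ext ⟨i, a⟩ ⟨j, b⟩
  simp [eU, Matrix.sum_apply, Matrix.kroneckerMap_apply, Matrix.single_apply, Matrix.one_apply,
    Prod.ext_iff, ite_and]
  split_ifs <;> rfl

lemma norm_eU_le (i j : Fin n) : ‖(eU i j : Matrix (Fin n × ι) (Fin n × ι) ℂ)‖ ≤ 1 := by
  have h1 : ‖(eU i i : Matrix (Fin n × ι) (Fin n × ι) ℂ)‖ ≤ 1 := by
    have h := CStarRing.norm_star_mul_self (x := (eU i i : Matrix (Fin n × ι) (Fin n × ι) ℂ))
    rw [star_eU, eU_mul, if_pos rfl] at h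
    nlinarith [norm_nonneg (eU i i : Matrix (Fin n × ι) (Fin n × ι) ℂ)]
  have h := CStarRing.norm_self_mul_star (x := (eU i j : Matrix (Fin n × ι) (Fin n × ι) ℂ))
  rw [star_eU, eU_mul, if_pos rfl] at h
  nlinarith [norm_nonneg (eU i j : Matrix (Fin n × ι) (Fin n × ι) ℂ)]

lemma norm_matrix_one_le {J : Type*} [Fintype J] [DecidableEq J] :
    ‖(1 : Matrix J J ℂ)‖ ≤ 1 := by
  simpa using norm_coe_unitary_le (1 : unitaryGroup J ℂ)

lemma norm_tL_le (s) : ‖(tL s : Matrix (Fin n × ι) (Fin n × ι) ℂ)‖ ≤ 1 := by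
  cases s
  · exact norm_matrix_one_le
  · exact norm_eU_le _ _

lemma norm_tR_le (s) : ‖(tR s : Matrix (Fin n × ι) (Fin n × ι) ℂ)‖ ≤ 1 := by
  cases s
  · exact norm_matrix_one_le
  · exact norm_eU_le _ _

lemma eU_mul_mul_eU (X : Matrix (Fin n × ι) (Fin n × ι) ℂ) (i j : Fin n) (p q : Fin n × ι) :
    (eU i j * X * eU j i : Matrix (Fin n × ι) (Fin n × ι) ℂ) p q = if p.1 = i ∧ q.1 = i then X (j, p.2) (j, q.2) else 0 := by
  obtain ⟨k, a⟩ := p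
  obtain ⟨l, b⟩ := q
  simp only [Matrix.mul_apply, eU, Matrix.kroneckerMap_apply, Matrix.single_apply, Matrix.one_apply,
    Fintype.sum_prod_type]
  by_cases hk : k = i <;> by_cases hl : l = i <;> simp [hk, hl, ite_and, eq_comm] <;> grind

lemma Theta_eq_sum (X : Matrix (Fin n × ι) (Fin n × ι) ℂ) :
    Theta X = ∑ s, tc s • (tL s * X * tR s) := by
  rw [Fintype.sum_option, Fintype.sum_prod_type]
  ext ⟨k, a⟩ ⟨l, b⟩
  simp only [tc, tL, tR, Matrix.add_apply, Matrix.sum_apply, Matrix.smul_apply, eU_mul_mul_eU,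
    Theta, Matrix.sub_apply, Matrix.kroneckerMap_apply, trOne, Matrix.one_apply, one_mul, mul_one]
  by_cases hkl : k = l
  · subst hkl
    simp [Finset.mul_sum]
    ring
  · have : ∀ x : Fin n, ¬(k = x ∧ l = x) := fun x h => hkl (h.1.trans h.2.symm)
    simp [hkl, this]

/-- `Theta` as a linear map. -/
def ThetaL : Matrix (Fin n × ι) (Fin n × ι) ℂ →ₗ[ℂ] Matrix (Fin n × ι) (Fin n × ι) ℂ where
  toFun := Theta
  map_add' X Y := by
    simp only [Theta_eq_sum, mul_add, add_mul, smul_add, Finset.sum_add_distrib]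
  map_smul' c X := by
    simp only [Theta_eq_sum, mul_smul_comm, smul_mul_assoc, Finset.smul_sum, RingHom.id_apply]
    exact Finset.sum_congr rfl fun s _ => smul_comm _ _ _

lemma Theta_sub (X Y : Matrix (Fin n × ι) (Fin n × ι) ℂ) : Theta (X - Y) = Theta X - Theta Y :=
  ThetaL.map_sub X Y

lemma Theta_smul (c : ℂ) (X : Matrix (Fin n × ι) (Fin n × ι) ℂ) : Theta (c • X) = c • Theta X :=
  ThetaL.map_smul c X

lemma Theta_one : Theta (1 : Matrix (Fin n × ι) (Fin n × ι) ℂ) = ((n : ℂ) ^ 2 - 1) • 1 := by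
  ext ⟨k, a⟩ ⟨l, b⟩
  simp only [Theta, Matrix.sub_apply, Matrix.smul_apply, Matrix.kroneckerMap_apply, trOne,
    Matrix.one_apply, Prod.mk.injEq, true_and, Finset.sum_const, Finset.card_univ,
    Fintype.card_fin]
  by_cases hkl : k = l <;> by_cases hab : a = b <;> simp [hkl, hab]
  ring

lemma norm_Theta_le (X : Matrix (Fin n × ι) (Fin n × ι) ℂ) :
    ‖Theta X‖ ≤ ((n : ℝ) ^ 3 + 1) * ‖X‖ := by
  rw [Theta_eq_sum, Fintype.sum_option]
  have h1 : ∀ s, ‖tL s * X * tR s‖ ≤ ‖X‖ := by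
    intro s
    calc ‖tL s * X * tR s‖ ≤ ‖(tL s : Matrix (Fin n × ι) (Fin n × ι) ℂ)‖ * ‖X‖ *
          ‖(tR s : Matrix (Fin n × ι) (Fin n × ι) ℂ)‖ :=
          (norm_mul_le _ _).trans (by gcongr; exact norm_mul_le _ _)
      _ ≤ 1 * ‖X‖ * 1 := by gcongr <;> [exact norm_tL_le s; exact norm_tR_le s]
      _ = ‖X‖ := by ring
  refine (norm_add_le _ _).trans ?_
  have h2 : ‖(tc (none : Option (Fin n × Fin n))) • (tL (none : Option (Fin n × Fin n)) * X *
      tR (none : Option (Fin n × Fin n)))‖ ≤ ‖X‖ := by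
    simp [tc, tL, tR]
  have h3 : ‖∑ q : Fin n × Fin n, (tc (some q) : ℂ) • (tL (some q) * X * tR (some q))‖ ≤
      ∑ _q : Fin n × Fin n, (n : ℝ) * ‖X‖ := by
    refine norm_sum_le_of_le _ fun q _ => ?_
    rw [norm_smul]
    simp only [tc, Complex.norm_natCast]
    gcongr
    exact h1 _
  simp at h3
  linarith

lemma trace_Theta_mul (X Y : Matrix (Fin n × ι) (Fin n × ι) ℂ) :
    (Theta X * Y).trace = (X * Theta Y).trace := by
  rw [Theta_eq_sum, Theta_eq_sum, Finset.sum_mul, Finset.mul_sum, Matrix.trace_sum,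
    Matrix.trace_sum, Fintype.sum_option, Fintype.sum_option]
  congr 1
  · simp [tc, tL, tR]
  · rw [Fintype.sum_prod_type, Fintype.sum_prod_type, Finset.sum_comm]
    refine Finset.sum_congr rfl fun i _ => Finset.sum_congr rfl fun j _ => ?_
    simp only [tc, tL, tR, smul_mul_assoc, mul_smul_comm, Matrix.trace_smul]
    congr 1
    rw [Matrix.mul_assoc, Matrix.mul_assoc, Matrix.trace_mul_comm]
    simp only [mul_assoc]

lemma Theta_isHermitian {X : Matrix (Fin n × ι) (Fin n × ι) ℂ} (hX : X.IsHermitian) :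
    (Theta X).IsHermitian := by
  unfold Matrix.IsHermitian
  rw [← Matrix.star_eq_conjTranspose, Theta_eq_sum, star_sum]
  refine Finset.sum_congr rfl fun s _ => ?_
  have hX' : star X = X := hX
  rw [star_smul, star_mul, star_mul, hX']
  cases s
  · simp [tc, tL, tR]
  · simp [tc, tL, tR, star_eU, mul_assoc]

lemma Theta_commutator (i j : Fin n) (X : Matrix (Fin n × ι) (Fin n × ι) ℂ) :
    Theta (eU i j * X - X * eU i j) = eU i j * Theta X - Theta X * eU i j := by
  have h1 : trOne (eU i j * X - X * eU i j) = 0 := by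
    ext a b
    simp only [trOne, Matrix.sub_apply, Matrix.mul_apply, eU, Matrix.kroneckerMap_apply,
      Matrix.single_apply, Matrix.one_apply, Fintype.sum_prod_type, Finset.sum_sub_distrib]
    simp [ite_and]
  have h2 : eU i j * ((1 : Matrix (Fin n) (Fin n) ℂ) ⊗ₖ trOne X) =
      ((1 : Matrix (Fin n) (Fin n) ℂ) ⊗ₖ trOne X) * eU i j := by
    unfold eU
    rw [← Matrix.mul_kronecker_mul, ← Matrix.mul_kronecker_mul]
    simp
  unfold Theta
  rw [h1, mul_sub, sub_mul, mul_smul_comm, smul_mul_assoc, h2]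
  simp

end ThetaAlg

/-! ### Variance bounds for resolvent functionals -/

section Variance

variable {J : Type*} [Fintype J] [DecidableEq J]

lemma ntr_single_mul (a b : J) (M : Matrix J J ℂ) :
    ntr (Matrix.single a b 1 * M) = (Fintype.card J : ℂ)⁻¹ * M b a := by
  simp [ntr, Matrix.trace_single_mul]

lemma variance_le [Nonempty J] {f : unitaryGroup J ℂ → ℂ} {D} (hf : HasD f D)
    {g : unitaryGroup J ℂ → Matrix J J ℂ} {c : ℝ} (hD : ∀ U K, D U K = ntr (K * g U))
    (hg : ∀ U, ‖g U‖ ≤ c) (hinv : ∀ U V, (∀ A, conjU A U = conjU A V) → f U = f V) :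
    ∫ U, ‖f U - ∫ V, f V ∂uHaar J‖ ^ 2 ∂uHaar J ≤ 2 * c ^ 2 / (Fintype.card J : ℝ) ^ 2 := by
  have hN : (0 : ℝ) < Fintype.card J := by exact_mod_cast Fintype.card_pos
  refine (poincare hf hinv).trans ?_
  have hintg : ∀ a b, Integrable (fun U => ‖D U (Matrix.single a b 1)‖ ^ 2) (uHaar J) := fun a b =>
    uHaar_integrable ((hf.dcont _).norm.pow 2)
  have h1 : ∑ a, ∑ b, ∫ U, ‖D U (Matrix.single a b 1)‖ ^ 2 ∂uHaar J ≤ c ^ 2 / Fintype.card J := by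
    have : ∑ a, ∑ b, ∫ U, ‖D U (Matrix.single a b 1)‖ ^ 2 ∂uHaar J =
        ∫ U, ∑ a, ∑ b, ‖D U (Matrix.single a b 1)‖ ^ 2 ∂uHaar J := by
      rw [integral_finsetSum _ fun a _ => integrable_finsetSum _ fun b _ => hintg a b]
      exact Finset.sum_congr rfl fun a _ => (integral_finsetSum _ fun b _ => hintg a b).symm
    rw [this]
    have hb : ∀ U, ∑ a, ∑ b, ‖D U (Matrix.single a b 1)‖ ^ 2 ≤ c ^ 2 / Fintype.card J := by
      intro U
      have e : ∀ a b, ‖D U (Matrix.single a b 1)‖ ^ 2 =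
          (Fintype.card J : ℝ)⁻¹ ^ 2 * ‖g U b a‖ ^ 2 := by
        intro a b
        rw [hD, ntr_single_mul, norm_mul, norm_inv, Complex.norm_natCast, mul_pow]
      simp only [e, ← Finset.mul_sum]
      rw [Finset.sum_comm]
      have h2 := sum_norm_sq_le (g U)
      have h3 : ‖g U‖ ^ 2 ≤ c ^ 2 := pow_le_pow_left₀ (norm_nonneg _) (hg U) 2
      calc (Fintype.card J : ℝ)⁻¹ ^ 2 * ∑ b, ∑ a, ‖g U b a‖ ^ 2
          ≤ (Fintype.card J : ℝ)⁻¹ ^ 2 * (Fintype.card J * c ^ 2) := by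
            gcongr
            exact h2.trans (by gcongr)
        _ = _ := by field_simp
    calc _ ≤ ∫ _U : unitaryGroup J ℂ, c ^ 2 / (Fintype.card J : ℝ) ∂uHaar J :=
          integral_mono (integrable_finsetSum _ fun a _ => integrable_finsetSum _ fun b _ =>
            hintg a b) (integrable_const _) hb
      _ = _ := by simp
  calc _ ≤ 2 / (Fintype.card J : ℝ) * (c ^ 2 / Fintype.card J) := by gcongr
    _ = _ := by field_simp

lemma covariance_le {f g : unitaryGroup J ℂ → ℂ} (hf : Continuous f) (hg : Continuous g)
    {v : ℝ} (hvf : ∫ U, ‖f U - ∫ V, f V ∂uHaar J‖ ^ 2 ∂uHaar J ≤ v)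
    (hvg : ∫ U, ‖g U - ∫ V, g V ∂uHaar J‖ ^ 2 ∂uHaar J ≤ v) :
    ‖∫ U, f U * g U ∂uHaar J - (∫ U, f U ∂uHaar J) * ∫ U, g U ∂uHaar J‖ ≤ v := by
  set a := ∫ U, f U ∂uHaar J
  set b := ∫ U, g U ∂uHaar J
  have e : ∫ U, f U * g U ∂uHaar J - a * b = ∫ U, (f U - a) * (g U - b) ∂uHaar J := by
    have e1 : ∀ U, (f U - a) * (g U - b) = f U * g U - a * g U - b * f U + a * b := fun U => by ring
    simp only [e1]
    rw [integral_add (uHaar_integrable (by fun_prop)) (integrable_const _),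
      integral_sub (uHaar_integrable (by fun_prop)) (uHaar_integrable (by fun_prop)),
      integral_sub (uHaar_integrable (by fun_prop)) (uHaar_integrable (by fun_prop)),
      integral_const_mul, integral_const_mul]
    simp only [integral_const, probReal_univ, one_smul]
    ring
  rw [e]
  calc ‖∫ U, (f U - a) * (g U - b) ∂uHaar J‖
      ≤ ∫ U, (1 / 2 * ‖f U - a‖ ^ 2 + 1 / 2 * ‖g U - b‖ ^ 2) ∂uHaar J := by
        refine norm_integral_le_of_norm_le (uHaar_integrable (by fun_prop)) (ae_of_all _ fun U => ?_)
        rw [norm_mul]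
        nlinarith [sq_nonneg (‖f U - a‖ - ‖g U - b‖)]
    _ = 1 / 2 * ∫ U, ‖f U - a‖ ^ 2 ∂uHaar J + 1 / 2 * ∫ U, ‖g U - b‖ ^ 2 ∂uHaar J := by
        rw [integral_add (uHaar_integrable (by fun_prop)) (uHaar_integrable (by fun_prop)),
          integral_const_mul, integral_const_mul]
    _ ≤ v := by linarith

end Variance

section Resolvent

variable {n : ℕ} {ι : Type*} [Fintype ι] [DecidableEq ι]

/-- The resolvent of `Theta (U X U*)`. -/
def GU (X : Matrix (Fin n × ι) (Fin n × ι) ℂ) (z : ℂ) (U : unitaryGroup (Fin n × ι) ℂ) :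
    Matrix (Fin n × ι) (Fin n × ι) ℂ := resM z (Theta (conjU X U))

lemma hasD_Theta (X : Matrix (Fin n × ι) (Fin n × ι) ℂ) :
    HasD (fun U => Theta (conjU X U)) (fun U K => Theta (K * conjU X U - conjU X U * K)) :=
  (hasD_conjU X).lin ThetaL

lemma hasD_GU {X : Matrix (Fin n × ι) (Fin n × ι) ℂ} (hX : X.IsHermitian) {z : ℂ}
    (hz : z.im ≠ 0) :
    HasD (GU X z) (fun U K => GU X z U * Theta (K * conjU X U - conjU X U * K) * GU X z U) := by
  have h := (HasD.const (J := Fin n × ι) (z • (1 : Matrix (Fin n × ι) (Fin n × ι) ℂ))).sub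
    (hasD_Theta X)
  have h2 := h.inverse (fun U => isUnit_resolvent (Theta_isHermitian (conjU_isHermitian hX U)) hz)
  refine (h2.congr_left (fun U => rfl)).congr fun U K => ?_
  simp only [GU, resM]
  noncomm_ring

lemma norm_GU_le {X : Matrix (Fin n × ι) (Fin n × ι) ℂ} (hX : X.IsHermitian) {z : ℂ}
    {η : ℝ} (hη : 0 < η) (hz : η ≤ z.im) (U) : ‖GU X z U‖ ≤ 1 / η :=
  (norm_resM_le (Theta_isHermitian (conjU_isHermitian hX U)) (hη.trans_le hz)).trans
    (one_div_le_one_div_of_le hη hz)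

lemma continuous_GU {X : Matrix (Fin n × ι) (Fin n × ι) ℂ} (hX : X.IsHermitian) {z : ℂ}
    (hz : z.im ≠ 0) : Continuous (GU X z) := (hasD_GU hX hz).cont

lemma GU_congr (X : Matrix (Fin n × ι) (Fin n × ι) ℂ) (z : ℂ) {U V : unitaryGroup (Fin n × ι) ℂ}
    (h : ∀ A, conjU A U = conjU A V) : GU X z U = GU X z V := by
  rw [GU, GU, h]

lemma continuous_ntr {J : Type*} [Fintype J] [DecidableEq J] :
    Continuous (ntr : Matrix J J ℂ → ℂ) := by
  unfold ntr
  exact continuous_const.mul (continuous_id.matrix_trace)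

lemma ntr_Theta_mul (X Y : Matrix (Fin n × ι) (Fin n × ι) ℂ) :
    ntr (Theta X * Y) = ntr (X * Theta Y) := by
  rw [ntr, trace_Theta_mul, ntr]

lemma ntr_comm_mul {J : Type*} [Fintype J] [DecidableEq J] (K P W : Matrix J J ℂ) :
    ntr ((K * P - P * K) * W) = ntr (K * (P * W - W * P)) := by
  rw [sub_mul, mul_sub, ntr_sub, ntr_sub, mul_assoc, mul_assoc, ntr_mul_comm P]
  simp only [mul_assoc]

lemma norm_comm_le {J : Type*} [Fintype J] [DecidableEq J] {P W : Matrix J J ℂ} {p w : ℝ}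
    (hp : ‖P‖ ≤ p) (hw : ‖W‖ ≤ w) : ‖P * W - W * P‖ ≤ 2 * p * w := by
  have h0 := norm_nonneg P
  have h1 := norm_nonneg W
  calc _ ≤ ‖P * W‖ + ‖W * P‖ := norm_sub_le _ _
    _ ≤ ‖P‖ * ‖W‖ + ‖W‖ * ‖P‖ := add_le_add (norm_mul_le _ _) (norm_mul_le _ _)
    _ = 2 * (‖P‖ * ‖W‖) := by ring
    _ ≤ 2 * (p * w) := by gcongr; linarith
    _ = _ := by ring

set_option maxHeartbeats 1600000 in
lemma variance_resolvent [Nonempty (Fin n × ι)] {X : Matrix (Fin n × ι) (Fin n × ι) ℂ}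
    (hX : X.IsHermitian) {z : ℂ} {η R p : ℝ} (hη : 0 < η) (hz : η ≤ z.im) (hR : ‖X‖ ≤ R)
    {P A B : Matrix (Fin n × ι) (Fin n × ι) ℂ} (hP : ‖P‖ ≤ p) (hA : ‖A‖ ≤ 1) (hB : ‖B‖ ≤ 1) :
    ∫ U, ‖ntr (conjU P U * A * GU X z U * B) -
        ∫ V, ntr (conjU P V * A * GU X z V * B) ∂uHaar (Fin n × ι)‖ ^ 2 ∂uHaar (Fin n × ι) ≤
      2 * (2 * p * (1 / η) + 2 * R * (((n : ℝ) ^ 3 + 1) * (p * (1 / η) ^ 2))) ^ 2 /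
        (Fintype.card (Fin n × ι) : ℝ) ^ 2 := by
  have hp0 : 0 ≤ p := (norm_nonneg _).trans hP
  have hz0 : z.im ≠ 0 := (hη.trans_le hz).ne'
  have hd := ((((hasD_conjU P).mul (HasD.const A)).mul (hasD_GU hX hz0)).mul
    (HasD.const B)).lin ntrL
  refine variance_le (g := fun U => (conjU P U * (A * GU X z U * B) - (A * GU X z U * B) * conjU P U)
    + (conjU X U * Theta (GU X z U * B * conjU P U * A * GU X z U) -
      Theta (GU X z U * B * conjU P U * A * GU X z U) * conjU X U)) hd ?_ ?_ ?_
  · intro U K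
    rw [mul_add, ntr_add, ← ntr_comm_mul, ← ntr_comm_mul, ← ntr_Theta_mul]
    change ntr _ = _
    have e : ntr (Theta (K * conjU X U - conjU X U * K) * (GU X z U * B * conjU P U * A * GU X z U))
        = ntr (conjU P U * A * GU X z U * Theta (K * conjU X U - conjU X U * K) * GU X z U * B) := by
      rw [show Theta (K * conjU X U - conjU X U * K) * (GU X z U * B * conjU P U * A * GU X z U) =
        (Theta (K * conjU X U - conjU X U * K) * GU X z U * B) * (conjU P U * A * GU X z U) by
          simp only [mul_assoc], ntr_mul_comm]
      simp only [mul_assoc]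
    rw [e, ← ntr_add]
    congr 1
    simp only [mul_zero, add_zero, add_mul, mul_assoc]
  · intro U
    have hG := norm_GU_le hX hη hz U
    have hη' : 0 ≤ 1 / η := by positivity
    have h1 : ‖A * GU X z U * B‖ ≤ 1 / η := by
      simpa using norm_mul_le_of_le (norm_mul_le_of_le hA hG) hB
    have h2 : ‖GU X z U * B * conjU P U * A * GU X z U‖ ≤ p * (1 / η) ^ 2 := by
      have hP' : ‖conjU P U‖ ≤ p := by rwa [norm_conjU]
      refine (norm_mul_le_of_le (norm_mul_le_of_le (norm_mul_le_of_le (norm_mul_le_of_le hG hB) hP')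
        hA) hG).trans (le_of_eq ?_)
      ring
    refine (norm_add_le _ _).trans (add_le_add (norm_comm_le ?_ h1) (norm_comm_le ?_ ?_))
    · rwa [norm_conjU]
    · rwa [norm_conjU]
    · refine (norm_Theta_le _).trans ?_
      gcongr
  · intro U V h
    simp only [h P, GU_congr X z h]

end Resolvent

/-! ### The master equation -/

section Invariants

variable {n : ℕ}

/-- Kronecker delta with complex values. -/
def kd {κ : Type*} [DecidableEq κ] (i j : κ) : ℂ := if i = j then 1 else 0

/-- Tensors of order four on `ℂⁿ` invariant under simultaneous conjugation. -/
lemma exists_invariant_tensor (hn : 2 ≤ n) (b : Fin n → Fin n → Fin n → Fin n → ℂ)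
    (hb : ∀ p q i j k l, kd q i * b p j k l - kd j p * b i q k l + kd q k * b i j p l -
      kd l p * b i j k q = 0) :
    ∃ α γ : ℂ, ∀ i j k l, b i j k l = α * (kd i j * kd k l) + γ * (kd i l * kd j k) := by
  have k0 : Fin n := ⟨0, by omega⟩
  set t : Fin n → Fin n → ℂ := fun k l => ∑ q, b q q k l with ht
  set s : Fin n → Fin n → ℂ := fun k j => ∑ q, b q j k q with hs
  have hsum : ∀ (i : Fin n) (f : Fin n → ℂ), ∑ q, kd q i * f q = f i := by
    intro i f; simp [kd]
  have hsum' : ∀ (i : Fin n) (f : Fin n → ℂ), ∑ q, kd i q * f q = f i := by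
    intro i f; simp [kd]
  have h1 : ∀ p l, t p l = kd l p * t k0 k0 := by
    intro p l
    have h : ∑ i, (kd k0 i * b p i k0 l - kd i p * b i k0 k0 l + kd k0 k0 * b i i p l -
      kd l p * b i i k0 k0) = 0 := Finset.sum_eq_zero fun i _ => hb p k0 i i k0 l
    rw [Finset.sum_sub_distrib, Finset.sum_add_distrib, Finset.sum_sub_distrib, hsum' k0
      (fun i => b p i k0 l), hsum p (fun i => b i k0 k0 l), ← Finset.mul_sum, ← Finset.mul_sum] at h
    simp only [kd, if_true] at h ⊢
    simp only [ht]
    linear_combination h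
  have h2 : ∀ p j, s p j = kd j p * s k0 k0 := by
    intro p j
    have h : ∑ i, (kd k0 i * b p j k0 i - kd j p * b i k0 k0 i + kd k0 k0 * b i j p i -
      kd i p * b i j k0 k0) = 0 := Finset.sum_eq_zero fun i _ => hb p k0 i j k0 i
    rw [Finset.sum_sub_distrib, Finset.sum_add_distrib, Finset.sum_sub_distrib, hsum' k0
      (fun i => b p j k0 i), hsum p (fun i => b i j k0 k0), ← Finset.mul_sum, ← Finset.mul_sum] at h
    simp only [kd, if_true] at h ⊢
    simp only [hs]
    linear_combination h
  have h3 : ∀ p j k l, (n : ℂ) * b p j k l + b k j p l =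
      kd j p * (kd l k * t k0 k0) + kd l p * (kd j k * s k0 k0) := by
    intro p j k l
    have h : ∑ q, (kd q q * b p j k l - kd j p * b q q k l + kd q k * b q j p l -
      kd l p * b q j k q) = 0 := Finset.sum_eq_zero fun q _ => hb p q q j k l
    rw [Finset.sum_sub_distrib, Finset.sum_add_distrib, Finset.sum_sub_distrib, hsum k
      (fun i => b i j p l), ← Finset.mul_sum, ← Finset.mul_sum] at h
    have e : ∑ q : Fin n, kd q q * b p j k l = n * b p j k l := by simp [kd]
    rw [e] at h
    have h1' := h1 k l
    have h2' := h2 k j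
    simp only [ht] at h1'
    simp only [hs] at h2'
    rw [h1', h2'] at h
    linear_combination h
  have hT : ((n : ℂ) ^ 2 - 1) ≠ 0 := by
    have : ((n : ℂ) ^ 2 - 1) = ((n ^ 2 - 1 : ℕ) : ℂ) := by
      rw [Nat.cast_sub (Nat.one_le_pow _ _ (by omega))]; push_cast; ring
    rw [this, Nat.cast_ne_zero]
    have : 2 ^ 2 ≤ n ^ 2 := Nat.pow_le_pow_left hn 2
    omega
  refine ⟨(n * t k0 k0 - s k0 k0) / ((n : ℂ) ^ 2 - 1), (n * s k0 k0 - t k0 k0) / ((n : ℂ) ^ 2 - 1),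
    fun p j k l => ?_⟩
  have e1 := h3 p j k l
  have e2 := h3 k j p l
  have c1 : kd j p = kd p j := by simp [kd, eq_comm]
  have c2 : kd l k = kd k l := by simp [kd, eq_comm]
  have c3 : kd l p = kd p l := by simp [kd, eq_comm]
  rw [c1, c2, c3] at e1
  rw [c1, c2, c3] at e2
  field_simp
  linear_combination (n : ℂ) * e1 - e2

/-- The involution exchanging `tL` and `tR`. -/
def osw : Option (Fin n × Fin n) → Option (Fin n × Fin n)
  | none => none
  | some q => some (q.2, q.1)

lemma contraction (β β' : Option (Fin n × Fin n) → Option (Fin n × Fin n) → ℂ)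
    (h1 : ∀ t, β none t = ∑ i, β (some (i, i)) t) (h2 : ∀ s, β s none = ∑ i, β s (some (i, i)))
    (h1' : ∀ t, β' none t = ∑ i, β' (some (i, i)) t)
    (h2' : ∀ s, β' s none = ∑ i, β' s (some (i, i))) (α γ : ℂ)
    (hβ : ∀ i j k l, β' (some (i, j)) (some (k, l)) =
      α * (kd i j * kd k l) + γ * (kd i l * kd j k)) :
    ((n : ℂ) ^ 2 - 1) * (∑ s, ∑ t, tc s * tc t * (β s t * β' (osw t) (osw s))) =
      (∑ s, tc s * β s (osw s)) * ∑ s, tc s * β' s (osw s) := by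
  have hkd : ∀ i j : Fin n, kd i j = kd j i := fun i j => by simp [kd, eq_comm]
  have hsum : ∀ (i : Fin n) (f : Fin n → ℂ), ∑ q, kd q i * f q = f i := by
    intro i f; simp [kd]
  have hsum' : ∀ (i : Fin n) (f : Fin n → ℂ), ∑ q, kd i q * f q = f i := by
    intro i f; simp [kd]
  have hkk : ∀ i : Fin n, kd i i = 1 := fun i => by simp [kd]
  have b1 : ∀ i j, β' none (some (i, j)) = (n * α + γ) * kd i j := by
    intro i j
    rw [h1']
    simp only [hβ, hkk, one_mul, Finset.sum_add_distrib, Finset.sum_const, Finset.card_univ,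
      Fintype.card_fin, nsmul_eq_mul, ← Finset.mul_sum, hsum]
    rw [hkd j i]
    ring
  have b2 : ∀ i j, β' (some (i, j)) none = (n * α + γ) * kd i j := by
    intro i j
    rw [h2']
    simp only [hβ, hkk, mul_one, Finset.sum_add_distrib, Finset.sum_const, Finset.card_univ,
      Fintype.card_fin, nsmul_eq_mul, ← Finset.mul_sum, hsum']
    rw [hkd j i]
    ring
  have b3 : β' none none = n * (n * α + γ) := by
    rw [h1']
    simp only [b2, hkk]
    simp [mul_add]
  set S := ∑ i, ∑ j, β (some (i, j)) (some (j, i)) with hS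
  have hΓ : ∑ s, tc s * β s (osw s) = n * S - β none none := by
    rw [Fintype.sum_option, Fintype.sum_prod_type]
    simp only [tc, osw, ← Finset.mul_sum, hS]
    ring
  have hΓ' : ∑ s, tc s * β' s (osw s) = n * ((n : ℂ) ^ 2 - 1) * γ := by
    rw [Fintype.sum_option, Fintype.sum_prod_type]
    simp only [tc, osw, ← Finset.mul_sum, hβ, b3, hkk, Finset.sum_add_distrib]
    simp only [mul_one, Finset.sum_const, Finset.card_univ, Fintype.card_fin, nsmul_eq_mul]
    have : ∑ x : Fin n, ∑ y : Fin n, kd x y * kd y x = n := by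
      simp only [hsum', hkk]; simp
    rw [this]
    ring
  have hd : ∀ f : Fin n → Fin n → ℂ, ∑ i, ∑ j, f i j * kd j i = ∑ i, f i i := by
    intro f
    simp [kd]
  have hmain : ∑ s, ∑ t, tc s * tc t * (β s t * β' (osw t) (osw s)) =
      n * γ * (n * S - β none none) := by
    have s1 : ∑ i, ∑ j, β none (some (i, j)) * kd j i = β none none := by
      rw [hd, h2]
    have s2 : ∑ i, ∑ j, β (some (i, j)) none * kd j i = β none none := by
      rw [hd, h1]
    have s3 : ∑ i, ∑ j, ∑ k, ∑ l, β (some (i, j)) (some (k, l)) * (kd l k * kd j i) =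
        β none none := by
      have : ∀ i j, ∑ k, ∑ l, β (some (i, j)) (some (k, l)) * (kd l k * kd j i) =
          β (some (i, j)) none * kd j i := by
        intro i j
        simp only [← mul_assoc, ← Finset.sum_mul, hd]
        rw [h2]
      simp only [this, s2]
    have s4 : ∑ i, ∑ j, ∑ k, ∑ l, β (some (i, j)) (some (k, l)) * (kd l i * kd k j) = S := by
      have : ∀ i j, ∑ k, ∑ l, β (some (i, j)) (some (k, l)) * (kd l i * kd k j) =
          β (some (i, j)) (some (j, i)) := by
        intro i j
        simp [kd]
      simp only [this, hS]
    have hexp : ∑ s, ∑ t, tc s * tc t * (β s t * β' (osw t) (osw s)) =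
        β none none * β' none none - n * ((n * α + γ) * ∑ i, ∑ j, β none (some (i, j)) * kd j i)
        - n * ((n * α + γ) * ∑ i, ∑ j, β (some (i, j)) none * kd j i) +
        n ^ 2 * (α * ∑ i, ∑ j, ∑ k, ∑ l, β (some (i, j)) (some (k, l)) * (kd l k * kd j i) +
          γ * ∑ i, ∑ j, ∑ k, ∑ l, β (some (i, j)) (some (k, l)) * (kd l i * kd k j)) := by
      simp only [Fintype.sum_option, Fintype.sum_prod_type, tc, osw, b1, b2, hβ, Finset.mul_sum,
        Finset.sum_add_distrib, sub_eq_add_neg, ← Finset.sum_neg_distrib]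
      have hadd : ∀ f g : Fin n → Fin n → Fin n → Fin n → ℂ, ∑ i, ∑ j, ∑ k, ∑ l, f i j k l +
          ∑ i, ∑ j, ∑ k, ∑ l, g i j k l = ∑ i, ∑ j, ∑ k, ∑ l, (f i j k l + g i j k l) := by
        intro f g; simp only [Finset.sum_add_distrib]
      simp only [hadd]
      have a1 : ∀ {a b c d a' b' c' d' : ℂ}, a = a' → b = b' → c = c' → d = d' →
        a + b + (c + d) = a' + c' + b' + d' := by
        rintro a b c d _ _ _ _ rfl rfl rfl rfl; ring
      refine a1 (by ring) ?_ ?_ ?_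
      · exact Finset.sum_congr rfl fun i _ => Finset.sum_congr rfl fun j _ => by ring
      · exact Finset.sum_congr rfl fun i _ => Finset.sum_congr rfl fun j _ => by ring
      · simp only [Finset.mul_sum]
        exact Finset.sum_congr rfl fun i _ => Finset.sum_congr rfl fun j _ =>
          Finset.sum_congr rfl fun k _ => Finset.sum_congr rfl fun l _ => by ring
    rw [hexp, s1, s2, s3, s4, b3]
    ring
  rw [hmain, hΓ, hΓ']
  ring

end Invariants

section Master

variable {n : ℕ} {ι : Type*} [Fintype ι] [DecidableEq ι]

lemma tR_eq (s) : (tR s : Matrix (Fin n × ι) (Fin n × ι) ℂ) = tL (osw s) := by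
  cases s <;> rfl

/-- The averaged functional `(A, B) ↦ 𝔼 tr (P A G B)`. -/
def betaU (X : Matrix (Fin n × ι) (Fin n × ι) ℂ) (z : ℂ) (P A B : Matrix (Fin n × ι) (Fin n × ι) ℂ) :
    ℂ := ∫ U, ntr (conjU P U * A * GU X z U * B) ∂uHaar (Fin n × ι)

/-- The averaged functional `𝔼 tr (P Θ(G))`. -/
def gamU (X : Matrix (Fin n × ι) (Fin n × ι) ℂ) (z : ℂ) (P : Matrix (Fin n × ι) (Fin n × ι) ℂ) :
    ℂ := ∫ U, ntr (conjU P U * Theta (GU X z U)) ∂uHaar (Fin n × ι)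

/-- The averaged Stieltjes transform of `Theta (U X U*)`. -/
def gU (X : Matrix (Fin n × ι) (Fin n × ι) ℂ) (z : ℂ) : ℂ :=
  ∫ U, ntr (GU X z U) ∂uHaar (Fin n × ι)

lemma continuous_ntr_beta {X : Matrix (Fin n × ι) (Fin n × ι) ℂ} (hX : X.IsHermitian) {z : ℂ}
    (hz : z.im ≠ 0) (P A B : Matrix (Fin n × ι) (Fin n × ι) ℂ) :
    Continuous fun U => ntr (conjU P U * A * GU X z U * B) :=
  continuous_ntr.comp ((((continuous_conjU P).mul continuous_const).mul (continuous_GU hX hz)).mul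
    continuous_const)

lemma integral_ntr_sum {κ : Type*} [Fintype κ] (f : κ → unitaryGroup (Fin n × ι) ℂ → ℂ)
    (hf : ∀ i, Continuous (f i)) :
    ∫ U, ∑ i, f i U ∂uHaar (Fin n × ι) = ∑ i, ∫ U, f i U ∂uHaar (Fin n × ι) :=
  integral_finsetSum _ fun i _ => uHaar_integrable (hf i)

lemma betaU_one_left {X : Matrix (Fin n × ι) (Fin n × ι) ℂ} (hX : X.IsHermitian) {z : ℂ}
    (hz : z.im ≠ 0) (P B : Matrix (Fin n × ι) (Fin n × ι) ℂ) :
    betaU X z P 1 B = ∑ i, betaU X z P (eU i i) B := by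
  unfold betaU
  rw [← integral_ntr_sum _ fun i => continuous_ntr_beta hX hz P _ _]
  congr 1; funext U
  rw [← ntr_sum, ← sum_eU_diag]
  simp only [Finset.mul_sum, Finset.sum_mul]

lemma betaU_one_right {X : Matrix (Fin n × ι) (Fin n × ι) ℂ} (hX : X.IsHermitian) {z : ℂ}
    (hz : z.im ≠ 0) (P A : Matrix (Fin n × ι) (Fin n × ι) ℂ) :
    betaU X z P A 1 = ∑ i, betaU X z P A (eU i i) := by
  unfold betaU
  rw [← integral_ntr_sum _ fun i => continuous_ntr_beta hX hz P _ _]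
  congr 1; funext U
  rw [← ntr_sum, ← sum_eU_diag]
  simp only [Finset.mul_sum, Finset.sum_mul]

lemma GU_comm_eU {X : Matrix (Fin n × ι) (Fin n × ι) ℂ} (hX : X.IsHermitian) {z : ℂ}
    (hz : z.im ≠ 0) (p q : Fin n) (U : unitaryGroup (Fin n × ι) ℂ) :
    GU X z U * Theta (eU p q * conjU X U - conjU X U * eU p q) * GU X z U =
      eU p q * GU X z U - GU X z U * eU p q := by
  rw [Theta_commutator]
  have hH := Theta_isHermitian (conjU_isHermitian hX U)
  have h1 : GU X z U * Theta (conjU X U) = z • GU X z U - 1 := by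
    have := resM_mul hH hz
    rw [mul_sub, mul_smul_comm, mul_one] at this
    rw [GU, ← this]; abel
  have h2 : Theta (conjU X U) * GU X z U = z • GU X z U - 1 := by
    have := mul_resM hH hz
    rw [sub_mul, smul_mul_assoc, one_mul] at this
    rw [GU, ← this]; abel
  calc _ = GU X z U * eU p q * (Theta (conjU X U) * GU X z U) -
        (GU X z U * Theta (conjU X U)) * eU p q * GU X z U := by noncomm_ring
    _ = _ := by
      rw [h1, h2]
      simp only [mul_sub, sub_mul, mul_smul_comm, smul_mul_assoc, mul_one, one_mul]
      abel

lemma integral_four {J : Type*} [Fintype J] [DecidableEq J] {f g h k : unitaryGroup J ℂ → ℂ}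
    (hf : Continuous f) (hg : Continuous g) (hh : Continuous h) (hk : Continuous k)
    {a b c d : ℂ} : ∫ U, (a * f U - b * g U + c * h U - d * k U) ∂uHaar J =
      a * ∫ U, f U ∂uHaar J - b * ∫ U, g U ∂uHaar J + c * ∫ U, h U ∂uHaar J -
        d * ∫ U, k U ∂uHaar J := by
  rw [integral_sub (uHaar_integrable (by fun_prop)) (uHaar_integrable (by fun_prop)),
    integral_add (uHaar_integrable (by fun_prop)) (uHaar_integrable (by fun_prop)),
    integral_sub (uHaar_integrable (by fun_prop)) (uHaar_integrable (by fun_prop))]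
  simp only [integral_const_mul]

lemma betaU_rel {X : Matrix (Fin n × ι) (Fin n × ι) ℂ} (hX : X.IsHermitian) {z : ℂ}
    (hz : z.im ≠ 0) (P : Matrix (Fin n × ι) (Fin n × ι) ℂ) (p q i j k l : Fin n) :
    kd q i * betaU X z P (eU p j) (eU k l) - kd j p * betaU X z P (eU i q) (eU k l) +
      kd q k * betaU X z P (eU i j) (eU p l) - kd l p * betaU X z P (eU i j) (eU k q) = 0 := by
  have hd := ((((hasD_conjU P).mul (HasD.const (eU i j))).mul (hasD_GU hX hz)).mul
    (HasD.const (eU k l))).lin ntrL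
  have h := hd.integral_eq_zero (eU p q)
  have hc := continuous_ntr_beta hX hz P
  rw [← neg_eq_zero, ← h]
  unfold betaU
  rw [← integral_four (hc _ _) (hc _ _) (hc _ _) (hc _ _), ← integral_neg]
  congr 1; funext U
  change _ = ntr _
  rw [GU_comm_eU hX hz]
  set Q := conjU P U
  set G := GU X z U
  have e1 : kd q i * ntr (Q * eU p j * G * eU k l) = ntr (Q * (eU p q * eU i j) * G * eU k l) := by
    rw [eU_mul]; unfold kd; split_ifs <;> simp [ntr]
  have e2 : kd j p * ntr (Q * eU i q * G * eU k l) = ntr (Q * (eU i j * eU p q) * G * eU k l) := by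
    rw [eU_mul]; unfold kd; split_ifs <;> simp [ntr]
  have e3 : kd q k * ntr (Q * eU i j * G * eU p l) = ntr (Q * eU i j * G * (eU p q * eU k l)) := by
    rw [eU_mul]; unfold kd; split_ifs <;> simp [ntr]
  have e4 : kd l p * ntr (Q * eU i j * G * eU k q) = ntr (eU p q * (Q * eU i j * G * eU k l)) := by
    rw [ntr_mul_comm (eU p q), mul_assoc (Q * eU i j * G), eU_mul]; unfold kd; split_ifs <;> simp [ntr]
  rw [e1, e2, e3, e4, ← ntr_sub, ← ntr_add, ← ntr_sub, ← neg_one_mul, ← ntr_smul]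
  congr 1
  simp only [mul_zero, add_zero, mul_sub, sub_mul, add_mul, mul_assoc, smul_sub, smul_add,
    neg_smul, one_smul]
  abel

lemma gamU_eq_sum {X : Matrix (Fin n × ι) (Fin n × ι) ℂ} (hX : X.IsHermitian) {z : ℂ}
    (hz : z.im ≠ 0) (P : Matrix (Fin n × ι) (Fin n × ι) ℂ) :
    gamU X z P = ∑ s, tc s * betaU X z P (tL s) (tR s) := by
  unfold gamU betaU
  simp only [← integral_const_mul]
  have hc : ∀ s, Continuous fun U : unitaryGroup (Fin n × ι) ℂ =>
      tc s * ntr (conjU P U * tL s * GU X z U * tR s) := fun s =>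
    continuous_const.mul (continuous_ntr_beta hX hz P _ _)
  rw [← integral_ntr_sum _ hc]
  congr 1; funext U
  rw [Theta_eq_sum, Finset.mul_sum, ntr_sum]
  refine Finset.sum_congr rfl fun s _ => ?_
  rw [mul_smul_comm, ntr_smul]
  simp only [mul_assoc]

lemma betaU_contraction (hn : 2 ≤ n) {X : Matrix (Fin n × ι) (Fin n × ι) ℂ} (hX : X.IsHermitian)
    {z : ℂ} (hz : z.im ≠ 0) (P P' : Matrix (Fin n × ι) (Fin n × ι) ℂ) :
    ((n : ℂ) ^ 2 - 1) * (∑ s, ∑ t, tc s * tc t *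
      (betaU X z P (tL s) (tL t) * betaU X z P' (tR t) (tR s))) = gamU X z P * gamU X z P' := by
  obtain ⟨α, γ, h⟩ := exists_invariant_tensor hn
    (fun i j k l => betaU X z P' (eU i j) (eU k l)) (betaU_rel hX hz P')
  have := contraction (fun s t => betaU X z P (tL s) (tL t))
    (fun s t => betaU X z P' (tL s) (tL t))
    (fun t => betaU_one_left hX hz P _) (fun t => betaU_one_right hX hz P _)
    (fun t => betaU_one_left hX hz P' _) (fun t => betaU_one_right hX hz P' _) α γ h
  rw [gamU_eq_sum hX hz, gamU_eq_sum hX hz]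
  simp only [tR_eq]
  exact this

lemma sum_ntr_single {J : Type*} [Fintype J] [DecidableEq J] (M N : Matrix J J ℂ) :
    ∑ a, ∑ b, ntr (Matrix.single b a 1 * M * Matrix.single a b 1 * N) =
      Fintype.card J * (ntr M * ntr N) := by
  rcases isEmpty_or_nonempty J with h | h
  · simp
  have hN : (Fintype.card J : ℂ) ≠ 0 := by exact_mod_cast Fintype.card_ne_zero
  have e : ∀ a b, ntr (Matrix.single b a 1 * M * Matrix.single a b 1 * N) =
      (Fintype.card J : ℂ)⁻¹ * (M a a * N b b) := by
    intro a b
    unfold ntr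
    congr 1
    rw [Matrix.single_mul_mul_single]
    simp [Matrix.trace_single_mul]
  simp only [e, ← Finset.mul_sum]
  simp only [ntr, Matrix.trace, Matrix.diag, ← Finset.sum_mul]
  field_simp

lemma Theta_double (G Y : Matrix (Fin n × ι) (Fin n × ι) ℂ) :
    Theta (G * Theta Y * G) = ∑ s, ∑ t, (tc s * tc t) • (tL s * G * tL t * Y * tR t * G * tR s) := by
  rw [Theta_eq_sum]
  refine Finset.sum_congr rfl fun s _ => ?_
  rw [Theta_eq_sum]
  simp only [Finset.mul_sum, Finset.sum_mul, Finset.smul_sum, mul_smul_comm, smul_mul_assoc,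
    mul_smul, mul_assoc]

lemma sd_sum (φ G X Y : Matrix (Fin n × ι) (Fin n × ι) ℂ) [Nonempty (Fin n × ι)] :
    ∑ a, ∑ b, ntr (Matrix.single b a 1 * ((Matrix.single a b 1 * φ - φ * Matrix.single a b 1) * Y +
      φ * Theta (G * Theta (Matrix.single a b 1 * X - X * Matrix.single a b 1) * G))) =
    Fintype.card (Fin n × ι) * (ntr (φ * Y) - ntr φ * ntr Y + ∑ s, ∑ t, tc s * tc t *
      (ntr (φ * tL s * G * tL t) * ntr (X * tR t * G * tR s) -
        ntr (X * φ * tL s * G * tL t) * ntr (1 * tR t * G * tR s))) := by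
  have e : ∀ a b, ntr (Matrix.single b a 1 * ((Matrix.single a b 1 * φ - φ * Matrix.single a b 1) * Y +
      φ * Theta (G * Theta (Matrix.single a b 1 * X - X * Matrix.single a b 1) * G))) =
      ntr (Matrix.single b a 1 * 1 * Matrix.single a b 1 * (φ * Y)) -
      ntr (Matrix.single b a 1 * φ * Matrix.single a b 1 * Y) + ∑ s, ∑ t, tc s * tc t *
      (ntr (Matrix.single b a 1 * (φ * tL s * G * tL t) * Matrix.single a b 1 * (X * tR t * G * tR s)) -
       ntr (Matrix.single b a 1 * (φ * tL s * G * tL t * X) * Matrix.single a b 1 *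
        (1 * tR t * G * tR s))) := by
    intro a b
    simp only [← ntr_sub, ← ntr_smul, ← ntr_sum]
    rw [← ntr_add]
    congr 1
    rw [mul_add, Theta_double]
    congr 1
    · simp only [sub_mul, mul_sub, mul_assoc, one_mul]
    · simp only [Finset.mul_sum]
      refine Finset.sum_congr rfl fun s _ => Finset.sum_congr rfl fun t _ => ?_
      simp only [mul_smul_comm, sub_mul, mul_sub, mul_assoc, one_mul]
  simp only [e, Finset.sum_add_distrib, Finset.sum_sub_distrib, sum_ntr_single, ntr_one]
  have e2 : ∑ a, ∑ b, ∑ s, ∑ t, tc s * tc t *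
      (ntr (Matrix.single b a 1 * (φ * tL s * G * tL t) * Matrix.single a b 1 * (X * tR t * G * tR s)) -
       ntr (Matrix.single b a 1 * (φ * tL s * G * tL t * X) * Matrix.single a b 1 *
        (1 * tR t * G * tR s))) = ∑ s, ∑ t, tc s * tc t * ∑ a, ∑ b,
      (ntr (Matrix.single b a 1 * (φ * tL s * G * tL t) * Matrix.single a b 1 * (X * tR t * G * tR s)) -
       ntr (Matrix.single b a 1 * (φ * tL s * G * tL t * X) * Matrix.single a b 1 *
        (1 * tR t * G * tR s))) := by
    simp only [Finset.mul_sum]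
    calc _ = ∑ a, ∑ s, ∑ b, ∑ t, _ := Finset.sum_congr rfl fun a _ => Finset.sum_comm
      _ = ∑ s, ∑ a, ∑ b, ∑ t, _ := Finset.sum_comm
      _ = ∑ s, ∑ a, ∑ t, ∑ b, _ := Finset.sum_congr rfl fun s _ => Finset.sum_congr rfl fun a _ =>
          Finset.sum_comm
      _ = _ := Finset.sum_congr rfl fun s _ => Finset.sum_comm
  rw [e2]
  simp only [Finset.sum_sub_distrib, sum_ntr_single]
  rw [mul_add, one_mul, mul_sub, Finset.mul_sum]
  congr 1
  refine Finset.sum_congr rfl fun s _ => ?_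
  rw [Finset.mul_sum]
  refine Finset.sum_congr rfl fun t _ => ?_
  rw [ntr_mul_comm (φ * tL s * G * tL t) X]
  simp only [mul_assoc]
  ring

end Master

section MasterBound

variable {n : ℕ} {ι : Type*} [Fintype ι] [DecidableEq ι]

lemma sd_integral {X : Matrix (Fin n × ι) (Fin n × ι) ℂ} [Nonempty (Fin n × ι)]
    (hX : X.IsHermitian) {z : ℂ} (hz : z.im ≠ 0) (φ : Matrix (Fin n × ι) (Fin n × ι) ℂ) :
    ∫ U, (ntr (conjU φ U * Theta (GU X z U)) - ntr φ * ntr (conjU 1 U * Theta (GU X z U)) +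
      ∑ s, ∑ t, tc s * tc t *
      (ntr (conjU φ U * tL s * GU X z U * tL t) * ntr (conjU X U * tR t * GU X z U * tR s) -
        ntr (conjU (X * φ) U * tL s * GU X z U * tL t) * ntr (conjU 1 U * tR t * GU X z U * tR s)))
      ∂uHaar (Fin n × ι) = 0 := by
  have hN : (Fintype.card (Fin n × ι) : ℂ) ≠ 0 := by exact_mod_cast Fintype.card_ne_zero
  have hd := fun a b => (((HasD.const (J := Fin n × ι) (Matrix.single b a (1 : ℂ))).mul
    ((hasD_conjU φ).mul ((hasD_GU hX hz).lin ThetaL))).lin ntrL)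
  have h0 : ∑ a, ∑ b, ∫ U, ntr (Matrix.single b a 1 * ((Matrix.single a b 1 * conjU φ U -
      conjU φ U * Matrix.single a b 1) * Theta (GU X z U) + conjU φ U * Theta (GU X z U *
        Theta (Matrix.single a b 1 * conjU X U - conjU X U * Matrix.single a b 1) * GU X z U)))
        ∂uHaar (Fin n × ι) = 0 := by
    refine Finset.sum_eq_zero fun a _ => Finset.sum_eq_zero fun b _ => ?_
    rw [← (hd a b).integral_eq_zero (Matrix.single a b 1)]
    congr 1; funext U
    change ntr _ = ntr _
    congr 1
    rw [zero_mul, zero_add]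
    rfl
  have hc : ∀ a b, Continuous fun U => ntr (Matrix.single b a 1 * ((Matrix.single a b 1 * conjU φ U -
      conjU φ U * Matrix.single a b 1) * Theta (GU X z U) + conjU φ U * Theta (GU X z U *
        Theta (Matrix.single a b 1 * conjU X U - conjU X U * Matrix.single a b 1) * GU X z U))) := by
    intro a b
    have h := (hd a b).dcont (Matrix.single a b 1)
    refine h.congr fun U => ?_
    change ntr _ = ntr _
    congr 1
    rw [zero_mul, zero_add]
    rfl
  have h1 : ∫ U, ∑ a, ∑ b, ntr (Matrix.single b a 1 * ((Matrix.single a b 1 * conjU φ U -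
      conjU φ U * Matrix.single a b 1) * Theta (GU X z U) + conjU φ U * Theta (GU X z U *
        Theta (Matrix.single a b 1 * conjU X U - conjU X U * Matrix.single a b 1) * GU X z U)))
        ∂uHaar (Fin n × ι) = 0 := by
    rw [← h0, integral_ntr_sum _ fun a => continuous_finsetSum _ fun b _ => hc a b]
    exact Finset.sum_congr rfl fun a _ => integral_ntr_sum _ fun b => hc a b
  simp only [sd_sum] at h1
  rw [integral_const_mul] at h1
  have h2 := (mul_eq_zero.1 h1).resolve_left hN
  rw [← h2]
  congr 1; funext U
  rw [conjU_mul, conjU_one, one_mul, ntr_conjU]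

lemma sum_norm_tc : ∑ s : Option (Fin n × Fin n), ‖tc s‖ = (n : ℝ) ^ 3 + 1 := by
  rw [Fintype.sum_option]
  simp [tc]
  ring

lemma continuous_Theta_GU {X : Matrix (Fin n × ι) (Fin n × ι) ℂ} (hX : X.IsHermitian) {z : ℂ}
    (hz : z.im ≠ 0) (P : Matrix (Fin n × ι) (Fin n × ι) ℂ) :
    Continuous fun U => ntr (conjU P U * Theta (GU X z U)) :=
  continuous_ntr.comp ((continuous_conjU P).mul ((hasD_GU hX hz).lin ThetaL).cont)

lemma integral_sub_const_mul_add {J : Type*} [Fintype J] [DecidableEq J]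
    {f g h : unitaryGroup J ℂ → ℂ} (hf : Continuous f) (hg : Continuous g) (hh : Continuous h)
    {a : ℂ} : ∫ U, (f U - a * g U + h U) ∂uHaar J =
      ∫ U, f U ∂uHaar J - a * ∫ U, g U ∂uHaar J + ∫ U, h U ∂uHaar J := by
  rw [integral_add (uHaar_integrable (by fun_prop)) (uHaar_integrable (by fun_prop)),
    integral_sub (uHaar_integrable (by fun_prop)) (uHaar_integrable (by fun_prop)),
    integral_const_mul]

lemma integral_mul_sub_mul {J : Type*} [Fintype J] [DecidableEq J]
    {f g h k : unitaryGroup J ℂ → ℂ} (hf : Continuous f) (hg : Continuous g) (hh : Continuous h)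
    (hk : Continuous k) : ∫ U, (f U * g U - h U * k U) ∂uHaar J =
      ∫ U, f U * g U ∂uHaar J - ∫ U, h U * k U ∂uHaar J :=
  integral_sub (uHaar_integrable (by fun_prop)) (uHaar_integrable (by fun_prop))

set_option maxHeartbeats 800000 in
theorem master_bound (hn : 2 ≤ n) [Nonempty (Fin n × ι)] {X : Matrix (Fin n × ι) (Fin n × ι) ℂ}
    (hX : X.IsHermitian) {z : ℂ} {η R p : ℝ} (hη : 0 < η) (hz : η ≤ z.im) (hR : ‖X‖ ≤ R)
    {φ : Matrix (Fin n × ι) (Fin n × ι) ℂ} (hp1 : 1 ≤ p) (hRp : R ≤ p) (hφ : ‖φ‖ ≤ p)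
    (hXφ : ‖X * φ‖ ≤ p) :
    ‖gamU X z φ - ntr φ * gamU X z 1 +
      (gamU X z φ * gamU X z X - gamU X z (X * φ) * gamU X z 1) / ((n : ℂ) ^ 2 - 1)‖ ≤
    2 * ((n : ℝ) ^ 3 + 1) ^ 2 *
      (2 * (2 * p * (1 / η) + 2 * R * (((n : ℝ) ^ 3 + 1) * (p * (1 / η) ^ 2))) ^ 2 /
        (Fintype.card (Fin n × ι) : ℝ) ^ 2) := by
  have hz0 : z.im ≠ 0 := (hη.trans_le hz).ne'
  set v := 2 * (2 * p * (1 / η) + 2 * R * (((n : ℝ) ^ 3 + 1) * (p * (1 / η) ^ 2))) ^ 2 /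
        (Fintype.card (Fin n × ι) : ℝ) ^ 2 with hv
  have hT : ((n : ℂ) ^ 2 - 1) ≠ 0 := by
    have : ((n : ℂ) ^ 2 - 1) = ((n ^ 2 - 1 : ℕ) : ℂ) := by
      rw [Nat.cast_sub (Nat.one_le_pow _ _ (by omega))]; push_cast; ring
    rw [this, Nat.cast_ne_zero]
    have : 2 ^ 2 ≤ n ^ 2 := Nat.pow_le_pow_left hn 2
    omega
  have hc := continuous_ntr_beta hX hz0
  have hcov : ∀ (P P' : Matrix (Fin n × ι) (Fin n × ι) ℂ), ‖P‖ ≤ p → ‖P'‖ ≤ p → ∀ s t,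
      ‖∫ U, ntr (conjU P U * tL s * GU X z U * tL t) * ntr (conjU P' U * tR t * GU X z U * tR s)
        ∂uHaar (Fin n × ι) - betaU X z P (tL s) (tL t) * betaU X z P' (tR t) (tR s)‖ ≤ v := by
    intro P P' hP hP' s t
    exact covariance_le (hc _ _ _) (hc _ _ _)
      (variance_resolvent hX hη hz hR hP (norm_tL_le s) (norm_tL_le t))
      (variance_resolvent hX hη hz hR hP' (norm_tR_le t) (norm_tR_le s))
  have h := sd_integral hX hz0 φ
  have hcc : ∀ s t, Continuous fun U => tc s * tc t *
      (ntr (conjU φ U * tL s * GU X z U * tL t) * ntr (conjU X U * tR t * GU X z U * tR s) -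
        ntr (conjU (X * φ) U * tL s * GU X z U * tL t) * ntr (conjU 1 U * tR t * GU X z U * tR s)) :=
    fun s t => continuous_const.mul (((hc _ _ _).mul (hc _ _ _)).sub ((hc _ _ _).mul (hc _ _ _)))
  have hcs : Continuous fun U => ∑ s, ∑ t, tc s * tc t *
      (ntr (conjU φ U * tL s * GU X z U * tL t) * ntr (conjU X U * tR t * GU X z U * tR s) -
        ntr (conjU (X * φ) U * tL s * GU X z U * tL t) * ntr (conjU 1 U * tR t * GU X z U * tR s)) :=
    continuous_finsetSum _ fun s _ => continuous_finsetSum _ fun t _ => hcc s t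
  have hφc := continuous_Theta_GU hX hz0 φ
  have h1c := continuous_Theta_GU hX hz0 1
  rw [integral_sub_const_mul_add hφc h1c hcs, integral_ntr_sum _ fun s => continuous_finsetSum _ fun t _ => hcc s t] at h
  simp only [integral_ntr_sum _ fun t => hcc _ t, integral_const_mul] at h
  have h' : gamU X z φ - ntr φ * gamU X z 1 = - ∑ s, ∑ t, tc s * tc t *
      ∫ U, (ntr (conjU φ U * tL s * GU X z U * tL t) * ntr (conjU X U * tR t * GU X z U * tR s) -
        ntr (conjU (X * φ) U * tL s * GU X z U * tL t) * ntr (conjU 1 U * tR t * GU X z U * tR s))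
        ∂uHaar (Fin n × ι) := by
    unfold gamU
    linear_combination h
  have hq : (gamU X z φ * gamU X z X - gamU X z (X * φ) * gamU X z 1) / ((n : ℂ) ^ 2 - 1) =
      ∑ s, ∑ t, tc s * tc t * (betaU X z φ (tL s) (tL t) * betaU X z X (tR t) (tR s) -
        betaU X z (X * φ) (tL s) (tL t) * betaU X z 1 (tR t) (tR s)) := by
    rw [← betaU_contraction hn hX hz0, ← betaU_contraction hn hX hz0, ← mul_sub,
      mul_div_cancel_left₀ _ hT]
    simp only [mul_sub, Finset.sum_sub_distrib]
  rw [h', hq, ← Finset.sum_neg_distrib, ← Finset.sum_add_distrib]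
  simp only [← Finset.sum_neg_distrib, ← Finset.sum_add_distrib]
  calc _ ≤ ∑ s : Option (Fin n × Fin n), ∑ t : Option (Fin n × Fin n), ‖tc s‖ * ‖tc t‖ * (2 * v) := by
        refine norm_sum_le_of_le _ fun s _ => norm_sum_le_of_le _ fun t _ => ?_
        rw [integral_mul_sub_mul (hc _ _ _) (hc _ _ _) (hc _ _ _) (hc _ _ _)]
        rw [← mul_neg, ← mul_add, norm_mul, norm_mul]
        gcongr
        have a1 := hcov φ X hφ (hR.trans hRp) s t
        have a2 := hcov (X * φ) 1 hXφ (norm_matrix_one_le.trans hp1) s t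
        rw [norm_sub_rev] at a1
        refine le_trans (le_of_eq ?_) ((norm_add_le _ _).trans (add_le_add a1 a2)) |>.trans
          (by linarith)
        congr 1
        ring
    _ = _ := by
        simp only [← Finset.sum_mul, ← Finset.mul_sum, sum_norm_tc]
        ring

end MasterBound

/-! ### Stieltjes transforms of finite families -/

section Stieltjes

variable {J : Type*} [Fintype J]

/-- The Stieltjes transform of the uniform distribution on a finite family of reals. -/
def stj (a : J → ℝ) (z : ℂ) : ℂ := (Fintype.card J : ℂ)⁻¹ * ∑ i, 1 / (z - a i : ℂ)

lemma im_one_div_sub (a : ℝ) (z : ℂ) :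
    (1 / (z - a : ℂ)).im = -(z.im * ‖1 / (z - a : ℂ)‖ ^ 2) := by
  rw [one_div, Complex.inv_im, norm_inv, inv_pow, ← Complex.normSq_eq_norm_sq]
  simp [div_eq_mul_inv]

lemma im_stj (a : J → ℝ) (z : ℂ) :
    (stj a z).im = -(z.im * ((Fintype.card J : ℝ)⁻¹ * ∑ i, ‖1 / (z - a i : ℂ)‖ ^ 2)) := by
  have h : (Fintype.card J : ℂ)⁻¹ = (((Fintype.card J : ℝ)⁻¹ : ℝ) : ℂ) := by push_cast; rfl
  rw [stj, h, Complex.im_ofReal_mul, Complex.im_sum]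
  simp only [im_one_div_sub, Finset.sum_neg_distrib, ← Finset.mul_sum]
  ring

lemma norm_sq_stj_le (a : J → ℝ) (z : ℂ) :
    ‖stj a z‖ ^ 2 ≤ (Fintype.card J : ℝ)⁻¹ * ∑ i, ‖1 / (z - a i : ℂ)‖ ^ 2 := by
  rcases isEmpty_or_nonempty J with h | h
  · simp [stj]
  have hN : (0 : ℝ) < Fintype.card J := by exact_mod_cast Fintype.card_pos
  rw [stj, norm_mul, norm_inv, Complex.norm_natCast, mul_pow]
  have h1 : ‖∑ i, 1 / (z - a i : ℂ)‖ ^ 2 ≤ Fintype.card J * ∑ i, ‖1 / (z - a i : ℂ)‖ ^ 2 := by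
    calc _ ≤ (∑ i, ‖1 / (z - a i : ℂ)‖) ^ 2 :=
          pow_le_pow_left₀ (norm_nonneg _) (norm_sum_le _ _) 2
      _ ≤ _ := by
        have := sq_sum_le_card_mul_sum_sq (s := Finset.univ) (f := fun i => ‖1 / (z - a i : ℂ)‖)
        simpa using this
  calc _ ≤ (Fintype.card J : ℝ)⁻¹ ^ 2 * (Fintype.card J * ∑ i, ‖1 / (z - a i : ℂ)‖ ^ 2) := by gcongr
    _ = _ := by field_simp

lemma norm_sq_stj_le_im (a : J → ℝ) {z : ℂ} (hz : 0 < z.im) :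
    z.im * ‖stj a z‖ ^ 2 ≤ -(stj a z).im := by
  rw [im_stj, neg_neg]
  exact mul_le_mul_of_nonneg_left (norm_sq_stj_le a z) hz.le

lemma neg_im_stj_ge [Nonempty J] (a : J → ℝ) {z : ℂ} (hz : 0 < z.im) {ρ : ℝ}
    (ha : ∀ i, ‖z‖ + |a i| ≤ ρ) : z.im / ρ ^ 2 ≤ -(stj a z).im := by
  have hN : (0 : ℝ) < Fintype.card J := by exact_mod_cast Fintype.card_pos
  rw [im_stj, neg_neg, div_eq_mul_inv]
  refine mul_le_mul_of_nonneg_left ?_ hz.le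
  have h : ∀ i, (ρ ^ 2)⁻¹ ≤ ‖1 / (z - a i : ℂ)‖ ^ 2 := by
    intro i
    have hne : z - a i ≠ 0 := im_sub_ofReal_ne hz.ne' _
    rw [norm_div, norm_one, one_div, inv_pow]
    have h1 : ‖z - a i‖ ≤ ρ := (norm_sub_le _ _).trans (by simpa using ha i)
    have : 0 < ‖z - a i‖ := norm_pos_iff.2 hne
    gcongr
  calc (ρ ^ 2)⁻¹ = (Fintype.card J : ℝ)⁻¹ * ∑ _i : J, (ρ ^ 2)⁻¹ := by
        simp
    _ ≤ _ := by gcongr with i; exact h i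

lemma ntr_resM_eq_stj [DecidableEq J] {H : Matrix J J ℂ} (hH : H.IsHermitian) {z : ℂ}
    (hz : z.im ≠ 0) : ntr (resM z H) = stj hH.eigenvalues z := ntr_resM hH hz

end Stieltjes

section Subordination

variable {n : ℕ} {ι : Type*} [Fintype ι] [DecidableEq ι]

lemma continuous_ntr_GU {X : Matrix (Fin n × ι) (Fin n × ι) ℂ} (hX : X.IsHermitian) {z : ℂ}
    (hz : z.im ≠ 0) : Continuous fun U => ntr (GU X z U) :=
  continuous_ntr.comp (continuous_GU hX hz)

lemma im_gU {X : Matrix (Fin n × ι) (Fin n × ι) ℂ} (hX : X.IsHermitian) {z : ℂ}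
    (hz : z.im ≠ 0) : (gU X z).im = ∫ U, (ntr (GU X z U)).im ∂uHaar (Fin n × ι) := by
  have h := integral_im (uHaar_integrable (continuous_ntr_GU hX hz))
  exact h.symm

lemma norm_integral_sq_le {J : Type*} [Fintype J] [DecidableEq J] {f : unitaryGroup J ℂ → ℂ}
    (hf : Continuous f) : ‖∫ U, f U ∂uHaar J‖ ^ 2 ≤ ∫ U, ‖f U‖ ^ 2 ∂uHaar J := by
  set m := ∫ U, ‖f U‖ ∂uHaar J with hm
  have h1 : ‖∫ U, f U ∂uHaar J‖ ≤ m := norm_integral_le_integral_norm _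
  have h2 : 0 ≤ ∫ U, (‖f U‖ - m) ^ 2 ∂uHaar J := integral_nonneg fun U => sq_nonneg _
  have h3 : ∫ U, (‖f U‖ - m) ^ 2 ∂uHaar J = ∫ U, ‖f U‖ ^ 2 ∂uHaar J - m ^ 2 := by
    have e : ∀ U, (‖f U‖ - m) ^ 2 = ‖f U‖ ^ 2 - 2 * m * ‖f U‖ + m ^ 2 := fun U => by ring
    simp only [e]
    rw [integral_add (uHaar_integrable (by fun_prop)) (integrable_const _),
      integral_sub (uHaar_integrable (by fun_prop)) (uHaar_integrable (by fun_prop)),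
      integral_const_mul, ← hm]
    simp only [integral_const, probReal_univ, one_smul]
    ring
  calc _ ≤ m ^ 2 := pow_le_pow_left₀ (norm_nonneg _) h1 2
    _ ≤ _ := by linarith

lemma norm_sq_gU_le {X : Matrix (Fin n × ι) (Fin n × ι) ℂ} (hX : X.IsHermitian) {z : ℂ}
    (hz : 0 < z.im) : z.im * ‖gU X z‖ ^ 2 ≤ -(gU X z).im := by
  have hc := continuous_ntr_GU hX hz.ne'
  rw [im_gU hX hz.ne', ← integral_neg]
  calc _ ≤ z.im * ∫ U, ‖ntr (GU X z U)‖ ^ 2 ∂uHaar (Fin n × ι) := by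
        gcongr
        exact norm_integral_sq_le hc
    _ = ∫ U, z.im * ‖ntr (GU X z U)‖ ^ 2 ∂uHaar (Fin n × ι) := (integral_const_mul _ _).symm
    _ ≤ _ := by
        refine integral_mono (uHaar_integrable (by fun_prop))
          (uHaar_integrable (Complex.continuous_im.comp hc).neg) fun U => ?_
        have hH := Theta_isHermitian (conjU_isHermitian hX U)
        simp only [GU, ntr_resM_eq_stj hH hz.ne']
        exact norm_sq_stj_le_im _ hz

lemma neg_im_gU_ge [Nonempty (Fin n × ι)] {X : Matrix (Fin n × ι) (Fin n × ι) ℂ}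
    (hX : X.IsHermitian) {z : ℂ} (hz : 0 < z.im) {ρ : ℝ}
    (hρ : ‖z‖ + ((n : ℝ) ^ 3 + 1) * ‖X‖ ≤ ρ) : z.im / ρ ^ 2 ≤ -(gU X z).im := by
  have hc := continuous_ntr_GU hX hz.ne'
  rw [im_gU hX hz.ne', ← integral_neg]
  calc z.im / ρ ^ 2 = ∫ _U, z.im / ρ ^ 2 ∂uHaar (Fin n × ι) := by simp
    _ ≤ _ := by
        refine integral_mono (integrable_const _)
          (uHaar_integrable (Complex.continuous_im.comp hc).neg) fun U => ?_
        have hH := Theta_isHermitian (conjU_isHermitian hX U)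
        simp only [GU, ntr_resM_eq_stj hH hz.ne']
        refine neg_im_stj_ge _ hz fun i => ?_
        have h1 := abs_eigenvalues_le hH i
        have h2 := norm_Theta_le (conjU X U)
        rw [norm_conjU] at h2
        linarith

lemma gamU_one {X : Matrix (Fin n × ι) (Fin n × ι) ℂ} (z : ℂ) :
    gamU X z 1 = ((n : ℂ) ^ 2 - 1) * gU X z := by
  unfold gamU gU
  rw [← integral_const_mul]
  congr 1; funext U
  rw [conjU_one, ← ntr_Theta_mul, Theta_one, smul_mul_assoc, one_mul, ntr_smul]

lemma mul_gU {X : Matrix (Fin n × ι) (Fin n × ι) ℂ} [Nonempty (Fin n × ι)] (hX : X.IsHermitian)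
    {z : ℂ} (hz : z.im ≠ 0) : z * gU X z = 1 + gamU X z X := by
  unfold gamU gU
  have h1 : (1 : ℂ) = ∫ _U, (1 : ℂ) ∂uHaar (Fin n × ι) := by simp
  rw [← integral_const_mul]
  conv_rhs => rw [h1]
  rw [← integral_add (integrable_const _) (uHaar_integrable (continuous_Theta_GU hX hz X))]
  congr 1; funext U
  have hH := Theta_isHermitian (conjU_isHermitian hX U)
  have := mul_resM hH hz
  rw [sub_mul, smul_mul_assoc, one_mul] at this
  rw [← ntr_Theta_mul, ← ntr_smul, GU, ← ntr_one (J := Fin n × ι), ← ntr_add, ← this]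
  congr 1; abel

lemma gamU_smul_sub {X : Matrix (Fin n × ι) (Fin n × ι) ℂ} (hX : X.IsHermitian)
    {z : ℂ} (hz : z.im ≠ 0) (c : ℂ) (P Q : Matrix (Fin n × ι) (Fin n × ι) ℂ) :
    gamU X z (c • P - Q) = c * gamU X z P - gamU X z Q := by
  unfold gamU
  rw [← integral_const_mul, ← integral_sub
    (uHaar_integrable (f := fun U => c * ntr (conjU P U * Theta (GU X z U)))
      (continuous_const.mul (continuous_Theta_GU hX hz P)))
    (uHaar_integrable (continuous_Theta_GU hX hz Q))]
  congr 1; funext U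
  rw [conjU_sub, conjU_smul, sub_mul, smul_mul_assoc, ntr_sub, ntr_smul]

/-- The approximate subordination function. -/
def omU (X : Matrix (Fin n × ι) (Fin n × ι) ℂ) (z : ℂ) : ℂ :=
  z / ((n : ℂ) ^ 2 - 1) + (1 - 1 / ((n : ℂ) ^ 2 - 1)) / gU X z

lemma three_le_sq_sub_one (hn : 2 ≤ n) : (3 : ℝ) ≤ (n : ℝ) ^ 2 - 1 := by
  have : (2 : ℝ) ≤ n := by exact_mod_cast hn
  nlinarith

lemma coe_sq_sub_one : ((n : ℂ) ^ 2 - 1) = (((n : ℝ) ^ 2 - 1 : ℝ) : ℂ) := by push_cast; ring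

theorem subordination (hn : 2 ≤ n) {R L : ℝ} (hR : 1 ≤ R) (hL : 1 ≤ L) {ρ : ℝ}
    (hρ : ρ = L + ((n : ℝ) ^ 3 + 1) * R)
    [Nonempty (Fin n × ι)] {X : Matrix (Fin n × ι) (Fin n × ι) ℂ} (hX : X.IsHermitian)
    (hXR : ‖X‖ ≤ R) {z : ℂ} (hz : 0 < z.im) (hz1 : z.im ≤ 1) (hzL : ‖z‖ ≤ L) :
    gU X z ≠ 0 ∧ z.im / ρ ^ 2 ≤ ‖gU X z‖ ∧ z.im ≤ (omU X z).im ∧ ‖omU X z‖ ≤ (L + ρ ^ 2) / z.im ∧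
    ‖stj hX.eigenvalues (omU X z) - gU X z‖ ≤
      4 * ((n : ℝ) ^ 3 + 1) ^ 2 * (2 * R + 2 * R ^ 2 * ((n : ℝ) ^ 3 + 1)) ^ 2 * ρ ^ 2 /
        ((Fintype.card (Fin n × ι) : ℝ) ^ 2 * z.im ^ 7) := by
  set η := z.im with hη
  set g := gU X z with hg
  set T : ℝ := (n : ℝ) ^ 2 - 1 with hT
  have hT3 : 3 ≤ T := three_le_sq_sub_one hn
  have hN : (0 : ℝ) < Fintype.card (Fin n × ι) := by exact_mod_cast Fintype.card_pos
  have hρ1 : 1 ≤ ρ := by rw [hρ]; nlinarith [pow_nonneg (Nat.cast_nonneg (α := ℝ) n) 3]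
  have hg1 : η / ρ ^ 2 ≤ -g.im := neg_im_gU_ge hX hz (by
    rw [hρ]; gcongr)
  have hg2 : η / ρ ^ 2 ≤ ‖g‖ := hg1.trans ((neg_le_abs _).trans (Complex.abs_im_le_norm g))
  have hpos : 0 < η / ρ ^ 2 := by positivity
  have hg0 : g ≠ 0 := norm_pos_iff.1 (hpos.trans_le hg2)
  have him : η ≤ (1 / g).im := by
    have h := norm_sq_gU_le hX hz
    rw [one_div, Complex.inv_im, Complex.normSq_eq_norm_sq, le_div_iff₀ (by positivity)]
    exact h
  have hom : omU X z = ((1 / T : ℝ) : ℂ) * z + ((1 - 1 / T : ℝ) : ℂ) * (1 / g) := by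
    rw [omU, coe_sq_sub_one, ← hT, ← hg]; push_cast; ring
  have hTi : 0 < 1 / T := by positivity
  have hTi1 : 1 / T ≤ 1 := by rw [div_le_one (by linarith)]; linarith
  have homi : η ≤ (omU X z).im := by
    rw [hom, Complex.add_im, Complex.im_ofReal_mul, Complex.im_ofReal_mul, ← hη]
    nlinarith
  have hgi : ‖1 / g‖ ≤ ρ ^ 2 / η := by
    rw [norm_div, norm_one, show ρ ^ 2 / η = 1 / (η / ρ ^ 2) by rw [one_div_div]]
    exact one_div_le_one_div_of_le hpos hg2
  refine ⟨hg0, hg2, homi, ?_, ?_⟩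
  · rw [hom]
    refine (norm_add_le _ _).trans ?_
    rw [norm_mul, norm_mul, Complex.norm_real, Complex.norm_real, Real.norm_of_nonneg hTi.le,
      Real.norm_of_nonneg (by linarith), add_div]
    have h1 : L ≤ L / η := by rw [le_div_iff₀ hz]; nlinarith
    have := norm_nonneg z
    have := norm_nonneg (1 / g)
    exact add_le_add (by nlinarith) (by nlinarith)
  · have hom0 : (omU X z).im ≠ 0 := (hz.trans_le homi).ne'
    set φ := resM (omU X z) X with hφ
    have hφn : ‖φ‖ ≤ 1 / η := (norm_resM_le hX (hz.trans_le homi)).trans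
      (one_div_le_one_div_of_le hz homi)
    have hη1 : 1 ≤ 1 / η := by rw [le_div_iff₀ hz]; linarith
    have hXφ : X * φ = omU X z • φ - 1 := by
      have := mul_resM hX hom0
      rw [sub_mul, smul_mul_assoc, one_mul] at this
      rw [hφ, ← this]; abel
    have hm := master_bound hn hX hz le_rfl hXR (φ := φ) (p := R * (1 / η)) (by nlinarith)
      (by nlinarith) (hφn.trans (by nlinarith)) ((norm_mul_le _ _).trans (by gcongr))
    rw [hXφ, gamU_smul_sub hX hz.ne', gamU_one, ← hg] at hm
    have hzg := mul_gU hX hz.ne'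
    rw [← hg] at hzg
    have hTc : ((n : ℂ) ^ 2 - 1) ≠ 0 := by
      rw [coe_sq_sub_one, ← hT]; exact_mod_cast (by linarith : T ≠ 0)
    have hkey : gamU X z φ - ntr φ * (((n : ℂ) ^ 2 - 1) * g) + (gamU X z φ * gamU X z X -
        (omU X z * gamU X z φ - ((n : ℂ) ^ 2 - 1) * g) * (((n : ℂ) ^ 2 - 1) * g)) /
          ((n : ℂ) ^ 2 - 1) = -(((n : ℂ) ^ 2 - 1) * g * (ntr φ - g)) := by
      have : gamU X z X = z * g - 1 := by rw [hzg]; ring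
      rw [this, omU, ← hg]
      field_simp
      ring
    rw [hkey, norm_neg, norm_mul, norm_mul, coe_sq_sub_one, ← hT, Complex.norm_real,
      Real.norm_of_nonneg (by linarith), ntr_resM_eq_stj hX hom0] at hm
    set e := ‖stj hX.eigenvalues (omU X z) - g‖
    have he0 : 0 ≤ e := norm_nonneg _
    have h1 : η / ρ ^ 2 * e ≤ T * ‖g‖ * e := by
      gcongr
      nlinarith
    set c := (n : ℝ) ^ 3 + 1
    have hc : 0 ≤ c := by positivity
    set N := (Fintype.card (Fin n × ι) : ℝ)
    have h2 : 2 * (R * (1 / η)) * (1 / η) + 2 * R * (c * (R * (1 / η) * (1 / η) ^ 2)) ≤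
        (2 * R + 2 * R ^ 2 * c) * (1 / η) ^ 3 := by
      have : (1 / η) ^ 2 ≤ (1 / η) ^ 3 := pow_le_pow_right₀ hη1 (by norm_num)
      nlinarith
    have h3 : η / ρ ^ 2 * e ≤ 2 * c ^ 2 * (2 * ((2 * R + 2 * R ^ 2 * c) * (1 / η) ^ 3) ^ 2 / N ^ 2) := by
      refine (h1.trans hm).trans ?_
      gcongr
    rw [le_div_iff₀ (by positivity)]
    have h4 : e * (N ^ 2 * η ^ 7) = (η / ρ ^ 2 * e) * (ρ ^ 2 * N ^ 2 * η ^ 6) := by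
      field_simp
    rw [h4]
    calc _ ≤ 2 * c ^ 2 * (2 * ((2 * R + 2 * R ^ 2 * c) * (1 / η) ^ 3) ^ 2 / N ^ 2) *
          (ρ ^ 2 * N ^ 2 * η ^ 6) := by gcongr
      _ = _ := by field_simp; ring

end Subordination

/-! ### Stability of the subordination equation -/

section Stability

variable {J : Type*} [Fintype J]

/-- The centered and normalized resolvent values. -/
def bst (a : J → ℝ) (w : ℂ) (i : J) : ℂ := 1 / (w - a i : ℂ) / stj a w - 1

/-- The map whose inverse is the subordination function. -/
def Hst (s : ℝ) (a : J → ℝ) (w : ℂ) : ℂ := w + s * (w - 1 / stj a w)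

/-- The contraction coefficient of the subordination equation. -/
def qst (s : ℝ) (a : J → ℝ) (w : ℂ) : ℝ := s * ((Fintype.card J : ℝ)⁻¹ * ∑ i, ‖bst a w i‖ ^ 2)

lemma stj_sub_stj (a : J → ℝ) {v w : ℂ} (hv : ∀ i, v - a i ≠ 0) (hw : ∀ i, w - a i ≠ 0) :
    stj a v - stj a w = (w - v) * ((Fintype.card J : ℂ)⁻¹ *
      ∑ i, 1 / (v - a i : ℂ) * (1 / (w - a i : ℂ))) := by
  have h : ∑ i, 1 / (v - a i : ℂ) - ∑ i, 1 / (w - a i : ℂ) =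
      (w - v) * ∑ i, 1 / (v - a i : ℂ) * (1 / (w - a i : ℂ)) := by
    rw [← Finset.sum_sub_distrib, Finset.mul_sum]
    refine Finset.sum_congr rfl fun i _ => ?_
    have := hv i
    have := hw i
    field_simp
    ring
  rw [stj, stj, ← mul_sub, h]
  ring

lemma Hst_sub_Hst [Nonempty J] (s : ℝ) (a : J → ℝ) {v w : ℂ} (hv : ∀ i, v - a i ≠ 0)
    (hw : ∀ i, w - a i ≠ 0) (hv0 : stj a v ≠ 0) (hw0 : stj a w ≠ 0) :
    Hst s a v - Hst s a w = (v - w) * (1 - s * ((Fintype.card J : ℂ)⁻¹ *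
      ∑ i, bst a v i * bst a w i)) := by
  have hN : (Fintype.card J : ℂ) ≠ 0 := by exact_mod_cast Fintype.card_ne_zero
  have h1 := stj_sub_stj a hv hw
  have h2 : (Fintype.card J : ℂ)⁻¹ * ∑ i, bst a v i * bst a w i =
      ((Fintype.card J : ℂ)⁻¹ * ∑ i, 1 / (v - a i : ℂ) * (1 / (w - a i : ℂ))) /
        (stj a v * stj a w) - 1 := by
    have e : ∀ i, bst a v i * bst a w i = 1 / (v - a i : ℂ) * (1 / (w - a i : ℂ)) *
        (1 / (stj a v * stj a w)) - 1 / (v - a i : ℂ) * (1 / stj a v) -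
        1 / (w - a i : ℂ) * (1 / stj a w) + 1 := fun i => by
      unfold bst; field_simp; ring
    simp only [e]
    rw [Finset.sum_add_distrib, Finset.sum_sub_distrib, Finset.sum_sub_distrib,
      ← Finset.sum_mul, ← Finset.sum_mul, ← Finset.sum_mul]
    simp only [Finset.sum_const, Finset.card_univ, nsmul_eq_mul, mul_one]
    have e1 : ∑ i, 1 / (v - a i : ℂ) = Fintype.card J * stj a v := by
      rw [stj, mul_inv_cancel_left₀ hN]
    have e2 : ∑ i, 1 / (w - a i : ℂ) = Fintype.card J * stj a w := by
      rw [stj, mul_inv_cancel_left₀ hN]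
    rw [e1, e2]
    field_simp
    ring
  rw [h2]
  set t := (Fintype.card J : ℂ)⁻¹ * ∑ i, 1 / (v - a i : ℂ) * (1 / (w - a i : ℂ))
  unfold Hst
  have h3 : stj a v = stj a w + (w - v) * t := by rw [← h1]; ring
  have h4 : 1 / stj a v - 1 / stj a w = (v - w) * (t / (stj a v * stj a w)) := by
    rw [div_sub_div _ _ hv0 hw0, one_mul, mul_one, ← mul_div_assoc]
    congr 1
    rw [h3]; ring
  linear_combination -(s : ℂ) * h4

lemma norm_sum_mul_le {f g : J → ℂ} {p q : ℝ}
    (hf : (Fintype.card J : ℝ)⁻¹ * ∑ i, ‖f i‖ ^ 2 ≤ p) (hg : (Fintype.card J : ℝ)⁻¹ * ∑ i, ‖g i‖ ^ 2 ≤ q) :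
    ‖(Fintype.card J : ℂ)⁻¹ * ∑ i, f i * g i‖ ≤ √(p * q) := by
  apply Real.le_sqrt_of_sq_le
  rw [norm_mul, norm_inv, Complex.norm_natCast, mul_pow]
  have h1 : ‖∑ i, f i * g i‖ ^ 2 ≤ (∑ i, ‖f i‖ ^ 2) * ∑ i, ‖g i‖ ^ 2 := by
    calc _ ≤ (∑ i, ‖f i‖ * ‖g i‖) ^ 2 := by
          refine pow_le_pow_left₀ (norm_nonneg _) ((norm_sum_le _ _).trans_eq ?_) 2
          simp
      _ ≤ _ := Finset.sum_mul_sq_le_sq_mul_sq _ _ _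
  calc _ ≤ (Fintype.card J : ℝ)⁻¹ ^ 2 * ((∑ i, ‖f i‖ ^ 2) * ∑ i, ‖g i‖ ^ 2) := by gcongr
    _ = ((Fintype.card J : ℝ)⁻¹ * ∑ i, ‖f i‖ ^ 2) * ((Fintype.card J : ℝ)⁻¹ * ∑ i, ‖g i‖ ^ 2) := by
      ring
    _ ≤ p * q := by
      have h0 : 0 ≤ (Fintype.card J : ℝ)⁻¹ * ∑ i, ‖f i‖ ^ 2 := by positivity
      have h2 : 0 ≤ (Fintype.card J : ℝ)⁻¹ * ∑ i, ‖g i‖ ^ 2 := by positivity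
      exact mul_le_mul hf hg h2 (h0.trans hf)

lemma qst_nonneg {s : ℝ} (hs : 0 ≤ s) (a : J → ℝ) (w : ℂ) : 0 ≤ qst s a w := by
  unfold qst; positivity

lemma norm_Hst_sub_ge [Nonempty J] {s : ℝ} (hs : 0 < s) (a : J → ℝ) {v w : ℂ}
    (hv : ∀ i, v - a i ≠ 0) (hw : ∀ i, w - a i ≠ 0) (hv0 : stj a v ≠ 0) (hw0 : stj a w ≠ 0) :
    ‖v - w‖ * (1 - √(qst s a v * qst s a w)) ≤ ‖Hst s a v - Hst s a w‖ := by
  rw [Hst_sub_Hst s a hv hw hv0 hw0, norm_mul]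
  gcongr
  have h := norm_sum_mul_le (f := bst a v) (g := bst a w) le_rfl le_rfl
  have h2 : s * ‖(Fintype.card J : ℂ)⁻¹ * ∑ i, bst a v i * bst a w i‖ ≤
      √(qst s a v * qst s a w) := by
    calc _ ≤ s * _ := mul_le_mul_of_nonneg_left h hs.le
      _ = √(s ^ 2) * _ := by rw [Real.sqrt_sq hs.le]
      _ = _ := by
        rw [← Real.sqrt_mul (sq_nonneg s)]
        congr 1; unfold qst; ring
  calc _ ≤ 1 - s * ‖(Fintype.card J : ℂ)⁻¹ * ∑ i, bst a v i * bst a w i‖ := by linarith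
    _ = ‖(1 : ℂ)‖ - ‖(s : ℂ) * ((Fintype.card J : ℂ)⁻¹ * ∑ i, bst a v i * bst a w i)‖ := by
      rw [norm_one, norm_mul (s : ℂ), Complex.norm_real, Real.norm_of_nonneg hs.le]
    _ ≤ _ := norm_sub_norm_le _ _

lemma stj_conj (a : J → ℝ) (w : ℂ) : stj a (starRingEnd ℂ w) = starRingEnd ℂ (stj a w) := by
  simp [stj]

lemma Hst_conj (s : ℝ) (a : J → ℝ) (w : ℂ) :
    Hst s a (starRingEnd ℂ w) = starRingEnd ℂ (Hst s a w) := by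
  simp [Hst, stj_conj]

lemma bst_conj (a : J → ℝ) (w : ℂ) (i : J) :
    bst a (starRingEnd ℂ w) i = starRingEnd ℂ (bst a w i) := by
  simp [bst, stj_conj]

lemma stj_ne_zero [Nonempty J] (a : J → ℝ) {w : ℂ} (hw : 0 < w.im) : stj a w ≠ 0 := by
  intro h
  have h1 := neg_im_stj_ge a hw (ρ := ‖w‖ + ∑ i, |a i|) fun i => by
    gcongr
    exact Finset.single_le_sum (f := fun i => |a i|) (fun i _ => abs_nonneg _) (Finset.mem_univ i)
  rw [h] at h1
  have h2 : 0 < ‖w‖ := norm_pos_iff.2 fun h => by simp [h] at hw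
  have h3 : 0 ≤ ∑ i, |a i| := Finset.sum_nonneg fun i _ => abs_nonneg _
  have : 0 < w.im / (‖w‖ + ∑ i, |a i|) ^ 2 := by positivity
  simp at h1
  linarith

lemma im_Hst [Nonempty J] (s : ℝ) (a : J → ℝ) {w : ℂ} (hw : 0 < w.im) :
    (Hst s a w).im = w.im * (1 - qst s a w) := by
  have hne : ∀ i, w - a i ≠ 0 := fun i => im_sub_ofReal_ne hw.ne' _
  have hne' : ∀ i, starRingEnd ℂ w - a i ≠ 0 := fun i => im_sub_ofReal_ne (by simpa using hw.ne') _
  have h0 := stj_ne_zero a hw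
  have h := Hst_sub_Hst s a hne hne' h0 (by rw [stj_conj]; simpa using h0)
  simp only [Hst_conj, bst_conj, Complex.mul_conj, Complex.normSq_eq_norm_sq] at h
  have e : (1 - (s : ℂ) * ((Fintype.card J : ℂ)⁻¹ * ∑ i, ((‖bst a w i‖ ^ 2 : ℝ) : ℂ))) =
      ((1 - qst s a w : ℝ) : ℂ) := by unfold qst; push_cast; rfl
  rw [e, Complex.sub_conj, Complex.sub_conj] at h
  have h2 := congrArg Complex.im h
  simp at h2
  linarith

lemma norm_sub_le_of_Hst [Nonempty J] {s : ℝ} (hs : 0 < s) (a : J → ℝ) {v w z : ℂ} {η Ω κ : ℝ}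
    (hη : 0 < η) (hz : z.im = η) (hκ : κ ≤ η / 2) (hv : 0 < v.im) (hw : 0 < w.im)
    (hvΩ : v.im ≤ Ω) (hwΩ : w.im ≤ Ω)
    (hHv : ‖Hst s a v - z‖ ≤ κ) (hHw : ‖Hst s a w - z‖ ≤ κ) : ‖v - w‖ ≤ 4 * Ω * κ / η := by
  have hΩ : 0 < Ω := hv.trans_le hvΩ
  have key : ∀ u : ℂ, 0 < u.im → u.im ≤ Ω → ‖Hst s a u - z‖ ≤ κ → qst s a u ≤ 1 - η / (2 * Ω) := by
    intro u hu huΩ hH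
    have h1 := (Complex.abs_im_le_norm _).trans hH
    rw [Complex.sub_im, hz, im_Hst s a hu, abs_le] at h1
    have h2 : η / 2 ≤ u.im * (1 - qst s a u) := by linarith
    have h3 : 0 < 1 - qst s a u := by
      by_contra h
      nlinarith
    have h4 : η / 2 ≤ Ω * (1 - qst s a u) := h2.trans (by gcongr)
    have : η / (2 * Ω) ≤ 1 - qst s a u := by
      rw [div_le_iff₀ (by positivity)]; linarith
    linarith
  have h1 := norm_Hst_sub_ge hs a (fun i => im_sub_ofReal_ne hv.ne' (a i))
    (fun i => im_sub_ofReal_ne hw.ne' (a i)) (stj_ne_zero a hv) (stj_ne_zero a hw)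
  have hqv := key v hv hvΩ hHv
  have hqw := key w hw hwΩ hHw
  have h2 : √(qst s a v * qst s a w) ≤ 1 - η / (2 * Ω) := by
    rw [Real.sqrt_le_iff]
    have := qst_nonneg hs.le a v
    have := qst_nonneg hs.le a w
    exact ⟨by linarith, by nlinarith⟩
  have h3 : ‖Hst s a v - Hst s a w‖ ≤ 2 * κ := by
    calc _ = ‖(Hst s a v - z) - (Hst s a w - z)‖ := by congr 1; ring
      _ ≤ _ := (norm_sub_le _ _).trans (by linarith)
  have h4 : ‖v - w‖ * (η / (2 * Ω)) ≤ 2 * κ := by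
    calc _ ≤ ‖v - w‖ * (1 - √(qst s a v * qst s a w)) := by gcongr; linarith
      _ ≤ _ := h1.trans h3
  rw [le_div_iff₀ hη]
  have h5 : ‖v - w‖ * (η / (2 * Ω)) = ‖v - w‖ * η / (2 * Ω) := by ring
  rw [h5, div_le_iff₀ (by positivity)] at h4
  linarith

lemma norm_stj_sub_le [Nonempty J] (a : J → ℝ) {v w : ℂ} {p q : ℝ} (hp : 0 < p) (hq : 0 < q)
    (hv : ∀ i, p ≤ ‖v - a i‖) (hw : ∀ i, q ≤ ‖w - a i‖) :
    ‖stj a v - stj a w‖ ≤ ‖v - w‖ / (p * q) := by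
  have hv0 : ∀ i, v - a i ≠ 0 := fun i => norm_pos_iff.1 (hp.trans_le (hv i))
  have hw0 : ∀ i, w - a i ≠ 0 := fun i => norm_pos_iff.1 (hq.trans_le (hw i))
  rw [stj_sub_stj a hv0 hw0, norm_mul, norm_sub_rev w v, div_eq_mul_inv]
  gcongr
  rw [norm_mul, norm_inv, Complex.norm_natCast]
  have hN : (0 : ℝ) < Fintype.card J := by exact_mod_cast Fintype.card_pos
  rw [inv_mul_le_iff₀ hN]
  refine (norm_sum_le _ _).trans ?_
  calc _ ≤ ∑ _i : J, (p * q)⁻¹ := by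
        refine Finset.sum_le_sum fun i _ => ?_
        rw [norm_mul, norm_div, norm_div, norm_one, one_div, one_div, mul_inv]
        have := hv i
        have := hw i
        gcongr
    _ = _ := by simp

end Stability

/-! ### The real branch of the subordination equation -/

section RealBranch

variable {J : Type*} [Fintype J]

/-- The real Stieltjes transform to the right of the support. -/
def rst (a : J → ℝ) (w : ℝ) : ℝ := (Fintype.card J : ℝ)⁻¹ * ∑ i, 1 / (w - a i)

lemma stj_ofReal (a : J → ℝ) (w : ℝ) : stj a (w : ℂ) = (rst a w : ℂ) := by
  unfold stj rst; push_cast; rfl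

lemma rst_pos [Nonempty J] {a : J → ℝ} {w : ℝ} (h : ∀ i, a i < w) : 0 < rst a w := by
  unfold rst
  have hN : (0 : ℝ) < Fintype.card J := by exact_mod_cast Fintype.card_pos
  have : 0 < ∑ i, 1 / (w - a i) :=
    Finset.sum_pos (fun i _ => one_div_pos.2 (sub_pos.2 (h i))) Finset.univ_nonempty
  positivity

lemma Hst_ofReal (s : ℝ) (a : J → ℝ) (w : ℝ) :
    Hst s a (w : ℂ) = ((w + s * (w - 1 / rst a w) : ℝ) : ℂ) := by
  unfold Hst; rw [stj_ofReal]; push_cast; rfl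

variable [Nonempty J] {a : J → ℝ} {w δ σ : ℝ}

lemma real_branch_shift (hδ : 0 < δ) (h : ∀ i, δ ≤ w - a i) (hm : ∑ i, a i = 0)
    (hσ : (Fintype.card J : ℝ)⁻¹ * ∑ i, a i ^ 2 ≤ σ ^ 2) :
    0 ≤ w - 1 / rst a w ∧ w - 1 / rst a w ≤ σ ^ 2 / δ ∧
    δ ^ 2 * ((Fintype.card J : ℝ)⁻¹ * ∑ i, ((1 / (w - a i)) / rst a w - 1) ^ 2) ≤ σ ^ 2 := by
  have hN : (0 : ℝ) < Fintype.card J := by exact_mod_cast Fintype.card_pos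
  have hg := rst_pos (a := a) (w := w) fun i => by linarith [h i]
  have hw : δ ≤ w := by
    have h1 : ∑ _i : J, δ ≤ ∑ i, (w - a i) := Finset.sum_le_sum fun i _ => h i
    rw [Finset.sum_sub_distrib, hm] at h1
    simp only [Finset.sum_const, Finset.card_univ, nsmul_eq_mul, sub_zero] at h1
    exact le_of_mul_le_mul_left h1 hN
  have hw0 : 0 < w := hδ.trans_le hw
  set N : ℝ := (Fintype.card J : ℝ) with hNdef
  set F := 1 / rst a w with hF
  have hFpos : 0 < F := by positivity
  have hsum : ∑ i, 1 / (w - a i) = N / F := by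
    rw [hF, rst, ← hNdef]; field_simp
  set b : J → ℝ := fun i => (1 / (w - a i)) / rst a w - 1 with hb
  have hyb : ∀ i, (w - a i) * b i = F - (w - a i) := fun i => by
    have : w - a i ≠ 0 := by linarith [h i]
    simp only [hb, hF]; field_simp
  have hsb : ∑ i, b i = 0 := by
    simp only [hb, Finset.sum_sub_distrib, ← Finset.sum_div, hsum]
    simp only [Finset.sum_const, Finset.card_univ, nsmul_eq_mul, mul_one, ← hNdef]
    rw [hF]; field_simp; ring
  have hsyb : ∑ i, (w - a i) * b i = N * (F - w) := by
    simp only [hyb, Finset.sum_sub_distrib, hm]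
    simp only [Finset.sum_const, Finset.card_univ, nsmul_eq_mul, ← hNdef]
    ring
  have hr0 : N * (w - F) = ∑ i, (w - a i) * b i ^ 2 := by
    have : ∑ i, (w - a i) * b i ^ 2 = F * ∑ i, b i - ∑ i, (w - a i) * b i := by
      rw [Finset.mul_sum, ← Finset.sum_sub_distrib]
      refine Finset.sum_congr rfl fun i _ => ?_
      linear_combination (b i) * hyb i
    rw [this, hsb, hsyb]; ring
  have hrpos : 0 ≤ w - F := by
    have : 0 ≤ ∑ i, (w - a i) * b i ^ 2 := Finset.sum_nonneg fun i _ =>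
      mul_nonneg (by linarith [h i]) (sq_nonneg _)
    rw [← hr0] at this
    exact nonneg_of_mul_nonneg_right this hN
  have hσ2 : ∑ i, a i ^ 2 ≤ N * σ ^ 2 := by
    rwa [inv_mul_le_iff₀ hN] at hσ
  refine ⟨hrpos, ?_, ?_⟩
  · have h1 : ∀ i, 1 / (w - a i) ≤ 1 / w + a i * (1 / w ^ 2) + a i ^ 2 * (1 / (w ^ 2 * δ)) := by
      intro i
      have hy : 0 < w - a i := by linarith [h i]
      have e : 1 / (w - a i) = 1 / w + a i * (1 / w ^ 2) + a i ^ 2 * (1 / (w ^ 2 * (w - a i))) := by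
        field_simp; ring
      rw [e]
      have := h i
      gcongr
    have h2 : N / F ≤ N / w + N * σ ^ 2 * (1 / (w ^ 2 * δ)) := by
      rw [← hsum]
      refine (Finset.sum_le_sum fun i _ => h1 i).trans ?_
      rw [Finset.sum_add_distrib, Finset.sum_add_distrib, ← Finset.sum_mul, ← Finset.sum_mul, hm]
      simp only [Finset.sum_const, Finset.card_univ, nsmul_eq_mul, ← hNdef]
      have : (∑ i, a i ^ 2) * (1 / (w ^ 2 * δ)) ≤ N * σ ^ 2 * (1 / (w ^ 2 * δ)) := by gcongr
      have e : N * (1 / w) = N / w := by ring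
      linarith
    have h3 : 1 / F ≤ 1 / w + σ ^ 2 / (w ^ 2 * δ) := by
      have e1 : N / F = N * (1 / F) := by ring
      have e2 : N / w + N * σ ^ 2 * (1 / (w ^ 2 * δ)) = N * (1 / w + σ ^ 2 / (w ^ 2 * δ)) := by ring
      rw [e1, e2] at h2
      exact le_of_mul_le_mul_left h2 hN
    have e : 1 / w + σ ^ 2 / (w ^ 2 * δ) = (w * δ + σ ^ 2) / (w ^ 2 * δ) := by
      field_simp
    rw [e, div_le_div_iff₀ hFpos (by positivity)] at h3
    have h4 : (w - F) * (w * δ) ≤ F * σ ^ 2 := by nlinarith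
    rw [le_div_iff₀ hδ]
    have h5 : (w - F) * δ * w ≤ σ ^ 2 * w := by nlinarith [sq_nonneg σ]
    exact le_of_mul_le_mul_right h5 hw0
  · have h1 : N * (w - F) = -∑ i, (w - a i - δ) * b i := by
      have : ∑ i, (w - a i - δ) * b i = ∑ i, (w - a i) * b i - δ * ∑ i, b i := by
        rw [Finset.mul_sum, ← Finset.sum_sub_distrib]
        exact Finset.sum_congr rfl fun i _ => by ring
      rw [this, hsb, hsyb]; ring
    have h2 : (N * (w - F)) ^ 2 ≤ N * ∑ i, ((w - a i - δ) * b i) ^ 2 := by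
      rw [h1, neg_sq]
      have := sq_sum_le_card_mul_sum_sq (s := Finset.univ) (f := fun i => (w - a i - δ) * b i)
      simpa using this
    have h3 : ∑ i, ((w - a i - δ) * b i) ^ 2 ≤ ∑ i, (F - (w - a i)) ^ 2 - δ ^ 2 * ∑ i, b i ^ 2 := by
      rw [Finset.mul_sum, ← Finset.sum_sub_distrib]
      refine Finset.sum_le_sum fun i _ => ?_
      rw [← hyb]
      have : (w - a i - δ) ^ 2 ≤ (w - a i) ^ 2 - δ ^ 2 := by nlinarith [h i]
      nlinarith [sq_nonneg (b i)]
    have h4 : ∑ i, (F - (w - a i)) ^ 2 ≤ N * σ ^ 2 + N * (w - F) ^ 2 := by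
      have : ∑ i, (F - (w - a i)) ^ 2 = ∑ i, a i ^ 2 + 2 * (F - w) * ∑ i, a i + N * (w - F) ^ 2 := by
        have e : ∀ i, (F - (w - a i)) ^ 2 = a i ^ 2 + 2 * (F - w) * a i + (w - F) ^ 2 := fun i => by
          ring
        simp only [e, Finset.sum_add_distrib, ← Finset.mul_sum]
        simp [← hNdef]
      rw [this, hm]; linarith
    have h5 : N * (N * (w - F) ^ 2) ≤ N * (N * σ ^ 2 + N * (w - F) ^ 2 - δ ^ 2 * ∑ i, b i ^ 2) := by
      calc N * (N * (w - F) ^ 2) = (N * (w - F)) ^ 2 := by ring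
        _ ≤ _ := h2.trans (by gcongr; linarith)
    have h6 := le_of_mul_le_mul_left h5 hN
    rw [mul_left_comm, inv_mul_le_iff₀ hN]
    linarith

lemma exists_real_branch {s B ε x : ℝ} (hs : 0 < s) (hε : 0 < ε) (hσ0 : 0 ≤ σ)
    (hB : ∀ i, a i ≤ B) (hm : ∑ i, a i = 0)
    (hσ : (Fintype.card J : ℝ)⁻¹ * ∑ i, a i ^ 2 ≤ σ ^ 2) (hx : B + 2 * σ * √s + ε ≤ x) :
    ∃ w : ℝ, (∀ i, ε ≤ w - a i) ∧ Hst s a w = x ∧ √(qst s a w) ≤ 1 - ε / (σ * √s + ε) := by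
  set δ := σ * √s + ε with hδ
  have hss : 0 < √s := Real.sqrt_pos.2 hs
  have hs2 : √s ^ 2 = s := Real.sq_sqrt hs.le
  have hσs : 0 ≤ σ * √s := by positivity
  have hδε : ε ≤ δ := by linarith
  have hδ0 : 0 < δ := hε.trans_le hδε
  set f : ℝ → ℝ := fun w => w + s * (w - 1 / rst a w) with hf
  have hle : B + δ ≤ x := by linarith
  have hgap : ∀ w, B + δ ≤ w → ∀ i, δ ≤ w - a i := fun w hw i => by linarith [hB i]
  have hcont : ContinuousOn f (Set.Icc (B + δ) x) := by
    have h1 : ContinuousOn (rst a) (Set.Icc (B + δ) x) := by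
      unfold rst
      refine continuousOn_const.mul (continuousOn_finsetSum _ fun i _ => ?_)
      refine continuousOn_const.div (by fun_prop) fun w hw => ?_
      have := hgap w hw.1 i
      linarith
    refine continuousOn_id.add (continuousOn_const.mul (continuousOn_id.sub
      (continuousOn_const.div h1 fun w hw => ?_)))
    exact (rst_pos fun i => by linarith [hgap w hw.1 i]).ne'
  have hlo : f (B + δ) ≤ x := by
    have h1 := (real_branch_shift hδ0 (hgap _ le_rfl) hm hσ).2.1
    have h2 : s * (σ ^ 2 / δ) ≤ σ * √s := by
      rw [← mul_div_assoc, div_le_iff₀ hδ0]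
      have : s * σ ^ 2 = (σ * √s) * (σ * √s) := by
        linear_combination -(σ ^ 2) * hs2
      rw [this]
      gcongr
      linarith
    have h3 := mul_le_mul_of_nonneg_left h1 hs.le
    simp only [hf]
    linarith
  have hhi : x ≤ f x := by
    have h1 := (real_branch_shift hδ0 (hgap _ hle) hm hσ).1
    simp only [hf]
    nlinarith
  obtain ⟨w, hw, hwx⟩ := intermediate_value_Icc hle hcont ⟨hlo, hhi⟩
  refine ⟨w, fun i => hδε.trans (hgap w hw.1 i), ?_, ?_⟩
  · rw [Hst_ofReal, ← hwx]
  · have h1 := (real_branch_shift hδ0 (hgap _ hw.1) hm hσ).2.2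
    have e : qst s a w = s * ((Fintype.card J : ℝ)⁻¹ *
        ∑ i, ((1 / (w - a i)) / rst a w - 1) ^ 2) := by
      unfold qst bst
      congr 2
      refine Finset.sum_congr rfl fun i _ => ?_
      rw [stj_ofReal]
      have : (1 / ((w : ℂ) - a i) / (rst a w : ℂ) - 1) =
          ((1 / (w - a i) / rst a w - 1 : ℝ) : ℂ) := by push_cast; rfl
      rw [this, Complex.norm_real, Real.norm_eq_abs, sq_abs]
    have h2 : 1 - ε / δ = σ * √s / δ := by
      rw [hδ]; field_simp; ring
    rw [h2]
    apply Real.sqrt_le_iff.2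
    refine ⟨by positivity, ?_⟩
    rw [e, div_pow, le_div_iff₀ (by positivity), mul_pow, hs2]
    nlinarith

end RealBranch

section Comparison

lemma norm_gU_le {n : ℕ} {ι : Type*} [Fintype ι] [DecidableEq ι]
    {X : Matrix (Fin n × ι) (Fin n × ι) ℂ} (hX : X.IsHermitian) {z : ℂ}
    (hz : 0 < z.im) : ‖gU X z‖ ≤ 1 / z.im := by
  have h1 := norm_sq_gU_le hX hz
  have h2 := (neg_le_abs _).trans (Complex.abs_im_le_norm (gU X z))
  rw [le_div_iff₀ hz]
  rcases (norm_nonneg (gU X z)).eq_or_lt with h | h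
  · rw [← h]; simp
  · have : (‖gU X z‖ * z.im) * ‖gU X z‖ ≤ 1 * ‖gU X z‖ := by nlinarith
    exact le_of_mul_le_mul_right this h

set_option maxHeartbeats 1000000 in
/-- Quantitative subordination, with constants depending only on `n` and the radii. -/
theorem exists_subordination {n : ℕ} (hn : 2 ≤ n) {R L : ℝ} (hR : 1 ≤ R) (hL : 1 ≤ L) :
    ∃ C : ℝ, 1 ≤ C ∧ ∀ (ι J : Type) [Fintype ι] [DecidableEq ι] [Nonempty (Fin n × ι)]
      [Fintype J] [Nonempty J] (X : Matrix (Fin n × ι) (Fin n × ι) ℂ) (a : J → ℝ)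
      (_ : X.IsHermitian) (_ : ‖X‖ ≤ R) (_ : ∀ i, |a i| ≤ R)
      (_ : ∀ w : ℂ, 0 < w.im → ntr (resM w X) = stj a w) (z : ℂ)
      (_ : 0 < z.im) (_ : z.im ≤ 1) (_ : ‖z‖ ≤ L),
      z.im ≤ (omU X z).im ∧ (omU X z).im ≤ C / z.im ∧
      ‖stj a (omU X z) - gU X z‖ ≤ C / ((Fintype.card (Fin n × ι) : ℝ) ^ 2 * z.im ^ 7) ∧
      ‖Hst ((n : ℝ) ^ 2 - 2) a (omU X z) - z‖ ≤
        C / ((Fintype.card (Fin n × ι) : ℝ) ^ 2 * z.im ^ 11) := by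
  obtain ⟨ρ, hρ⟩ : ∃ ρ : ℝ, ρ = L + ((n : ℝ) ^ 3 + 1) * R := ⟨_, rfl⟩
  obtain ⟨C0, hC0⟩ : ∃ C0 : ℝ, C0 = 4 * ((n : ℝ) ^ 3 + 1) ^ 2 *
    (2 * R + 2 * R ^ 2 * ((n : ℝ) ^ 3 + 1)) ^ 2 * ρ ^ 2 := ⟨_, rfl⟩
  have hC00 : 0 ≤ C0 := by rw [hC0]; positivity
  obtain ⟨s, hs⟩ : ∃ s : ℝ, s = (n : ℝ) ^ 2 - 2 := ⟨_, rfl⟩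
  rw [← hs]
  have hs1 : 1 ≤ s := by have := three_le_sq_sub_one hn; linarith
  have hρ1 : 1 ≤ ρ := by rw [hρ]; nlinarith [pow_nonneg (Nat.cast_nonneg (α := ℝ) n) 3]
  obtain ⟨A, hA⟩ : ∃ A : ℝ, A = L + ρ ^ 2 + R := ⟨_, rfl⟩
  have hA0 : 0 < A := by rw [hA]; positivity
  refine ⟨L + ρ ^ 2 + C0 + s * C0 * ρ ^ 2 * A ^ 2, ?_, ?_⟩
  · have : 0 ≤ s * C0 * ρ ^ 2 * A ^ 2 := by positivity
    linarith [sq_nonneg ρ]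
  intro ι J _ _ _ _ _ X a hX hXR haR hst z hz hz1 hzL
  obtain ⟨hg0, hg1, hw1, hw2, hg⟩ := subordination hn hR hL hρ hX hXR hz hz1 hzL
  have hw0 : 0 < (omU X z).im := hz.trans_le hw1
  rw [← ntr_resM_eq_stj hX hw0.ne', hst _ hw0, ← hC0] at hg
  set w := omU X z with hwdef
  set η := z.im
  set g := gU X z with hgdef
  set N : ℝ := (Fintype.card (Fin n × ι) : ℝ) with hNdef
  have hN : 0 < N := by rw [hNdef]; exact_mod_cast Fintype.card_pos
  have hX1 : 0 ≤ s * C0 * ρ ^ 2 * A ^ 2 := by positivity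
  refine ⟨hw1, ?_, ?_, ?_⟩
  · refine ((le_abs_self _).trans (Complex.abs_im_le_norm w)).trans (hw2.trans ?_)
    exact div_le_div_of_nonneg_right (by linarith) hz.le
  · refine hg.trans ?_
    gcongr
    linarith [sq_nonneg ρ]
  · have hS : η ^ 3 / A ^ 2 ≤ ‖stj a w‖ := by
      have h1 := neg_im_stj_ge a hw0 (ρ := A / η) fun i => by
        have : ‖w‖ + |a i| ≤ (L + ρ ^ 2) / η + R / η :=
          add_le_add hw2 ((haR i).trans (by
            rw [le_div_iff₀ hz]; exact mul_le_of_le_one_right (by linarith) hz1))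
        rw [← add_div, ← hA] at this
        exact this
      have h2 := h1.trans ((neg_le_abs _).trans (Complex.abs_im_le_norm _))
      refine le_trans ?_ h2
      rw [div_pow, div_div_eq_mul_div]
      refine div_le_div_of_nonneg_right ?_ (sq_nonneg A)
      calc η ^ 3 = η * η ^ 2 := by ring
        _ ≤ w.im * η ^ 2 := mul_le_mul_of_nonneg_right hw1 (sq_nonneg η)
    have hS0 : stj a w ≠ 0 := stj_ne_zero a hw0
    have hTc : ((n : ℂ) ^ 2 - 1) ≠ 0 := by
      rw [coe_sq_sub_one]; exact_mod_cast (by linarith : (n : ℝ) ^ 2 - 1 ≠ 0)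
    have e : Hst s a w - z = s * ((stj a w - g) * (1 / g) * (1 / stj a w)) := by
      have hz' : z = ((n : ℂ) ^ 2 - 1) * w - ((n : ℂ) ^ 2 - 2) * (1 / g) := by
        rw [hwdef, omU, ← hgdef]; field_simp; ring
      have hsc : (s : ℂ) = (n : ℂ) ^ 2 - 2 := by rw [hs]; push_cast; ring
      rw [Hst, hsc]
      nth_rewrite 1 [hz']
      field_simp
      ring
    have h1 : ‖1 / g‖ ≤ ρ ^ 2 / η := by
      rw [norm_div, norm_one, show ρ ^ 2 / η = 1 / (η / ρ ^ 2) by rw [one_div_div]]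
      exact one_div_le_one_div_of_le (by positivity) hg1
    have h2 : ‖1 / stj a w‖ ≤ A ^ 2 / η ^ 3 := by
      rw [norm_div, norm_one, show A ^ 2 / η ^ 3 = 1 / (η ^ 3 / A ^ 2) by rw [one_div_div]]
      exact one_div_le_one_div_of_le (by positivity) hS
    rw [e, norm_mul, norm_mul, norm_mul, Complex.norm_real, Real.norm_of_nonneg (by linarith)]
    calc _ ≤ s * (C0 / (N ^ 2 * η ^ 7) * (ρ ^ 2 / η) * (A ^ 2 / η ^ 3)) := by gcongr
      _ = s * C0 * ρ ^ 2 * A ^ 2 / (N ^ 2 * η ^ 11) := by field_simp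
      _ ≤ _ := by
        gcongr
        linarith [sq_nonneg ρ]

set_option maxHeartbeats 1000000 in
/-- Two models with the same spectral distribution have nearly the same expected resolvent. -/
theorem exists_comparison {n : ℕ} (hn : 2 ≤ n) {R L : ℝ} (hR : 1 ≤ R) (hL : 1 ≤ L) :
    ∃ C : ℝ, 1 ≤ C ∧ ∀ (ι κ J : Type) [Fintype ι] [DecidableEq ι] [Nonempty (Fin n × ι)]
      [Fintype κ] [DecidableEq κ] [Nonempty (Fin n × κ)]
      [Fintype J] [Nonempty J] (X : Matrix (Fin n × ι) (Fin n × ι) ℂ)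
      (Y : Matrix (Fin n × κ) (Fin n × κ) ℂ) (a : J → ℝ)
      (_ : X.IsHermitian) (_ : ‖X‖ ≤ R) (_ : Y.IsHermitian) (_ : ‖Y‖ ≤ R) (_ : ∀ i, |a i| ≤ R)
      (_ : ∀ w : ℂ, 0 < w.im → ntr (resM w X) = stj a w)
      (_ : ∀ w : ℂ, 0 < w.im → ntr (resM w Y) = stj a w)
      (_ : Fintype.card (Fin n × ι) ≤ Fintype.card (Fin n × κ)) (z : ℂ)
      (_ : 0 < z.im) (_ : z.im ≤ 1) (_ : ‖z‖ ≤ L),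
      ‖gU X z - gU Y z‖ ≤ C / ((Fintype.card (Fin n × ι) : ℝ) ^ 2 * z.im ^ 15) := by
  obtain ⟨C, hC, h⟩ := exists_subordination hn hR hL
  refine ⟨4 * C ^ 2 + 6 * C, by nlinarith, ?_⟩
  intro ι κ J _ _ _ _ _ _ _ _ X Y a hX hXR hY hYR haR hXs hYs hcard z hz hz1 hzL
  obtain ⟨hX1, hX2, hX3, hX4⟩ := h ι J X a hX hXR haR hXs z hz hz1 hzL
  obtain ⟨hY1, hY2, hY3, hY4⟩ := h κ J Y a hY hYR haR hYs z hz hz1 hzL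
  set η := z.im with hη
  set N : ℝ := (Fintype.card (Fin n × ι) : ℝ) with hNdef
  have hN : 0 < N := by rw [hNdef]; exact_mod_cast Fintype.card_pos
  have hNM : N ≤ (Fintype.card (Fin n × κ) : ℝ) := by rw [hNdef]; exact_mod_cast hcard
  have hs : (0 : ℝ) < (n : ℝ) ^ 2 - 2 := by have := three_le_sq_sub_one hn; linarith
  have hpow : ∀ k, k ≤ 15 → 1 / (N ^ 2 * η ^ k) ≤ 1 / (N ^ 2 * η ^ 15) := fun k hk => by
    gcongr 1 / (N ^ 2 * ?_)
    exact pow_le_pow_of_le_one hz.le hz1 hk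
  have hY3' := hY3.trans (show _ ≤ C / (N ^ 2 * η ^ 7) by gcongr)
  have hY4' := hY4.trans (show _ ≤ C / (N ^ 2 * η ^ 11) by gcongr)
  rcases le_total (C / (N ^ 2 * η ^ 11)) (η / 2) with hk | hk
  · have h1 := norm_sub_le_of_Hst hs a hz rfl hk (hz.trans_le hX1) (hz.trans_le hY1) hX2 hY2 hX4 hY4'
    have him : ∀ w : ℂ, η ≤ w.im → ∀ i, η ≤ ‖w - a i‖ := fun w hw i =>
      (hw.trans (by simpa using le_abs_self (w - a i).im)).trans (Complex.abs_im_le_norm _)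
    have h2 := norm_stj_sub_le a hz hz (him _ hX1) (him _ hY1)
    have h3 : ‖stj a (omU X z) - stj a (omU Y z)‖ ≤ 4 * C ^ 2 * (1 / (N ^ 2 * η ^ 15)) := by
      refine h2.trans ?_
      calc _ ≤ (4 * (C / η) * (C / (N ^ 2 * η ^ 11)) / η) / (η * η) := by gcongr
        _ = _ := by field_simp
    have e : gU X z - gU Y z = (stj a (omU X z) - stj a (omU Y z)) -
        (stj a (omU X z) - gU X z) + (stj a (omU Y z) - gU Y z) := by ring
    have h4 := hpow 7 (by norm_num)
    have h5 : C / (N ^ 2 * η ^ 7) ≤ C * (1 / (N ^ 2 * η ^ 15)) := by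
      rw [div_eq_mul_one_div]; gcongr
    have h6 : 0 ≤ 1 / (N ^ 2 * η ^ 15) := by positivity
    rw [e, div_eq_mul_one_div (4 * C ^ 2 + 6 * C)]
    calc _ ≤ _ := (norm_add_le _ _).trans (add_le_add (norm_sub_le _ _) le_rfl)
      _ ≤ 4 * C ^ 2 * (1 / (N ^ 2 * η ^ 15)) + C * (1 / (N ^ 2 * η ^ 15)) +
          C * (1 / (N ^ 2 * η ^ 15)) :=
        add_le_add (add_le_add h3 (hX3.trans h5)) (hY3'.trans h5)
      _ ≤ _ := by
        have : 0 ≤ C * (1 / (N ^ 2 * η ^ 15)) := by positivity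
        rw [add_mul]
        linarith
  · have h1 := norm_gU_le hX hz
    have h2 := norm_gU_le hY hz
    have h3 : 1 / η ≤ 2 * C * (1 / (N ^ 2 * η ^ 13)) := by
      calc 1 / η = (η / 2) * (2 / η ^ 2) := by field_simp
        _ ≤ C / (N ^ 2 * η ^ 11) * (2 / η ^ 2) := by gcongr
        _ = _ := by field_simp
    have h4 := hpow 13 (by norm_num)
    have h5 : 0 ≤ 1 / (N ^ 2 * η ^ 15) := by positivity
    rw [div_eq_mul_one_div (4 * C ^ 2 + 6 * C)]
    have h6 : 2 * C * (1 / (N ^ 2 * η ^ 13)) ≤ 2 * C * (1 / (N ^ 2 * η ^ 15)) := by gcongr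
    refine (norm_sub_le _ _).trans ?_
    have h7 : 0 ≤ C * (1 / (N ^ 2 * η ^ 15)) := by positivity
    have h8 : 0 ≤ 4 * C ^ 2 * (1 / (N ^ 2 * η ^ 15)) := by positivity
    rw [add_mul]
    linarith

set_option maxHeartbeats 1000000 in
/-- Outside the limiting support the expected resolvent is almost real, once the dimension is
large compared to the inverse distance to the real axis. -/
theorem exists_im_gU_le {n : ℕ} (hn : 2 ≤ n) {R L ε : ℝ} (hR : 1 ≤ R) (hL : 1 ≤ L) (hε : 0 < ε) :
    ∃ C η₀ : ℝ, 0 < C ∧ 0 < η₀ ∧ ∀ (ι J : Type) [Fintype ι] [DecidableEq ι] [Nonempty (Fin n × ι)]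
      [Fintype J] [Nonempty J] (X : Matrix (Fin n × ι) (Fin n × ι) ℂ) (a : J → ℝ) (B σ x η : ℝ)
      (_ : X.IsHermitian) (_ : ‖X‖ ≤ R) (_ : ∀ i, |a i| ≤ R)
      (_ : ∀ w : ℂ, 0 < w.im → ntr (resM w X) = stj a w)
      (_ : 0 ≤ σ) (_ : σ ≤ R) (_ : ∀ i, a i ≤ B) (_ : ∑ i, a i = 0)
      (_ : (Fintype.card J : ℝ)⁻¹ * ∑ i, a i ^ 2 ≤ σ ^ 2)
      (_ : B + 2 * σ * √((n : ℝ) ^ 2 - 2) + ε ≤ x) (_ : |x| + 1 ≤ L)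
      (_ : 0 < η) (_ : η ≤ η₀)
      (_ : C / ((Fintype.card (Fin n × ι) : ℝ) ^ 2 * η ^ 11) ≤ η / 2),
      -(gU X (x + η * Complex.I)).im ≤ C * η := by
  obtain ⟨C₁, hC₁, h⟩ := exists_subordination hn hR hL
  set s : ℝ := (n : ℝ) ^ 2 - 2 with hs
  have hs0 : 0 < s := by have := three_le_sq_sub_one hn; rw [hs]; linarith
  have hss : 0 < √s := Real.sqrt_pos.2 hs0
  set A : ℝ := (R * √s + ε) / ε with hA
  have hA0 : 0 < A := by positivity
  refine ⟨C₁ + 1 + 4 * A / ε ^ 2, min 1 (ε / (4 * A)), by positivity, by positivity, ?_⟩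
  intro ι J _ _ _ _ _ X a B σ x η hX hXR haR hXs hσ0 hσR haB ham haσ hx hxL hη hη0 hηN
  have hη1 : η ≤ 1 := hη0.trans (min_le_left _ _)
  have hη2 : η ≤ ε / (4 * A) := hη0.trans (min_le_right _ _)
  set z : ℂ := x + η * Complex.I with hz
  have hzim : z.im = η := by simp [hz]
  have hzL : ‖z‖ ≤ L := by
    refine (norm_add_le _ _).trans ?_
    simp only [norm_mul, Complex.norm_real, Complex.norm_I, mul_one, Real.norm_eq_abs, abs_of_pos hη]
    linarith
  obtain ⟨hX1, hX2, hX3, hX4⟩ := h ι J X a hX hXR haR hXs z (by rwa [hzim]) (by rwa [hzim]) hzL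
  rw [hzim] at hX1 hX2 hX3 hX4
  set N : ℝ := (Fintype.card (Fin n × ι) : ℝ) with hNdef
  have hN : 0 < N := by rw [hNdef]; exact_mod_cast Fintype.card_pos
  have hk : C₁ / (N ^ 2 * η ^ 11) ≤ η / 2 := by
    refine le_trans ?_ hηN
    gcongr
    have : 0 ≤ 4 * A / ε ^ 2 := by positivity
    linarith
  have hk' : C₁ / (N ^ 2 * η ^ 7) ≤ η / 2 := by
    refine le_trans ?_ hk
    gcongr C₁ / (N ^ 2 * ?_)
    exact pow_le_pow_of_le_one hη.le hη1 (by norm_num)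
  set w := omU X z
  have hw0 : 0 < w.im := hη.trans_le hX1
  obtain ⟨v, hv1, hv2, hv3⟩ := exists_real_branch hs0 hε hσ0 haB ham haσ hx
  have hv0 : ∀ i, (v : ℂ) - a i ≠ 0 := fun i => by
    have := hv1 i
    exact_mod_cast (by linarith : v - a i ≠ 0)
  have hsv : stj a v ≠ 0 := by
    rw [stj_ofReal]
    exact_mod_cast (rst_pos fun i => by linarith [hv1 i]).ne'
  have hq : qst s a w ≤ 1 := by
    have h1 := (Complex.abs_im_le_norm _).trans hX4
    rw [Complex.sub_im, hzim, im_Hst s a hw0, abs_le] at h1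
    by_contra hcon
    have := mul_neg_of_pos_of_neg hw0 (by linarith : 1 - qst s a w < 0)
    linarith
  have h1 := norm_Hst_sub_ge hs0 a (fun i => im_sub_ofReal_ne hw0.ne' (a i)) hv0
    (stj_ne_zero a hw0) hsv
  have h2 : ‖Hst s a w - Hst s a v‖ ≤ 2 * η := by
    rw [hv2]
    have e : Hst s a w - x = (Hst s a w - z) + η * Complex.I := by rw [hz]; ring
    rw [e]
    refine (norm_add_le _ _).trans ?_
    simp only [norm_mul, Complex.norm_real, Complex.norm_I, mul_one, Real.norm_eq_abs, abs_of_pos hη]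
    linarith
  have h3 : √(qst s a w * qst s a v) ≤ 1 - 1 / A := by
    calc _ ≤ √(qst s a v) := by
          apply Real.sqrt_le_sqrt
          exact mul_le_of_le_one_left (qst_nonneg hs0.le a v) hq
      _ ≤ 1 - ε / (σ * √s + ε) := hv3
      _ ≤ 1 - 1 / A := by
        rw [hA, one_div_div]
        gcongr
  have h4 : ‖w - v‖ ≤ 2 * η * A := by
    have : ‖w - v‖ * (1 / A) ≤ 2 * η := by
      calc _ ≤ ‖w - v‖ * (1 - √(qst s a w * qst s a v)) := by gcongr; linarith
        _ ≤ _ := h1.trans h2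
    rwa [mul_one_div, div_le_iff₀ hA0] at this
  have h5 : 2 * η * A ≤ ε / 2 := by
    rw [le_div_iff₀ (by positivity)] at hη2
    linarith
  have hvn : ∀ i, ε ≤ ‖(v : ℂ) - a i‖ := fun i => by
    rw [← Complex.ofReal_sub, Complex.norm_real]
    exact (hv1 i).trans (le_abs_self _)
  have hwn : ∀ i, ε / 2 ≤ ‖w - a i‖ := fun i => by
    have : (v : ℂ) - a i = (w - a i) - (w - v) := by ring
    have h6 := hvn i
    rw [this] at h6
    have := norm_sub_le (w - a i) (w - v)
    linarith
  have h6 := norm_stj_sub_le a (by positivity) hε hwn hvn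
  have h7 : ‖stj a w - stj a v‖ ≤ 4 * A / ε ^ 2 * η := by
    refine h6.trans ?_
    calc _ ≤ 2 * η * A / (ε / 2 * ε) := by gcongr
      _ = _ := by field_simp; ring
  have e : -(gU X z).im = (stj a w - gU X z).im - (stj a w - stj a v).im := by
    rw [stj_ofReal]; simp
  rw [e]
  have h8 := (le_abs_self _).trans (Complex.abs_im_le_norm (stj a w - gU X z))
  have h9 := (neg_le_abs _).trans (Complex.abs_im_le_norm (stj a w - stj a v))
  have h10 : 0 ≤ C₁ * η := by positivity
  rw [add_mul, add_mul]
  linarith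

end Comparison

/-! ### A rational kernel with high order decay -/

section Kernel

lemma partial_fractions {P : Type*} [Fintype P] [DecidableEq P] [Nonempty P] {v : P → ℂ}
    (hv : Function.Injective v) {y : ℂ} (hy : ∀ p, y + v p ≠ 0) :
    ∏ p, 1 / (y + v p) =
      ∑ p, (∏ q ∈ Finset.univ.erase p, 1 / (v q - v p)) * (1 / (y + v p)) := by
  have h := congrArg (Polynomial.eval y) (Lagrange.sum_basis (s := Finset.univ) (v := fun p => -v p)
    (fun p _ q _ h => hv (neg_injective h)) Finset.univ_nonempty)
  rw [Polynomial.eval_finsetSum, Polynomial.eval_one] at h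
  have h0 : ∏ p, 1 / (y + v p) = (∑ p, Polynomial.eval y
      (Lagrange.basis Finset.univ (fun p => -v p) p)) * ∏ p, 1 / (y + v p) := by
    rw [h, one_mul]
  rw [h0, Finset.sum_mul]
  refine Finset.sum_congr rfl fun p _ => ?_
  rw [Lagrange.basis, Polynomial.eval_prod, ← Finset.mul_prod_erase _ _ (Finset.mem_univ p),
    mul_left_comm, ← Finset.prod_mul_distrib, mul_comm]
  congr 1
  refine Finset.prod_congr rfl fun q hq => ?_
  have h1 := hy q
  simp only [Lagrange.basisDivisor, Polynomial.eval_mul, Polynomial.eval_C, Polynomial.eval_sub,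
    Polynomial.eval_X, sub_neg_eq_add, one_div]
  rw [mul_assoc, mul_inv_cancel₀ h1, mul_one]
  congr 1; ring

/-- The (imaginary parts of the) poles of the kernel. -/
def uK {K : ℕ} (p : Fin K × Bool) : ℝ := if p.2 then (p.1 : ℝ) + 1 else -((p.1 : ℝ) + 1)

/-- The residues of the kernel. -/
def cK {K : ℕ} (p : Fin K × Bool) : ℂ :=
  ∏ q ∈ Finset.univ.erase p, 1 / ((uK q : ℂ) * Complex.I - uK p * Complex.I)

/-- The rational kernel `∏ 1 / (y² + j²)`. -/
def hK (K : ℕ) (y : ℝ) : ℝ := ∏ j : Fin K, 1 / (y ^ 2 + ((j : ℝ) + 1) ^ 2)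

lemma one_le_abs_uK {K : ℕ} (p : Fin K × Bool) : 1 ≤ |uK p| := by
  have h : (0 : ℝ) ≤ (p.1 : ℕ) := Nat.cast_nonneg _
  have h1 : |((p.1 : ℕ) : ℝ) + 1| = ((p.1 : ℕ) : ℝ) + 1 := abs_of_nonneg (by linarith)
  unfold uK
  split_ifs
  · rw [h1]; linarith
  · rw [abs_neg, h1]; linarith

lemma abs_uK_le {K : ℕ} (p : Fin K × Bool) : |uK p| ≤ K := by
  have h : (0 : ℝ) ≤ (p.1 : ℕ) := Nat.cast_nonneg _
  have h1 : |((p.1 : ℕ) : ℝ) + 1| = ((p.1 : ℕ) : ℝ) + 1 := abs_of_nonneg (by linarith)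
  have h2 : ((p.1 : ℕ) : ℝ) + 1 ≤ K := by exact_mod_cast p.1.2
  unfold uK
  split_ifs
  · rw [h1]; linarith
  · rw [abs_neg, h1]; linarith

lemma uK_injective {K : ℕ} : Function.Injective (uK (K := K)) := by
  rintro ⟨j, b⟩ ⟨k, c⟩ h
  have hj : (0 : ℝ) ≤ (j : ℕ) := Nat.cast_nonneg _
  have hk : (0 : ℝ) ≤ (k : ℕ) := Nat.cast_nonneg _
  cases b <;> cases c <;> simp [uK] at h
  · simp [Fin.ext h]
  · linarith
  · linarith
  · simp [Fin.ext h]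

lemma add_uK_ne {K : ℕ} (y : ℝ) (p : Fin K × Bool) : (y : ℂ) + uK p * Complex.I ≠ 0 := by
  intro h
  have h1 := congrArg Complex.im h
  have h2 := one_le_abs_uK p
  simp at h1
  rw [h1] at h2
  norm_num at h2

lemma one_le_norm_add_uK {K : ℕ} (y : ℝ) (p : Fin K × Bool) :
    1 ≤ ‖(y : ℂ) + uK p * Complex.I‖ := by
  refine (one_le_abs_uK p).trans ?_
  have := Complex.abs_im_le_norm ((y : ℂ) + uK p * Complex.I)
  simpa using this

lemma hK_eq_prod (K : ℕ) (y : ℝ) :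
    (hK K y : ℂ) = ∏ p : Fin K × Bool, 1 / ((y : ℂ) + uK p * Complex.I) := by
  rw [Fintype.prod_prod_type, hK, Complex.ofReal_prod]
  refine Finset.prod_congr rfl fun j _ => ?_
  rw [Fintype.prod_bool]
  simp only [uK, if_true, Bool.false_eq_true, if_false]
  rw [one_div_mul_one_div]
  push_cast
  congr 1
  linear_combination ((j : ℂ) + 1) ^ 2 * Complex.I_sq

lemma hK_eq_sum {K : ℕ} (hK0 : 0 < K) (y : ℝ) :
    (hK K y : ℂ) = ∑ p : Fin K × Bool, cK p * (1 / ((y : ℂ) + uK p * Complex.I)) := by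
  have : Nonempty (Fin K × Bool) := ⟨(⟨0, hK0⟩, true)⟩
  rw [hK_eq_prod]
  refine partial_fractions (v := fun p : Fin K × Bool => (uK p : ℂ) * Complex.I) ?_ (add_uK_ne y)
  intro p q h
  exact uK_injective (by exact_mod_cast mul_right_cancel₀ Complex.I_ne_zero h)

lemma hK_pos (K : ℕ) (y : ℝ) : 0 < hK K y := Finset.prod_pos fun j _ => by positivity

lemma hK_le_one (K : ℕ) (y : ℝ) : hK K y ≤ 1 := by
  refine Finset.prod_le_one (fun j _ => by positivity) fun j _ => ?_
  rw [div_le_one (by positivity)]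
  have : (0 : ℝ) ≤ (j : ℕ) := Nat.cast_nonneg _
  nlinarith [sq_nonneg y]

lemma hK_le_pow (K : ℕ) {y r : ℝ} (hr : 0 < r) (hy : r ≤ |y|) : hK K y ≤ (1 / r) ^ (2 * K) := by
  calc hK K y ≤ ∏ _j : Fin K, (1 / r) ^ 2 := by
        refine Finset.prod_le_prod (fun j _ => by positivity) fun j _ => ?_
        rw [_root_.one_div_pow]
        have h1 : r ^ 2 ≤ y ^ 2 := by rw [← sq_abs y]; exact pow_le_pow_left₀ hr.le hy 2
        apply one_div_le_one_div_of_le (by positivity)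
        nlinarith [sq_nonneg ((j : ℝ) + 1)]
    _ = _ := by simp [pow_mul]

lemma hK_ge (K : ℕ) {y : ℝ} (hy : |y| ≤ 1) : hK K 1 ≤ hK K y := by
  refine Finset.prod_le_prod (fun j _ => by positivity) fun j _ => ?_
  have : y ^ 2 ≤ 1 ^ 2 := by rw [← sq_abs y]; exact pow_le_pow_left₀ (abs_nonneg _) hy 2
  gcongr

/-- The derivative of the kernel is dominated by the kernel. -/
lemma norm_deriv_hK_le {K : ℕ} (hK0 : 0 < K) (y : ℝ) :
    ‖∑ p : Fin K × Bool, cK p * (1 / ((y : ℂ) + uK p * Complex.I)) ^ 2‖ ≤ 2 * K * hK K y := by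
  have hd : ∀ p : Fin K × Bool, HasDerivAt (fun t : ℝ => 1 / ((t : ℂ) + uK p * Complex.I))
      (-(1 / ((y : ℂ) + uK p * Complex.I)) ^ 2) y := fun p => by
    have h1 : HasDerivAt (fun t : ℝ => (t : ℂ) + uK p * Complex.I) 1 y :=
      (Complex.ofRealCLM.hasDerivAt (x := y)).add_const _
    have h2 := h1.inv (add_uK_ne y p)
    simp only [one_div]
    refine h2.congr_deriv ?_
    rw [inv_pow, neg_div, one_div]
  have h1 : HasDerivAt (fun t : ℝ => ∑ p : Fin K × Bool, cK p * (1 / ((t : ℂ) + uK p * Complex.I)))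
      (∑ p : Fin K × Bool, cK p * (-(1 / ((y : ℂ) + uK p * Complex.I)) ^ 2)) y :=
    HasDerivAt.fun_sum fun p _ => (hd p).const_mul _
  have h2 := HasDerivAt.fun_finsetProd (u := Finset.univ) fun p _ => hd p
  have e : (fun t : ℝ => ∑ p : Fin K × Bool, cK p * (1 / ((t : ℂ) + uK p * Complex.I))) =
      fun t : ℝ => ∏ p : Fin K × Bool, 1 / ((t : ℂ) + uK p * Complex.I) := by
    funext t
    rw [← hK_eq_sum hK0, hK_eq_prod]
  rw [e] at h1
  have h3 := h1.unique h2
  have h4 : ‖∑ p : Fin K × Bool, cK p * (-(1 / ((y : ℂ) + uK p * Complex.I)) ^ 2)‖ ≤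
      ∑ _p : Fin K × Bool, hK K y := by
    rw [h3]
    refine norm_sum_le_of_le _ fun p _ => ?_
    rw [norm_smul, norm_neg, norm_pow, pow_two, ← mul_assoc, ← norm_mul,
      Finset.prod_erase_mul _ _ (Finset.mem_univ p), ← hK_eq_prod, Complex.norm_real,
      Real.norm_of_nonneg (hK_pos K y).le]
    refine mul_le_of_le_one_right (hK_pos K y).le ?_
    rw [norm_div, norm_one, div_le_one (zero_lt_one.trans_le (one_le_norm_add_uK y p))]
    exact one_le_norm_add_uK y p
  simp only [mul_neg, Finset.sum_neg_distrib, norm_neg] at h4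
  refine h4.trans (le_of_eq ?_)
  rw [Finset.sum_const, Finset.card_univ, Fintype.card_prod, Fintype.card_fin, Fintype.card_bool,
    nsmul_eq_mul]
  push_cast
  ring

end Kernel

/-! ### Smoothed counting of eigenvalues -/

section Counting

/-- The average of the kernel at scale `η` around `x`. -/
def kav {J : Type*} [Fintype J] (K : ℕ) (x η : ℝ) (a : J → ℝ) : ℝ :=
  (Fintype.card J : ℝ)⁻¹ * ∑ i, hK K ((x - a i) / η)

/-- The spectral parameters at which the kernel is expanded in resolvents. -/
def zK {K : ℕ} (x η : ℝ) (p : Fin K × Bool) : ℂ := (x : ℂ) + (η * uK p : ℝ) * Complex.I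

lemma zK_im {K : ℕ} (x η : ℝ) (p : Fin K × Bool) : (zK x η p).im = η * uK p := by
  simp [zK]

lemma zK_im_ne {K : ℕ} (x : ℝ) {η : ℝ} (hη : 0 < η) (p : Fin K × Bool) : (zK x η p).im ≠ 0 := by
  rw [zK_im]
  refine mul_ne_zero hη.ne' fun h => ?_
  have := one_le_abs_uK p
  rw [h] at this
  norm_num at this

lemma one_div_zK_sub {K : ℕ} (x : ℝ) {η : ℝ} (hη : 0 < η) (p : Fin K × Bool) (a : ℝ) :
    (η : ℂ) * (1 / (zK x η p - a)) = 1 / ((((x - a) / η : ℝ) : ℂ) + uK p * Complex.I) := by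
  have h1 : zK x η p - a ≠ 0 := im_sub_ofReal_ne (zK_im_ne x hη p) a
  have h2 := add_uK_ne ((x - a) / η) p
  have h3 : (η : ℂ) ≠ 0 := by exact_mod_cast hη.ne'
  rw [mul_one_div, div_eq_div_iff h1 h2, zK]
  push_cast
  field_simp
  ring

lemma kav_eq {J : Type*} [Fintype J] {K : ℕ} (hK0 : 0 < K) (x : ℝ) {η : ℝ} (hη : 0 < η)
    (a : J → ℝ) :
    (kav K x η a : ℂ) = ∑ p : Fin K × Bool, cK p * (η * stj a (zK x η p)) := by
  unfold kav stj
  push_cast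
  simp only [hK_eq_sum hK0, ← one_div_zK_sub x hη]
  rw [Finset.sum_comm]
  simp only [Finset.mul_sum]
  refine Finset.sum_congr rfl fun p _ => Finset.sum_congr rfl fun i _ => ?_
  ring

variable {n : ℕ} {ι : Type*} [Fintype ι] [DecidableEq ι]

/-- The smoothed eigenvalue count of `Theta (U X U*)` near `x`, as a combination of resolvents. -/
def fK (K : ℕ) (x η : ℝ) (X : Matrix (Fin n × ι) (Fin n × ι) ℂ)
    (U : unitaryGroup (Fin n × ι) ℂ) : ℂ :=
  ∑ p : Fin K × Bool, cK p * (η * ntr (GU X (zK x η p) U))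

/-- The eigenvalues of `Theta (U X U*)`. -/
def thE {X : Matrix (Fin n × ι) (Fin n × ι) ℂ} (hX : X.IsHermitian)
    (U : unitaryGroup (Fin n × ι) ℂ) : Fin n × ι → ℝ :=
  (Theta_isHermitian (conjU_isHermitian hX U)).eigenvalues

lemma ntr_GU_eq {X : Matrix (Fin n × ι) (Fin n × ι) ℂ} (hX : X.IsHermitian) {z : ℂ}
    (hz : z.im ≠ 0) (U : unitaryGroup (Fin n × ι) ℂ) : ntr (GU X z U) = stj (thE hX U) z :=
  ntr_resM_eq_stj _ hz

lemma fK_eq {X : Matrix (Fin n × ι) (Fin n × ι) ℂ} (hX : X.IsHermitian) {K : ℕ} (hK0 : 0 < K)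
    (x : ℝ) {η : ℝ} (hη : 0 < η) (U : unitaryGroup (Fin n × ι) ℂ) :
    fK K x η X U = kav K x η (thE hX U) := by
  rw [kav_eq hK0 x hη, fK]
  simp only [ntr_GU_eq hX (zK_im_ne x hη _)]

lemma continuous_fK {X : Matrix (Fin n × ι) (Fin n × ι) ℂ} (hX : X.IsHermitian) (K : ℕ)
    (x : ℝ) {η : ℝ} (hη : 0 < η) : Continuous (fK K x η X) := by
  unfold fK
  exact continuous_finsetSum _ fun p _ => continuous_const.mul
    (continuous_const.mul (continuous_ntr_GU hX (zK_im_ne x hη p)))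

lemma integral_fK {X : Matrix (Fin n × ι) (Fin n × ι) ℂ} (hX : X.IsHermitian) (K : ℕ)
    (x : ℝ) {η : ℝ} (hη : 0 < η) : ∫ U, fK K x η X U ∂uHaar (Fin n × ι) =
      ∑ p : Fin K × Bool, cK p * (η * gU X (zK x η p)) := by
  have hi : ∀ p : Fin K × Bool, Integrable
      (fun U => cK p * ((η : ℂ) * ntr (GU X (zK x η p) U))) (uHaar (Fin n × ι)) := fun p =>
    uHaar_integrable (continuous_const.mul
      (continuous_const.mul (continuous_ntr_GU hX (zK_im_ne x hη p))))
  unfold fK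
  rw [integral_finsetSum _ fun p _ => hi p]
  simp only [integral_const_mul, gU]

lemma integral_kav {X : Matrix (Fin n × ι) (Fin n × ι) ℂ} (hX : X.IsHermitian) {K : ℕ}
    (hK0 : 0 < K) (x : ℝ) {η : ℝ} (hη : 0 < η) :
    ∫ U, fK K x η X U ∂uHaar (Fin n × ι) =
      ((∫ U, kav K x η (thE hX U) ∂uHaar (Fin n × ι) : ℝ) : ℂ) := by
  simp only [fK_eq hX hK0 x hη]
  exact integral_ofReal

lemma continuous_kav {X : Matrix (Fin n × ι) (Fin n × ι) ℂ} (hX : X.IsHermitian) {K : ℕ}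
    (hK0 : 0 < K) (x : ℝ) {η : ℝ} (hη : 0 < η) : Continuous fun U => kav K x η (thE hX U) := by
  have h := Complex.continuous_re.comp (continuous_fK hX K x hη)
  refine h.congr fun U => ?_
  rw [Function.comp_apply, fK_eq hX hK0 x hη, Complex.ofReal_re]

lemma gU_conj {X : Matrix (Fin n × ι) (Fin n × ι) ℂ} (hX : X.IsHermitian) {z : ℂ}
    (hz : z.im ≠ 0) : gU X (starRingEnd ℂ z) = starRingEnd ℂ (gU X z) := by
  unfold gU
  rw [← integral_conj]
  congr 1
  funext U
  rw [ntr_GU_eq hX hz, ntr_GU_eq hX (by simpa using hz), stj_conj]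

/-- Every Hermitian matrix has arbitrarily large inflations with the same spectral distribution. -/
lemma exists_inflation [Nonempty (Fin n × ι)] {X : Matrix (Fin n × ι) (Fin n × ι) ℂ}
    (hX : X.IsHermitian) {k : ℕ} (hk : 0 < k) :
    ∃ Y : Matrix (Fin n × (ι × Fin k)) (Fin n × (ι × Fin k)) ℂ, Y.IsHermitian ∧ ‖Y‖ ≤ ‖X‖ ∧
      ∀ w : ℂ, 0 < w.im → ntr (resM w Y) = stj hX.eigenvalues w := by
  refine ⟨diagonal fun q => (hX.eigenvalues (q.1, q.2.1) : ℂ), ?_, ?_, fun w hw => ?_⟩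
  · refine Matrix.isHermitian_diagonal_of_self_adjoint _ ?_
    funext q
    simp
  · rw [Matrix.l2_opNorm_diagonal, pi_norm_le_iff_of_nonneg (norm_nonneg _)]
    intro q
    rw [Complex.norm_real]
    exact abs_eigenvalues_le hX _
  · have h := resM_eq_of_mul (z := w)
      (H := diagonal fun q : Fin n × (ι × Fin k) => (hX.eigenvalues (q.1, q.2.1) : ℂ))
      (G := diagonal fun q => 1 / (w - hX.eigenvalues (q.1, q.2.1))) (by
        rw [Matrix.smul_one_eq_diagonal, Matrix.diagonal_sub, Matrix.diagonal_mul_diagonal,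
          ← Matrix.diagonal_one]
        congr 1
        funext q
        rw [mul_one_div, div_self (im_sub_ofReal_ne hw.ne' _)])
    rw [h.2, ntr, Matrix.trace_diagonal, stj]
    have hs : ∑ q : Fin n × (ι × Fin k), 1 / (w - hX.eigenvalues (q.1, q.2.1) : ℂ) =
        k * ∑ q : Fin n × ι, 1 / (w - hX.eigenvalues q : ℂ) := by
      simp only [Fintype.sum_prod_type, Finset.sum_const, Finset.card_univ, Fintype.card_fin,
        nsmul_eq_mul, Finset.mul_sum]
    have hk' : (k : ℂ) ≠ 0 := by exact_mod_cast hk.ne'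
    have hN : (Fintype.card (Fin n × ι) : ℂ) ≠ 0 := by exact_mod_cast Fintype.card_ne_zero
    rw [hs]
    simp only [Fintype.card_prod, Fintype.card_fin] at hN ⊢
    push_cast at hN ⊢
    have h1 := left_ne_zero_of_mul hN
    have h2 := right_ne_zero_of_mul hN
    field_simp

end Counting

section Expectation

lemma neg_im_one_div_ge {y s t : ℝ} (ht : 0 < t) (h : |y - s| ≤ t) :
    1 ≤ 2 * t * -(1 / ((y : ℂ) + t * Complex.I - s)).im := by
  have hne : (y : ℂ) + t * Complex.I - s ≠ 0 := im_sub_ofReal_ne (by simpa using ht.ne') s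
  have h0 : 0 < (y - s) ^ 2 + t ^ 2 := by positivity
  have e : -(1 / ((y : ℂ) + t * Complex.I - s)).im = t / ((y - s) ^ 2 + t ^ 2) := by
    rw [one_div, Complex.inv_im, Complex.normSq_apply]
    simp
    ring
  have h2 : (y - s) ^ 2 ≤ t ^ 2 := by
    rw [← sq_abs]; exact pow_le_pow_left₀ (abs_nonneg _) h 2
  rw [e, ← mul_div_assoc, le_div_iff₀ h0]
  linarith

lemma neg_im_one_div_nonneg {y s t : ℝ} (ht : 0 < t) :
    0 ≤ -(1 / ((y : ℂ) + t * Complex.I - s)).im := by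
  rw [im_one_div_sub, neg_neg]
  have : ((y : ℂ) + t * Complex.I).im = t := by simp
  rw [this]
  positivity

/-- Pointwise domination of the kernel by Poisson kernels on a finer grid. -/
lemma hK_le_sum (K : ℕ) {x s η ε t : ℝ} (hη : 0 < η) (hε : 0 < ε) (ht : 0 < t) :
    hK K ((x - s) / η) ≤ (η / ε) ^ (2 * K) + ∑ l ∈ Finset.range (⌈2 * ε / t⌉₊ + 1),
      2 * t * -(1 / (((x - ε + l * t : ℝ) : ℂ) + t * Complex.I - s)).im := by
  have hnn : ∀ l ∈ Finset.range (⌈2 * ε / t⌉₊ + 1),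
      0 ≤ 2 * t * -(1 / (((x - ε + l * t : ℝ) : ℂ) + t * Complex.I - s)).im := fun l _ =>
    mul_nonneg (by positivity) (neg_im_one_div_nonneg ht)
  by_cases h : ε ≤ |x - s|
  · have h1 : ε / η ≤ |(x - s) / η| := by
      rw [abs_div, abs_of_pos hη]; gcongr
    have h2 := hK_le_pow K (by positivity) h1
    rw [one_div_div] at h2
    linarith [Finset.sum_nonneg hnn]
  · have h' := abs_lt.1 (not_le.1 h)
    have hu : 0 ≤ (s - (x - ε)) / t := div_nonneg (by linarith) ht.le
    have hl : ⌊(s - (x - ε)) / t⌋₊ ∈ Finset.range (⌈2 * ε / t⌉₊ + 1) := by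
      rw [Finset.mem_range]
      have h3 : (s - (x - ε)) / t ≤ 2 * ε / t := by gcongr; linarith
      have h4 : (⌊(s - (x - ε)) / t⌋₊ : ℝ) ≤ (⌈2 * ε / t⌉₊ : ℝ) :=
        (Nat.floor_le hu).trans (h3.trans (Nat.le_ceil _))
      have : ⌊(s - (x - ε)) / t⌋₊ ≤ ⌈2 * ε / t⌉₊ := by exact_mod_cast h4
      omega
    have h5 := Finset.single_le_sum hnn hl
    have h6 : 1 ≤ 2 * t * -(1 / (((x - ε + ⌊(s - (x - ε)) / t⌋₊ * t : ℝ) : ℂ) +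
        t * Complex.I - s)).im := by
      refine neg_im_one_div_ge ht ?_
      have h7 := (le_div_iff₀ ht).1 (Nat.floor_le hu)
      have h8 := (div_lt_iff₀ ht).1 (Nat.lt_floor_add_one ((s - (x - ε)) / t))
      rw [abs_le]
      constructor <;> linarith
    have h9 := hK_le_one K ((x - s) / η)
    have : 0 ≤ (η / ε) ^ (2 * K) := by positivity
    linarith

lemma kav_le {J : Type*} [Fintype J] [Nonempty J] (K : ℕ) (a : J → ℝ) {x η ε t : ℝ} (hη : 0 < η)
    (hε : 0 < ε) (ht : 0 < t) :
    kav K x η a ≤ (η / ε) ^ (2 * K) + ∑ l ∈ Finset.range (⌈2 * ε / t⌉₊ + 1),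
      2 * t * -(stj a (((x - ε + l * t : ℝ) : ℂ) + t * Complex.I)).im := by
  have hN : (0 : ℝ) < Fintype.card J := by exact_mod_cast Fintype.card_pos
  unfold kav
  have h1 : ∑ i, hK K ((x - a i) / η) ≤ ∑ i, ((η / ε) ^ (2 * K) +
      ∑ l ∈ Finset.range (⌈2 * ε / t⌉₊ + 1),
        2 * t * -(1 / (((x - ε + l * t : ℝ) : ℂ) + t * Complex.I - a i)).im) :=
    Finset.sum_le_sum fun i _ => hK_le_sum K hη hε ht
  refine (mul_le_mul_of_nonneg_left h1 (inv_nonneg.2 hN.le)).trans (le_of_eq ?_)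
  rw [Finset.sum_add_distrib, mul_add, Finset.sum_const, Finset.card_univ, nsmul_eq_mul,
    ← mul_assoc, inv_mul_cancel₀ hN.ne', one_mul, Finset.sum_comm, Finset.mul_sum]
  congr 1
  refine Finset.sum_congr rfl fun l _ => ?_
  have hc : (Fintype.card J : ℂ)⁻¹ = (((Fintype.card J : ℝ)⁻¹ : ℝ) : ℂ) := by push_cast; rfl
  rw [stj, hc, Complex.im_ofReal_mul, Complex.im_sum, ← Finset.mul_sum, Finset.sum_neg_distrib]
  ring

variable {n : ℕ}

lemma integral_kav_le {ι : Type*} [Fintype ι] [DecidableEq ι] [Nonempty (Fin n × ι)]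
    {X : Matrix (Fin n × ι) (Fin n × ι) ℂ} (hX : X.IsHermitian) {K : ℕ} (hK0 : 0 < K)
    {x η ε t : ℝ} (hη : 0 < η) (hε : 0 < ε) (ht : 0 < t) :
    ∫ U, kav K x η (thE hX U) ∂uHaar (Fin n × ι) ≤ (η / ε) ^ (2 * K) +
      ∑ l ∈ Finset.range (⌈2 * ε / t⌉₊ + 1),
        2 * t * -(gU X (((x - ε + l * t : ℝ) : ℂ) + t * Complex.I)).im := by
  have hz : ∀ l : ℕ, (((x - ε + l * t : ℝ) : ℂ) + t * Complex.I).im ≠ 0 := fun l => by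
    simpa using ht.ne'
  have hc : ∀ l : ℕ, Continuous fun U => 2 * t *
      -(stj (thE hX U) (((x - ε + l * t : ℝ) : ℂ) + t * Complex.I)).im := fun l => by
    have h := Complex.continuous_im.comp (continuous_ntr_GU hX (hz l))
    simp only [Function.comp_def, ntr_GU_eq hX (hz l)] at h
    exact continuous_const.mul h.neg
  calc _ ≤ ∫ U, ((η / ε) ^ (2 * K) + ∑ l ∈ Finset.range (⌈2 * ε / t⌉₊ + 1),
        2 * t * -(stj (thE hX U) (((x - ε + l * t : ℝ) : ℂ) + t * Complex.I)).im)
          ∂uHaar (Fin n × ι) :=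
        integral_mono (uHaar_integrable (continuous_kav hX hK0 x hη))
          (uHaar_integrable (continuous_const.add (continuous_finsetSum _ fun l _ => hc l)))
          fun U => kav_le K _ hη hε ht
    _ = _ := by
        rw [integral_add (integrable_const _)
          (uHaar_integrable (continuous_finsetSum _ fun l _ => hc l)),
          integral_finsetSum _ fun l _ => uHaar_integrable (hc l)]
        simp only [integral_const, probReal_univ, one_smul]
        congr 1
        refine Finset.sum_congr rfl fun l _ => ?_
        rw [integral_const_mul, integral_neg, im_gU hX (hz l)]
        simp only [ntr_GU_eq hX (hz l)]

lemma norm_gU_sub_conj {ι κ : Type*} [Fintype ι] [DecidableEq ι] [Fintype κ] [DecidableEq κ]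
    {X : Matrix (Fin n × ι) (Fin n × ι) ℂ} (hX : X.IsHermitian)
    {Y : Matrix (Fin n × κ) (Fin n × κ) ℂ} (hY : Y.IsHermitian) {z : ℂ} (hz : z.im ≠ 0) :
    ‖gU X (starRingEnd ℂ z) - gU Y (starRingEnd ℂ z)‖ = ‖gU X z - gU Y z‖ := by
  rw [gU_conj hX hz, gU_conj hY hz, ← map_sub, RCLike.norm_conj]

/-- The expected smoothed count is comparable for a matrix and for its inflations. -/
lemma exists_integral_fK_sub_le (hn : 2 ≤ n) {R L : ℝ} (hR : 1 ≤ R) (hL : 1 ≤ L) (K : ℕ) :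
    ∃ C : ℝ, 0 ≤ C ∧ ∀ (ι κ : Type) [Fintype ι] [DecidableEq ι] [Nonempty (Fin n × ι)]
      [Fintype κ] [DecidableEq κ] [Nonempty (Fin n × κ)]
      (X : Matrix (Fin n × ι) (Fin n × ι) ℂ) (Y : Matrix (Fin n × κ) (Fin n × κ) ℂ)
      (hX : X.IsHermitian) (_ : ‖X‖ ≤ R) (_ : Y.IsHermitian) (_ : ‖Y‖ ≤ R)
      (_ : ∀ w : ℂ, 0 < w.im → ntr (resM w Y) = stj hX.eigenvalues w)
      (_ : Fintype.card (Fin n × ι) ≤ Fintype.card (Fin n × κ)) (x η : ℝ)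
      (_ : |x| + 1 ≤ L) (_ : 0 < η) (_ : K * η ≤ 1),
      ‖∫ U, fK K x η X U ∂uHaar (Fin n × ι) - ∫ U, fK K x η Y U ∂uHaar (Fin n × κ)‖ ≤
        C / ((Fintype.card (Fin n × ι) : ℝ) ^ 2 * η ^ 14) := by
  obtain ⟨C, hC, h⟩ := exists_comparison hn hR hL
  refine ⟨∑ p : Fin K × Bool, ‖cK p‖ * C, by positivity, ?_⟩
  intro ι κ _ _ _ _ _ _ X Y hX hXR hY hYR hYX hcard x η hx hη hKη
  have hN : (0 : ℝ) < Fintype.card (Fin n × ι) := by exact_mod_cast Fintype.card_pos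
  rw [integral_fK hX K x hη, integral_fK hY K x hη, ← Finset.sum_sub_distrib, Finset.sum_div]
  refine norm_sum_le_of_le _ fun p _ => ?_
  have hu1 := one_le_abs_uK p
  have hu2 := abs_uK_le p
  have key : ∀ z : ℂ, z = (x : ℂ) + (η * |uK p| : ℝ) * Complex.I →
      ‖gU X z - gU Y z‖ ≤ C / ((Fintype.card (Fin n × ι) : ℝ) ^ 2 * η ^ 15) := by
    rintro z rfl
    have him : ((x : ℂ) + (η * |uK p| : ℝ) * Complex.I).im = η * |uK p| := by simp
    have hle : η * |uK p| ≤ 1 := by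
      calc η * |uK p| ≤ η * K := by gcongr
        _ ≤ 1 := by linarith
    have hηle : η ≤ η * |uK p| := le_mul_of_one_le_right hη.le hu1
    have h1 := h ι κ (Fin n × ι) X Y hX.eigenvalues hX hXR hY hYR
      (fun i => (abs_eigenvalues_le hX i).trans hXR) (fun w hw => ntr_resM_eq_stj hX hw.ne') hYX
      hcard ((x : ℂ) + (η * |uK p| : ℝ) * Complex.I) (by rw [him]; linarith) (by rwa [him]) (by
        refine (norm_add_le _ _).trans ?_
        rw [norm_mul, Complex.norm_I, mul_one, Complex.norm_real, Complex.norm_real,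
          Real.norm_eq_abs, Real.norm_of_nonneg (by linarith : 0 ≤ η * |uK p|)]
        linarith)
    rw [him] at h1
    refine h1.trans ?_
    gcongr
  have hb : ‖gU X (zK x η p) - gU Y (zK x η p)‖ ≤
      C / ((Fintype.card (Fin n × ι) : ℝ) ^ 2 * η ^ 15) := by
    rcases le_or_gt 0 (uK p) with hu | hu
    · exact key _ (by rw [zK, abs_of_nonneg hu])
    · rw [← norm_gU_sub_conj hX hY (zK_im_ne x hη p)]
      refine key _ ?_
      rw [zK, abs_of_neg hu]
      simp
  rw [← mul_sub, ← mul_sub, norm_mul, norm_mul, Complex.norm_real, Real.norm_of_nonneg hη.le]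
  calc ‖cK p‖ * (η * ‖gU X (zK x η p) - gU Y (zK x η p)‖)
      ≤ ‖cK p‖ * (η * (C / ((Fintype.card (Fin n × ι) : ℝ) ^ 2 * η ^ 15))) := by gcongr
    _ = _ := by field_simp

/-- Outside of the limiting spectrum the expected smoothed count is small. -/
theorem exists_integral_kav_le (hn : 2 ≤ n) {R L ε : ℝ} (hR : 1 ≤ R) (hL : 1 ≤ L) (hε : 0 < ε)
    {K : ℕ} (hK0 : 0 < K) :
    ∃ C : ℝ, 0 ≤ C ∧ ∀ (ι : Type) [Fintype ι] [DecidableEq ι] [Nonempty (Fin n × ι)]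
      (X : Matrix (Fin n × ι) (Fin n × ι) ℂ) (B σ x η : ℝ) (hX : X.IsHermitian) (_ : ‖X‖ ≤ R)
      (_ : 0 ≤ σ) (_ : σ ≤ R) (_ : ∀ i, hX.eigenvalues i ≤ B) (_ : ∑ i, hX.eigenvalues i = 0)
      (_ : (Fintype.card (Fin n × ι) : ℝ)⁻¹ * ∑ i, hX.eigenvalues i ^ 2 ≤ σ ^ 2)
      (_ : B + 2 * σ * √((n : ℝ) ^ 2 - 2) + 2 * ε ≤ x) (_ : |x| + 1 ≤ L)
      (_ : 0 < η) (_ : K * η ≤ 1),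
      ∫ U, kav K x η (thE hX U) ∂uHaar (Fin n × ι) ≤
        C / ((Fintype.card (Fin n × ι) : ℝ) ^ 2 * η ^ 14) + (η / ε) ^ (2 * K) := by
  obtain ⟨C, hC, hcomp⟩ := exists_integral_fK_sub_le hn hR hL K
  obtain ⟨D, η₀, hD, hη₀, him⟩ := exists_im_gU_le hn hR (L := L + ε + 1) (by linarith) hε
  refine ⟨C, hC, ?_⟩
  intro ι _ _ _ X B σ x η hX hXR hσ hσR hB htr hvar hx hxL hη hKη
  refine le_of_forall_pos_le_add fun δ hδ => ?_
  obtain ⟨t, ht, ht1, htη, htδ⟩ : ∃ t : ℝ, 0 < t ∧ t ≤ 1 ∧ t ≤ η₀ ∧ (4 * ε + 4) * D * t ≤ δ := by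
    refine ⟨min (min 1 η₀) (δ / ((4 * ε + 4) * D)), by positivity,
      (min_le_left _ _).trans (min_le_left _ _), (min_le_left _ _).trans (min_le_right _ _), ?_⟩
    calc (4 * ε + 4) * D * _ ≤ (4 * ε + 4) * D * (δ / ((4 * ε + 4) * D)) := by
          gcongr
          exact min_le_right _ _
      _ = δ := by field_simp
  obtain ⟨k, hk⟩ := exists_nat_ge (D / (t ^ 11 * (t / 2)) + 1)
  have hk1 : (1 : ℝ) ≤ k := le_trans (by
    have : 0 ≤ D / (t ^ 11 * (t / 2)) := by positivity
    linarith) hk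
  have hk0 : 0 < k := by exact_mod_cast zero_lt_one.trans_le hk1
  have : Nonempty (Fin k) := ⟨⟨0, hk0⟩⟩
  have : Nonempty ι := ⟨(Classical.arbitrary (Fin n × ι)).2⟩
  have : Nonempty (Fin n) := ⟨(Classical.arbitrary (Fin n × ι)).1⟩
  obtain ⟨Y, hY, hYX, hYs⟩ := exists_inflation hX hk0
  have hYR := hYX.trans hXR
  have hN1 : 1 ≤ Fintype.card (Fin n × ι) := Fintype.card_pos
  have hcardeq : Fintype.card (Fin n × (ι × Fin k)) = Fintype.card (Fin n × ι) * k := by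
    simp [Fintype.card_prod, mul_assoc]
  have hcard : Fintype.card (Fin n × ι) ≤ Fintype.card (Fin n × (ι × Fin k)) := by
    rw [hcardeq]; exact Nat.le_mul_of_pos_right _ hk0
  have h1 := hcomp ι (ι × Fin k) X Y hX hXR hY hYR hYs hcard x η hxL hη hKη
  rw [integral_kav hX hK0 x hη, integral_kav hY hK0 x hη, ← Complex.ofReal_sub,
    Complex.norm_real] at h1
  have h2 := (abs_le.1 h1).2
  have h3 := integral_kav_le hY hK0 (x := x) hη hε ht
  have hM : D / ((Fintype.card (Fin n × (ι × Fin k)) : ℝ) ^ 2 * t ^ 11) ≤ t / 2 := by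
    have hkM : (k : ℝ) ≤ (Fintype.card (Fin n × (ι × Fin k)) : ℝ) ^ 2 := by
      rw [hcardeq]
      push_cast
      have : (1 : ℝ) ≤ Fintype.card (Fin n × ι) := by exact_mod_cast hN1
      calc (k : ℝ) ≤ (1 * k) ^ 2 := by nlinarith
        _ ≤ _ := by gcongr
    have hDk : D / (t ^ 11 * (t / 2)) ≤ (Fintype.card (Fin n × (ι × Fin k)) : ℝ) ^ 2 := by linarith
    rw [div_le_iff₀ (by positivity)] at hDk ⊢
    linarith
  have h4 : ∀ l ∈ Finset.range (⌈2 * ε / t⌉₊ + 1),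
      2 * t * -(gU Y (((x - ε + l * t : ℝ) : ℂ) + t * Complex.I)).im ≤ 2 * t * (D * t) := by
    intro l hl
    rw [Finset.mem_range] at hl
    have hl1 : (l : ℝ) ≤ ⌈2 * ε / t⌉₊ := by exact_mod_cast Nat.lt_succ_iff.1 hl
    have hl2 : (l : ℝ) ≤ 2 * ε / t + 1 :=
      hl1.trans (Nat.ceil_lt_add_one (by positivity)).le
    have hl3 : l * t ≤ 2 * ε + t := by
      calc l * t ≤ (2 * ε / t + 1) * t := by gcongr
        _ = _ := by field_simp
    have hl0 : 0 ≤ l * t := by positivity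
    gcongr
    refine him (ι × Fin k) (Fin n × ι) Y hX.eigenvalues B σ (x - ε + l * t) t hY hYR
      (fun i => (abs_eigenvalues_le hX i).trans hXR) hYs hσ hσR hB htr hvar (by linarith) ?_
      ht htη hM
    have hxa := abs_le.1 (le_refl |x|)
    have : |x - ε + l * t| ≤ |x| + ε + 1 := abs_le.2 ⟨by linarith, by linarith⟩
    linarith
  have h5 := Finset.sum_le_sum h4
  rw [Finset.sum_const, Finset.card_range, nsmul_eq_mul] at h5
  have h6 : ((⌈2 * ε / t⌉₊ + 1 : ℕ) : ℝ) * (2 * t * (D * t)) ≤ δ := by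
    have : ((⌈2 * ε / t⌉₊ + 1 : ℕ) : ℝ) ≤ 2 * ε / t + 2 := by
      push_cast
      linarith [Nat.ceil_lt_add_one (show 0 ≤ 2 * ε / t by positivity)]
    calc _ ≤ (2 * ε / t + 2) * (2 * t * (D * t)) := by gcongr
      _ = (4 * ε + 4 * t) * D * t := by field_simp; ring
      _ ≤ (4 * ε + 4 * 1) * D * t := by gcongr
      _ ≤ δ := by linarith
  linarith

end Expectation

/-! ### Hilbert–Schmidt bounds and the variance of the smoothed count -/

section HilbertSchmidt

variable {J : Type*} [Fintype J]

/-- The squared Hilbert–Schmidt norm. -/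
def hsq (M : Matrix J J ℂ) : ℝ := ∑ a, ∑ b, ‖M a b‖ ^ 2

lemma hsq_nonneg (M : Matrix J J ℂ) : 0 ≤ hsq M := by unfold hsq; positivity

lemma hsq_star (M : Matrix J J ℂ) : hsq (star M) = hsq M := by
  unfold hsq
  rw [Finset.sum_comm]
  simp [Matrix.star_eq_conjTranspose, Matrix.conjTranspose_apply]

lemma hsq_smul (c : ℂ) (M : Matrix J J ℂ) : hsq (c • M) = ‖c‖ ^ 2 * hsq M := by
  simp [hsq, mul_pow, Finset.mul_sum]

lemma hsq_sum_le {κ : Type*} (s : Finset κ) (M : κ → Matrix J J ℂ) :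
    hsq (∑ i ∈ s, M i) ≤ s.card * ∑ i ∈ s, hsq (M i) := by
  unfold hsq
  rw [Finset.sum_comm (s := s), Finset.mul_sum]
  refine Finset.sum_le_sum fun a _ => ?_
  rw [Finset.sum_comm (s := s), Finset.mul_sum]
  refine Finset.sum_le_sum fun b _ => ?_
  rw [Matrix.sum_apply]
  calc ‖∑ i ∈ s, M i a b‖ ^ 2 ≤ (∑ i ∈ s, ‖M i a b‖) ^ 2 :=
        pow_le_pow_left₀ (norm_nonneg _) (norm_sum_le _ _) 2
    _ ≤ _ := sq_sum_le_card_mul_sum_sq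

lemma hsq_sub_le (M N : Matrix J J ℂ) : hsq (M - N) ≤ 2 * hsq M + 2 * hsq N := by
  unfold hsq
  simp only [Finset.mul_sum, ← Finset.sum_add_distrib]
  refine Finset.sum_le_sum fun a _ => Finset.sum_le_sum fun b _ => ?_
  have h := norm_sub_le (M a b) (N a b)
  have h2 := pow_le_pow_left₀ (norm_nonneg _) h 2
  rw [Matrix.sub_apply]
  nlinarith [sq_nonneg (‖M a b‖ - ‖N a b‖)]

variable [DecidableEq J]

lemma hsq_mul_left_le (P W : Matrix J J ℂ) : hsq (P * W) ≤ ‖P‖ ^ 2 * hsq W := by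
  unfold hsq
  rw [Finset.sum_comm, Finset.sum_comm (f := fun a b => ‖W a b‖ ^ 2), Finset.mul_sum]
  refine Finset.sum_le_sum fun b _ => ?_
  have h := Matrix.l2_opNorm_mulVec P (WithLp.toLp 2 fun a => W a b)
  have h2 := pow_le_pow_left₀ (norm_nonneg _) h 2
  rw [mul_pow, EuclideanSpace.norm_sq_eq, EuclideanSpace.norm_sq_eq] at h2
  exact h2

lemma hsq_mul_right_le (P W : Matrix J J ℂ) : hsq (W * P) ≤ ‖P‖ ^ 2 * hsq W := by
  have h := hsq_mul_left_le (star P) (star W)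
  rwa [← star_mul, hsq_star, hsq_star, norm_star] at h

lemma hsq_conjU_le (A : Matrix J J ℂ) (U : unitaryGroup J ℂ) : hsq (conjU A U) ≤ hsq A := by
  have hU : ‖(U : Matrix J J ℂ)‖ ^ 2 ≤ 1 :=
    pow_le_one₀ (norm_nonneg _) (norm_coe_unitary_le U)
  have hA := hsq_nonneg A
  unfold conjU
  calc _ ≤ ‖star (U : Matrix J J ℂ)‖ ^ 2 * hsq ((U : Matrix J J ℂ) * A) := hsq_mul_right_le _ _
    _ ≤ 1 * (‖(U : Matrix J J ℂ)‖ ^ 2 * hsq A) := by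
        rw [norm_star]
        gcongr
        · exact hsq_nonneg _
        · exact hsq_mul_left_le _ _
    _ ≤ 1 * (1 * hsq A) := by gcongr
    _ = _ := by ring

lemma hsq_diagonal (w : J → ℂ) : hsq (diagonal w) = ∑ i, ‖w i‖ ^ 2 := by
  unfold hsq
  refine Finset.sum_congr rfl fun a _ => ?_
  rw [Finset.sum_eq_single a]
  · simp
  · intro b _ hb
    simp [Matrix.diagonal_apply_ne _ hb.symm]
  · simp

lemma hsq_comm_le {P W : Matrix J J ℂ} {R : ℝ} (hP : ‖P‖ ≤ R) :
    hsq (P * W - W * P) ≤ 4 * R ^ 2 * hsq W := by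
  have h := pow_le_pow_left₀ (norm_nonneg _) hP 2
  have h1 := hsq_sub_le (P * W) (W * P)
  have h2 := hsq_mul_left_le P W
  have h3 := hsq_mul_right_le P W
  have h4 := mul_le_mul_of_nonneg_right h (hsq_nonneg W)
  linarith

lemma variance_le_hsq [Nonempty J] {f : unitaryGroup J ℂ → ℂ} {D} (hf : HasD f D)
    {g : unitaryGroup J ℂ → Matrix J J ℂ} {q : unitaryGroup J ℂ → ℝ} (hq : Continuous q)
    (hD : ∀ U K, D U K = ntr (K * g U))
    (hg : ∀ U, hsq (g U) ≤ q U) (hinv : ∀ U V, (∀ A, conjU A U = conjU A V) → f U = f V) :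
    ∫ U, ‖f U - ∫ V, f V ∂uHaar J‖ ^ 2 ∂uHaar J ≤
      2 / (Fintype.card J : ℝ) ^ 3 * ∫ U, q U ∂uHaar J := by
  have hN : (0 : ℝ) < Fintype.card J := by exact_mod_cast Fintype.card_pos
  refine (poincare hf hinv).trans ?_
  have hintg : ∀ a b, Integrable (fun U => ‖D U (Matrix.single a b 1)‖ ^ 2) (uHaar J) := fun a b =>
    uHaar_integrable ((hf.dcont _).norm.pow 2)
  have h1 : ∑ a, ∑ b, ∫ U, ‖D U (Matrix.single a b 1)‖ ^ 2 ∂uHaar J ≤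
      (Fintype.card J : ℝ)⁻¹ ^ 2 * ∫ U, q U ∂uHaar J := by
    have : ∑ a, ∑ b, ∫ U, ‖D U (Matrix.single a b 1)‖ ^ 2 ∂uHaar J =
        ∫ U, ∑ a, ∑ b, ‖D U (Matrix.single a b 1)‖ ^ 2 ∂uHaar J := by
      rw [integral_finsetSum _ fun a _ => integrable_finsetSum _ fun b _ => hintg a b]
      exact Finset.sum_congr rfl fun a _ => (integral_finsetSum _ fun b _ => hintg a b).symm
    rw [this, ← integral_const_mul]
    refine integral_mono (integrable_finsetSum _ fun a _ => integrable_finsetSum _ fun b _ =>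
      hintg a b) (uHaar_integrable (continuous_const.mul hq)) fun U => ?_
    have e : ∀ a b, ‖D U (Matrix.single a b 1)‖ ^ 2 =
        (Fintype.card J : ℝ)⁻¹ ^ 2 * ‖g U b a‖ ^ 2 := by
      intro a b
      rw [hD, ntr_single_mul, norm_mul, norm_inv, Complex.norm_natCast, mul_pow]
    simp only [e, ← Finset.mul_sum]
    rw [Finset.sum_comm]
    have := hg U
    unfold hsq at this
    gcongr
  calc _ ≤ 2 / (Fintype.card J : ℝ) * ((Fintype.card J : ℝ)⁻¹ ^ 2 * ∫ U, q U ∂uHaar J) := by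
        gcongr
    _ = _ := by field_simp

end HilbertSchmidt

section VarianceCount

variable {n : ℕ} {ι : Type*} [Fintype ι] [DecidableEq ι]

/-- The Hilbert–Schmidt bound of the map `Theta`. -/
def hsT (n : ℕ) : ℝ :=
  Fintype.card (Option (Fin n × Fin n)) * ∑ s : Option (Fin n × Fin n), ‖tc s‖ ^ 2

lemma hsT_nonneg (n : ℕ) : 0 ≤ hsT n := by unfold hsT; positivity

lemma hsq_Theta_le (W : Matrix (Fin n × ι) (Fin n × ι) ℂ) : hsq (Theta W) ≤ hsT n * hsq W := by
  rw [Theta_eq_sum, hsT, mul_assoc, Finset.sum_mul]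
  refine (hsq_sum_le _ _).trans ?_
  rw [Finset.card_univ]
  gcongr with s
  rw [hsq_smul]
  gcongr
  have hL : ‖(tL s : Matrix (Fin n × ι) (Fin n × ι) ℂ)‖ ^ 2 ≤ 1 :=
    pow_le_one₀ (norm_nonneg _) (norm_tL_le s)
  have hR : ‖(tR s : Matrix (Fin n × ι) (Fin n × ι) ℂ)‖ ^ 2 ≤ 1 :=
    pow_le_one₀ (norm_nonneg _) (norm_tR_le s)
  have h1 := hsq_mul_right_le (tR s) (tL s * W)
  have h2 := hsq_mul_left_le (tL s) W
  have h3 := mul_le_mul_of_nonneg_right hR (hsq_nonneg (tL s * W))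
  have h4 := mul_le_mul_of_nonneg_right hL (hsq_nonneg W)
  linarith

/-- The gradient of the smoothed count, as a combination of squared resolvents. -/
def WK (K : ℕ) (x η : ℝ) (X : Matrix (Fin n × ι) (Fin n × ι) ℂ)
    (U : unitaryGroup (Fin n × ι) ℂ) : Matrix (Fin n × ι) (Fin n × ι) ℂ :=
  ∑ p : Fin K × Bool, (cK p * η) • (GU X (zK x η p) U * GU X (zK x η p) U)

lemma hsq_WK_le [Nonempty (Fin n × ι)] {X : Matrix (Fin n × ι) (Fin n × ι) ℂ}
    (hX : X.IsHermitian) {K : ℕ} (hK0 : 0 < K) (x : ℝ) {η : ℝ} (hη : 0 < η)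
    (U : unitaryGroup (Fin n × ι) ℂ) :
    hsq (WK K x η X U) ≤
      (2 * K / η) ^ 2 * (Fintype.card (Fin n × ι) * kav K x η (thE hX U)) := by
  have hN : (0 : ℝ) < Fintype.card (Fin n × ι) := by exact_mod_cast Fintype.card_pos
  have hH := Theta_isHermitian (conjU_isHermitian hX U)
  have hη' : (η : ℂ) ≠ 0 := by exact_mod_cast hη.ne'
  have e : WK K x η X U = conjU (diagonal fun i => ∑ p : Fin K × Bool,
      (cK p * η) * ((1 / (zK x η p - thE hX U i)) * (1 / (zK x η p - thE hX U i))))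
        hH.eigenvectorUnitary := by
    have hG : ∀ p : Fin K × Bool, GU X (zK x η p) U * GU X (zK x η p) U =
        conjU (diagonal fun i => (1 / (zK x η p - thE hX U i)) * (1 / (zK x η p - thE hX U i)))
          hH.eigenvectorUnitary := fun p => by
      rw [GU, (resM_spectral hH fun i => im_sub_ofReal_ne (zK_im_ne x hη p) _).2, ← conjU_mul,
        Matrix.diagonal_mul_diagonal]
      rfl
    have hd : (diagonal fun i => ∑ p : Fin K × Bool,
        (cK p * η) * ((1 / (zK x η p - thE hX U i)) * (1 / (zK x η p - thE hX U i)))) =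
        ∑ p : Fin K × Bool, (cK p * (η : ℂ)) • diagonal fun i =>
          (1 / (zK x η p - thE hX U i : ℂ)) * (1 / (zK x η p - thE hX U i)) := by
      ext i j
      rw [Matrix.sum_apply]
      by_cases hij : i = j
      · subst hij; simp
      · simp [Matrix.diagonal_apply_ne _ hij]
    rw [hd, WK]
    simp only [hG]
    simp only [conjU, Finset.mul_sum, Finset.sum_mul, mul_smul_comm, smul_mul_assoc]
  rw [e]
  refine (hsq_conjU_le _ _).trans ?_
  rw [hsq_diagonal, kav, ← mul_assoc (Fintype.card (Fin n × ι) : ℝ), mul_inv_cancel₀ hN.ne',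
    one_mul, Finset.mul_sum]
  refine Finset.sum_le_sum fun i _ => ?_
  have e2 : ∑ p : Fin K × Bool,
      (cK p * η) * ((1 / (zK x η p - thE hX U i)) * (1 / (zK x η p - thE hX U i))) =
      (1 / η : ℂ) * ∑ p : Fin K × Bool,
        cK p * (1 / ((((x - thE hX U i) / η : ℝ) : ℂ) + uK p * Complex.I)) ^ 2 := by
    rw [Finset.mul_sum]
    refine Finset.sum_congr rfl fun p _ => ?_
    rw [← one_div_zK_sub x hη p]
    field_simp
  have h1 := norm_deriv_hK_le hK0 ((x - thE hX U i) / η)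
  have h2 := hK_le_one K ((x - thE hX U i) / η)
  have h3 := hK_pos K ((x - thE hX U i) / η)
  rw [e2, norm_mul, norm_div, norm_one, Complex.norm_real, Real.norm_of_nonneg hη.le]
  calc _ ≤ (1 / η * (2 * K * hK K ((x - thE hX U i) / η))) ^ 2 := by gcongr
    _ = (2 * K / η) ^ 2 * (hK K ((x - thE hX U i) / η) * hK K ((x - thE hX U i) / η)) := by ring
    _ ≤ (2 * K / η) ^ 2 * (hK K ((x - thE hX U i) / η) * 1) := by gcongr
    _ = _ := by ring

/-- The variance of the smoothed count is controlled by its expectation. -/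
lemma variance_fK_le [Nonempty (Fin n × ι)] {X : Matrix (Fin n × ι) (Fin n × ι) ℂ}
    (hX : X.IsHermitian) {R : ℝ} (hR : ‖X‖ ≤ R) {K : ℕ} (hK0 : 0 < K) (x : ℝ) {η : ℝ}
    (hη : 0 < η) :
    ∫ U, ‖fK K x η X U - ∫ V, fK K x η X V ∂uHaar (Fin n × ι)‖ ^ 2 ∂uHaar (Fin n × ι) ≤
      32 * R ^ 2 * hsT n * K ^ 2 / ((Fintype.card (Fin n × ι) : ℝ) ^ 2 * η ^ 2) *
        ∫ U, kav K x η (thE hX U) ∂uHaar (Fin n × ι) := by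
  have hN : (0 : ℝ) < Fintype.card (Fin n × ι) := by exact_mod_cast Fintype.card_pos
  have hd : HasD (fK K x η X) _ := HasD.sum Finset.univ fun (p : Fin K × Bool) _ =>
    (((hasD_GU hX (zK_im_ne x hη p)).lin ntrL).smul (η : ℂ)).smul (cK p)
  have h := variance_le_hsq hd
    (g := fun U => conjU X U * Theta (WK K x η X U) - Theta (WK K x η X U) * conjU X U)
    (q := fun U => 4 * R ^ 2 * (hsT n * ((2 * K / η) ^ 2 *
      (Fintype.card (Fin n × ι) * kav K x η (thE hX U))))) ?_ ?_ ?_ ?_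
  · refine h.trans (le_of_eq ?_)
    simp only [integral_const_mul]
    field_simp
    ring
  · exact continuous_const.mul (continuous_const.mul (continuous_const.mul
      (continuous_const.mul (continuous_kav hX hK0 x hη))))
  · intro U K'
    rw [← ntr_comm_mul, ← ntr_Theta_mul, WK, Finset.mul_sum, ntr_sum]
    refine Finset.sum_congr rfl fun p _ => ?_
    rw [mul_smul_comm, ntr_smul, ← mul_assoc, ntr_mul_comm, ← mul_assoc, mul_assoc (cK p)]
    rfl
  · intro U
    refine (hsq_comm_le (R := R) (by rwa [norm_conjU])).trans ?_
    gcongr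
    refine (hsq_Theta_le _).trans ?_
    have := hsT_nonneg n
    gcongr
    exact hsq_WK_le hX hK0 x hη U
  · intro U V h
    simp only [fK, GU_congr X _ h]

end VarianceCount

/-! ### Absence of outliers -/

section Outliers

variable {n : ℕ}

lemma kav_nonneg {J : Type*} [Fintype J] (K : ℕ) (x η : ℝ) (a : J → ℝ) : 0 ≤ kav K x η a :=
  mul_nonneg (by positivity) (Finset.sum_nonneg fun i _ => (hK_pos K _).le)

lemma kav_ge {J : Type*} [Fintype J] (K : ℕ) {x η : ℝ} (hη : 0 < η) (a : J → ℝ) {i : J}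
    (hi : |x - a i| ≤ η) : (Fintype.card J : ℝ)⁻¹ * hK K 1 ≤ kav K x η a := by
  unfold kav
  gcongr
  refine le_trans ?_ (Finset.single_le_sum (f := fun i => hK K ((x - a i) / η))
    (fun i _ => (hK_pos K _).le) (Finset.mem_univ i))
  refine hK_ge K ?_
  rw [abs_div, abs_of_pos hη, div_le_one hη]
  exact hi

lemma integral_sq_le {J : Type*} [Fintype J] [DecidableEq J] {f : unitaryGroup J ℂ → ℂ}
    (hf : Continuous f) : ∫ U, ‖f U‖ ^ 2 ∂uHaar J ≤
      2 * ∫ U, ‖f U - ∫ V, f V ∂uHaar J‖ ^ 2 ∂uHaar J + 2 * ‖∫ V, f V ∂uHaar J‖ ^ 2 := by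
  obtain ⟨m, hm⟩ : ∃ m, m = ∫ V, f V ∂uHaar J := ⟨_, rfl⟩
  rw [← hm]
  have h : ∫ U, ‖f U‖ ^ 2 ∂uHaar J ≤ ∫ U, (2 * ‖f U - m‖ ^ 2 + 2 * ‖m‖ ^ 2) ∂uHaar J := by
    refine integral_mono (uHaar_integrable (by fun_prop)) (uHaar_integrable (by fun_prop))
      fun U => ?_
    have h1 : ‖f U‖ ≤ ‖f U - m‖ + ‖m‖ := by
      simpa using norm_add_le (f U - m) m
    have h2 := pow_le_pow_left₀ (norm_nonneg _) h1 2
    simp only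
    nlinarith [sq_nonneg (‖f U - m‖ - ‖m‖)]
  rw [integral_add (uHaar_integrable (by fun_prop)) (integrable_const _),
    integral_const_mul] at h
  simpa using h

lemma measure_near_le {ι : Type*} [Fintype ι] [DecidableEq ι] [Nonempty (Fin n × ι)]
    {X : Matrix (Fin n × ι) (Fin n × ι) ℂ} (hX : X.IsHermitian) {R : ℝ} (hR : ‖X‖ ≤ R)
    {K : ℕ} (hK0 : 0 < K) (x : ℝ) {η : ℝ} (hη : 0 < η) {E : ℝ}
    (hE : ∫ U, kav K x η (thE hX U) ∂uHaar (Fin n × ι) ≤ E) :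
    (uHaar (Fin n × ι)).real {U | ∃ i, |x - thE hX U i| ≤ η} ≤
      2 / hK K 1 ^ 2 * (32 * R ^ 2 * hsT n * K ^ 2 / η ^ 2 * E +
        (Fintype.card (Fin n × ι) : ℝ) ^ 2 * E ^ 2) := by
  have hN : (0 : ℝ) < Fintype.card (Fin n × ι) := by exact_mod_cast Fintype.card_pos
  have hh := hK_pos K 1
  have hT := hsT_nonneg n
  obtain ⟨v, hv⟩ : ∃ v, v = ∫ U, kav K x η (thE hX U) ∂uHaar (Fin n × ι) := ⟨_, rfl⟩
  have hv0 : 0 ≤ v := hv ▸ integral_nonneg fun U => kav_nonneg K x η _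
  rw [← hv] at hE
  have hvar := variance_fK_le hX hR hK0 x hη
  have hsq := integral_sq_le (continuous_fK hX K x hη)
  rw [integral_kav hX hK0 x hη, Complex.norm_real, Real.norm_of_nonneg (hv ▸ hv0), ← hv] at hsq
  rw [integral_kav hX hK0 x hη, ← hv] at hvar
  simp only [fK_eq hX hK0 x hη, Complex.norm_real, sq_abs, Real.norm_eq_abs] at hsq hvar
  have hm := mul_meas_ge_le_integral_of_nonneg (μ := uHaar (Fin n × ι))
    (f := fun U => kav K x η (thE hX U) ^ 2) (ae_of_all _ fun U => sq_nonneg _)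
    (uHaar_integrable ((continuous_kav hX hK0 x hη).pow 2))
    (((Fintype.card (Fin n × ι) : ℝ)⁻¹ * hK K 1) ^ 2)
  have hsub : (uHaar (Fin n × ι)).real {U | ∃ i, |x - thE hX U i| ≤ η} ≤
      (uHaar (Fin n × ι)).real {U | ((Fintype.card (Fin n × ι) : ℝ)⁻¹ * hK K 1) ^ 2 ≤
        kav K x η (thE hX U) ^ 2} := by
    refine measureReal_mono ?_
    rintro U ⟨i, hi⟩
    exact pow_le_pow_left₀ (by positivity) (kav_ge K hη _ hi) 2
  have h1 : ((Fintype.card (Fin n × ι) : ℝ)⁻¹ * hK K 1) ^ 2 *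
      (uHaar (Fin n × ι)).real {U | ∃ i, |x - thE hX U i| ≤ η} ≤
      2 * (32 * R ^ 2 * hsT n * K ^ 2 / ((Fintype.card (Fin n × ι) : ℝ) ^ 2 * η ^ 2) * E) +
        2 * E ^ 2 := by
    have h2 := mul_le_mul_of_nonneg_left hsub
      (sq_nonneg ((Fintype.card (Fin n × ι) : ℝ)⁻¹ * hK K 1))
    have h3 : 32 * R ^ 2 * hsT n * K ^ 2 / ((Fintype.card (Fin n × ι) : ℝ) ^ 2 * η ^ 2) * v ≤
        32 * R ^ 2 * hsT n * K ^ 2 / ((Fintype.card (Fin n × ι) : ℝ) ^ 2 * η ^ 2) * E := by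
      gcongr
    have h4 : v ^ 2 ≤ E ^ 2 := pow_le_pow_left₀ hv0 hE 2
    linarith
  rw [mul_comm, ← le_div_iff₀ (by positivity)] at h1
  refine h1.trans (le_of_eq ?_)
  field_simp

/-- With high probability `Theta (U X U*)` has no eigenvalue beyond the edge. -/
theorem exists_measure_outlier_le (hn : 2 ≤ n) {R ε : ℝ} (hR : 1 ≤ R) (hε : 0 < ε) :
    ∃ C : ℝ, 0 ≤ C ∧ ∀ (ι : Type) [Fintype ι] [DecidableEq ι] [Nonempty (Fin n × ι)]
      (X : Matrix (Fin n × ι) (Fin n × ι) ℂ) (B σ η : ℝ) (hX : X.IsHermitian) (_ : ‖X‖ ≤ R)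
      (_ : 0 ≤ σ) (_ : σ ≤ R) (_ : ∀ i, hX.eigenvalues i ≤ B) (_ : B ≤ R)
      (_ : ∑ i, hX.eigenvalues i = 0)
      (_ : (Fintype.card (Fin n × ι) : ℝ)⁻¹ * ∑ i, hX.eigenvalues i ^ 2 ≤ σ ^ 2)
      (_ : 0 < η) (_ : 60 * η ≤ 1) (_ : (Fintype.card (Fin n × ι) : ℝ) * η ^ 58 = 1),
      (uHaar (Fin n × ι)).real
        {U | ∃ i, B + 2 * σ * √((n : ℝ) ^ 2 - 2) + 2 * ε ≤ thE hX U i} ≤ C * η ^ 87 := by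
  have hn0 : (0 : ℝ) ≤ n := Nat.cast_nonneg n
  obtain ⟨ρ, hρ⟩ : ∃ ρ : ℝ, ρ = ((n : ℝ) ^ 3 + 1) * R := ⟨_, rfl⟩
  have hρ0 : 0 ≤ ρ := by rw [hρ]; positivity
  obtain ⟨L, hL⟩ : ∃ L : ℝ, L = ρ + R + 2 * R * n + 2 * ε + 1 := ⟨_, rfl⟩
  have hRn : 0 ≤ R * n := by positivity
  have hL1 : 1 ≤ L := by linarith
  obtain ⟨C, hC, hexp⟩ := exists_integral_kav_le hn hR hL1 hε (K := 60) (by norm_num)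
  have hT := hsT_nonneg n
  have hh := hK_pos 60 1
  obtain ⟨D, hD⟩ : ∃ D : ℝ, D = C + (1 / ε) ^ 120 := ⟨_, rfl⟩
  have hD0 : 0 ≤ D := by rw [hD]; positivity
  obtain ⟨F, hF⟩ : ∃ F : ℝ, F = 2 / hK 60 1 ^ 2 * (32 * R ^ 2 * hsT n * (60 : ℕ) ^ 2 * D + D ^ 2) :=
    ⟨_, rfl⟩
  have hF0 : 0 ≤ F := by rw [hF]; positivity
  refine ⟨(ρ + 1) * F, by positivity, ?_⟩
  intro ι _ _ _ X B σ η hX hXR hσ hσR hB hBR htr hvar hη hη60 hηN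
  have hN : (0 : ℝ) < Fintype.card (Fin n × ι) := by exact_mod_cast Fintype.card_pos
  have hη1 : η ≤ 1 := by linarith
  obtain ⟨N, hNdef⟩ : ∃ N : ℝ, N = (Fintype.card (Fin n × ι) : ℝ) := ⟨_, rfl⟩
  rw [← hNdef] at hηN hN
  obtain ⟨x₀, hx₀⟩ : ∃ x₀ : ℝ, x₀ = B + 2 * σ * √((n : ℝ) ^ 2 - 2) + 2 * ε := ⟨_, rfl⟩
  have hB0 : 0 ≤ B := by
    by_contra hneg
    have : ∑ i, hX.eigenvalues i < 0 := by
      calc _ ≤ ∑ _i : Fin n × ι, B := Finset.sum_le_sum fun i _ => hB i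
        _ = N * B := by rw [Finset.sum_const, Finset.card_univ, nsmul_eq_mul, hNdef]
        _ < 0 := mul_neg_of_pos_of_neg hN (not_le.1 hneg)
    linarith
  have hsq : √((n : ℝ) ^ 2 - 2) ≤ n := by
    rw [Real.sqrt_le_left hn0]; linarith
  have hσs : σ * √((n : ℝ) ^ 2 - 2) ≤ R * n :=
    mul_le_mul hσR hsq (Real.sqrt_nonneg _) (by linarith)
  have hσs0 : 0 ≤ σ * √((n : ℝ) ^ 2 - 2) := mul_nonneg hσ (Real.sqrt_nonneg _)
  have hx₀0 : 0 ≤ x₀ := by rw [hx₀]; linarith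
  have hx₀L : x₀ + 1 ≤ L := by rw [hx₀, hL]; linarith
  have hpt : ∀ x, x₀ ≤ x → x + 1 ≤ L →
      (uHaar (Fin n × ι)).real {U | ∃ i, |x - thE hX U i| ≤ η} ≤ F * η ^ 88 := by
    intro x hx hxL
    have hE := hexp ι X B σ x η hX hXR hσ hσR hB htr hvar (by rw [← hx₀]; exact hx)
      (by rw [abs_of_nonneg (hx₀0.trans hx)]; exact hxL) hη (by push_cast; exact hη60)
    rw [← hNdef] at hE
    have hE2 : C / (N ^ 2 * η ^ 14) + (η / ε) ^ (2 * 60) ≤ D * η ^ 102 := by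
      have e1 : C / (N ^ 2 * η ^ 14) = C * η ^ 102 := by
        rw [div_eq_iff (by positivity)]
        calc C = C * (N * η ^ 58) ^ 2 := by rw [hηN]; ring
          _ = _ := by ring
      have e2 : (η / ε) ^ (2 * 60) = (1 / ε) ^ 120 * η ^ 120 := by
        rw [div_eq_mul_one_div, mul_pow]; ring
      have e3 : η ^ 120 ≤ η ^ 102 := pow_le_pow_of_le_one hη.le hη1 (by norm_num)
      rw [e1, e2, hD, add_mul]
      gcongr
    have hm := measure_near_le hX hXR (K := 60) (by norm_num) x hη (hE.trans hE2)
    rw [← hNdef] at hm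
    refine hm.trans ?_
    have e4 : 32 * R ^ 2 * hsT n * (60 : ℕ) ^ 2 / η ^ 2 * (D * η ^ 102) =
        32 * R ^ 2 * hsT n * (60 : ℕ) ^ 2 * D * η ^ 100 := by field_simp
    have e5 : N ^ 2 * (D * η ^ 102) ^ 2 = D ^ 2 * η ^ 88 := by
      calc N ^ 2 * (D * η ^ 102) ^ 2 = D ^ 2 * η ^ 88 * (N * η ^ 58) ^ 2 := by ring
        _ = _ := by rw [hηN]; ring
    have e6 : η ^ 100 ≤ η ^ 88 := pow_le_pow_of_le_one hη.le hη1 (by norm_num)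
    rw [e4, e5, hF, mul_assoc (2 / hK 60 1 ^ 2), add_mul]
    gcongr
  have hsub : {U | ∃ i, x₀ ≤ thE hX U i} ⊆ ⋃ l ∈ Finset.range (⌊ρ / η⌋₊ + 1),
      {U | x₀ + l * η + 1 ≤ L ∧ ∃ i, |x₀ + l * η - thE hX U i| ≤ η} := by
    rintro U ⟨i, hi⟩
    have hθ : thE hX U i ≤ ρ := by
      have h1 := abs_eigenvalues_le (Theta_isHermitian (conjU_isHermitian hX U)) i
      have h2 := norm_Theta_le (conjU X U)
      rw [norm_conjU] at h2
      have h3 : ((n : ℝ) ^ 3 + 1) * ‖X‖ ≤ ρ := by rw [hρ]; gcongr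
      exact (le_abs_self _).trans (h1.trans (h2.trans h3))
    have hu : 0 ≤ (thE hX U i - x₀) / η := div_nonneg (by linarith) hη.le
    have h7 := (le_div_iff₀ hη).1 (Nat.floor_le hu)
    have h8 := (div_lt_iff₀ hη).1 (Nat.lt_floor_add_one ((thE hX U i - x₀) / η))
    simp only [Set.mem_iUnion, Finset.mem_range, Set.mem_ofPred_eq, exists_prop]
    refine ⟨⌊(thE hX U i - x₀) / η⌋₊, ?_, ?_, i, ?_⟩
    · refine Nat.lt_succ_of_le (Nat.floor_le_floor ?_)
      gcongr
      linarith
    · linarith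
    · rw [abs_le]
      constructor <;> linarith
  rw [← hx₀]
  have hcount : ((⌊ρ / η⌋₊ + 1 : ℕ) : ℝ) ≤ (ρ + 1) / η := by
    push_cast
    have h1 := Nat.floor_le (show 0 ≤ ρ / η by positivity)
    have h2 : 1 ≤ 1 / η := by rw [le_div_iff₀ hη]; linarith
    rw [add_div]
    linarith
  calc _ ≤ (uHaar (Fin n × ι)).real (⋃ l ∈ Finset.range (⌊ρ / η⌋₊ + 1),
        {U | x₀ + l * η + 1 ≤ L ∧ ∃ i, |x₀ + l * η - thE hX U i| ≤ η}) := measureReal_mono hsub (measure_ne_top _ _)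
    _ ≤ ∑ l ∈ Finset.range (⌊ρ / η⌋₊ + 1), (uHaar (Fin n × ι)).real
        {U | x₀ + l * η + 1 ≤ L ∧ ∃ i, |x₀ + l * η - thE hX U i| ≤ η} :=
          measureReal_biUnion_finset_le _ _
    _ ≤ ∑ _l ∈ Finset.range (⌊ρ / η⌋₊ + 1), F * η ^ 88 := by
        refine Finset.sum_le_sum fun l _ => ?_
        by_cases hl : x₀ + l * η + 1 ≤ L
        · simp only [hl, true_and]
          exact hpt _ (by linarith [show 0 ≤ l * η by positivity]) hl
        · simp only [hl, false_and, Set.ofPred_false, measureReal_empty]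
          positivity
    _ = ((⌊ρ / η⌋₊ + 1 : ℕ) : ℝ) * (F * η ^ 88) := by
        rw [Finset.sum_const, Finset.card_range, nsmul_eq_mul]
    _ ≤ (ρ + 1) / η * (F * η ^ 88) := by gcongr
    _ = _ := by field_simp

end Outliers

/-! ### Spectral windows -/

section Window

variable {J : Type*} [Fintype J] [DecidableEq J]

lemma conjU_posSemidef {A : Matrix J J ℂ} (hA : A.PosSemidef) (U : unitaryGroup J ℂ) :
    (conjU A U).PosSemidef := by
  have := hA.mul_mul_conjTranspose_same (U : Matrix J J ℂ)
  rwa [← star_eq_conjTranspose] at this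

lemma conjU_star_conjU (A : Matrix J J ℂ) (U : unitaryGroup J ℂ) :
    conjU (conjU A U) (star U) = A := by
  have h : star (U : Matrix J J ℂ) * U = 1 := Unitary.coe_star_mul_self U
  simp only [conjU, Unitary.coe_star, star_star]
  rw [mul_assoc, mul_assoc, h, mul_one, ← mul_assoc, h, one_mul]

lemma posSemidef_smul_one_sub_iff {H : Matrix J J ℂ} (hH : H.IsHermitian) (t : ℝ) :
    ((t : ℂ) • 1 - H).PosSemidef ↔ ∀ i, hH.eigenvalues i ≤ t := by
  have hd : (t : ℂ) • 1 - H =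
      conjU (diagonal fun i => ((t - hH.eigenvalues i : ℝ) : ℂ)) hH.eigenvectorUnitary := by
    conv_lhs => rw [eq_conjU_diagonal hH, ← conjU_one hH.eigenvectorUnitary, ← conjU_smul,
      ← conjU_sub]
    congr 1
    ext i j
    by_cases h : i = j <;> simp [h, diagonal, one_apply]
  have hdiag : (diagonal fun i => ((t - hH.eigenvalues i : ℝ) : ℂ)).PosSemidef ↔
      ∀ i, hH.eigenvalues i ≤ t := by
    rw [posSemidef_diagonal_iff]
    refine forall_congr' fun i => ?_
    rw [Complex.zero_le_real, sub_nonneg]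
  rw [← hdiag, hd]
  refine ⟨fun h => ?_, fun h => conjU_posSemidef h _⟩
  have := conjU_posSemidef h (star hH.eigenvectorUnitary)
  rwa [conjU_star_conjU] at this

lemma posSemidef_smul_one_sub_of_norm_le {H : Matrix J J ℂ} (hH : H.IsHermitian) {t : ℝ}
    (h : ‖H‖ ≤ t) : ((t : ℂ) • 1 - H).PosSemidef :=
  (posSemidef_smul_one_sub_iff hH t).2 fun i =>
    (le_abs_self _).trans ((abs_eigenvalues_le hH i).trans h)

lemma ofReal_smul_one_isHermitian (c : ℝ) : ((c : ℂ) • (1 : Matrix J J ℂ)).IsHermitian := by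
  rw [IsHermitian, conjTranspose_smul, conjTranspose_one, Complex.star_def, Complex.conj_ofReal]

lemma posSemidef_ofReal_smul_one {c : ℝ} (hc : 0 ≤ c) :
    ((c : ℂ) • (1 : Matrix J J ℂ)).PosSemidef :=
  PosSemidef.one.smul (Complex.zero_le_real.2 hc)

lemma isClosed_posSemidef : IsClosed {A : Matrix J J ℂ | A.PosSemidef} := by
  have h : {A : Matrix J J ℂ | A.PosSemidef} = {A | A.IsHermitian} ∩
      ⋂ x : J → ℂ, {A | 0 ≤ star x ⬝ᵥ (A *ᵥ x)} := by
    ext A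
    simp only [Set.mem_inter_iff, Set.mem_iInter, Set.mem_ofPred_eq]
    exact posSemidef_iff_dotProduct_mulVec
  rw [h]
  refine IsClosed.inter ?_ (isClosed_iInter fun x => ?_)
  · exact isClosed_eq (by fun_prop) continuous_id
  · refine isClosed_le continuous_const ?_
    fun_prop

lemma ntr_mul_self {H : Matrix J J ℂ} (hH : H.IsHermitian) :
    ntr (H * H) = (((Fintype.card J : ℝ)⁻¹ * ∑ i, hH.eigenvalues i ^ 2 : ℝ) : ℂ) := by
  conv_lhs => rw [eq_conjU_diagonal hH, ← conjU_mul, ntr_conjU, diagonal_mul_diagonal, ntr,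
    trace_diagonal]
  push_cast
  congr 1
  exact Finset.sum_congr rfl fun i _ => (sq _).symm

lemma ntr_eq_sum_eigenvalues {H : Matrix J J ℂ} (hH : H.IsHermitian) :
    ntr H = (((Fintype.card J : ℝ)⁻¹ * ∑ i, hH.eigenvalues i : ℝ) : ℂ) := by
  rw [ntr, hH.trace_eq_sum_eigenvalues]
  push_cast
  rfl

lemma ntr_eq_re {H : Matrix J J ℂ} (hH : H.IsHermitian) : ntr H = ((ntr H).re : ℂ) := by
  rw [ntr_eq_sum_eigenvalues hH, Complex.ofReal_re]

/-- Hermitian matrices with spectrum in `[A - ε, B + ε]`, mean close to `m` and standard deviation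
at most `σ + ε`; the constant `c` is an auxiliary shift. -/
def window (J : Type*) [Fintype J] [DecidableEq J] (c A B m σ ε : ℝ) : Set (Matrix J J ℂ) :=
  {X | X.IsHermitian ∧ ‖(c : ℂ) • 1 + X‖ ≤ c + B + ε ∧ ‖(c : ℂ) • 1 - X‖ ≤ c - A + ε ∧
    |(ntr X).re - m| ≤ ε ∧ (ntr (X * X)).re - (ntr X).re ^ 2 ≤ (σ + ε) ^ 2}

variable {c A B m σ ε : ℝ}

lemma isClosed_window : IsClosed (window J c A B m σ ε) := by
  have h1 : Continuous fun X : Matrix J J ℂ => (ntr X).re :=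
    Complex.continuous_re.comp continuous_ntr
  have h2 : Continuous fun X : Matrix J J ℂ => (ntr (X * X)).re :=
    Complex.continuous_re.comp (continuous_ntr.comp (by fun_prop))
  have h3 : Continuous fun X : Matrix J J ℂ => ‖(c : ℂ) • 1 + X‖ := by fun_prop
  have h4 : Continuous fun X : Matrix J J ℂ => ‖(c : ℂ) • 1 - X‖ := by fun_prop
  have h5 : Continuous fun X : Matrix J J ℂ => |(ntr X).re - m| := by fun_prop
  have h6 : Continuous fun X : Matrix J J ℂ => (ntr (X * X)).re - (ntr X).re ^ 2 := by fun_prop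
  exact IsClosed.inter (isClosed_eq (by fun_prop) continuous_id) (IsClosed.inter
    (isClosed_le h3 continuous_const) (IsClosed.inter (isClosed_le h4 continuous_const)
    (IsClosed.inter (isClosed_le h5 continuous_const) (isClosed_le h6 continuous_const))))

lemma conjU_mem_window_iff (X : Matrix J J ℂ) (U : unitaryGroup J ℂ) :
    conjU X U ∈ window J c A B m σ ε ↔ X ∈ window J c A B m σ ε := by
  have key : ∀ (X : Matrix J J ℂ) (U : unitaryGroup J ℂ), X ∈ window J c A B m σ ε →
      conjU X U ∈ window J c A B m σ ε := by
    rintro X U ⟨h1, h2, h3, h4, h5⟩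
    have e1 : (c : ℂ) • 1 + conjU X U = conjU ((c : ℂ) • 1 + X) U := by
      conv_lhs => rw [← conjU_one U]
      simp only [conjU, mul_add, add_mul, mul_smul_comm, smul_mul_assoc]
    have e2 : (c : ℂ) • 1 - conjU X U = conjU ((c : ℂ) • 1 - X) U := by
      conv_lhs => rw [← conjU_one U]
      rw [conjU_sub, conjU_smul]
    refine ⟨conjU_isHermitian h1 U, ?_, ?_, ?_, ?_⟩
    · rwa [e1, norm_conjU]
    · rwa [e2, norm_conjU]
    · rwa [ntr_conjU]
    · rwa [← conjU_mul, ntr_conjU, ntr_conjU]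
  refine ⟨fun h => ?_, key X U⟩
  have := key _ (star U) h
  rwa [conjU_star_conjU] at this

lemma posSemidef_sub_of_mem_window {X : Matrix J J ℂ} (hX : X ∈ window J c A B m σ ε) :
    (X - ((A - ε : ℝ) : ℂ) • 1).PosSemidef := by
  have h := posSemidef_smul_one_sub_of_norm_le ((ofReal_smul_one_isHermitian c).sub hX.1) hX.2.2.1
  convert h using 1
  push_cast
  module

lemma posSemidef_sub_of_mem_window' {X : Matrix J J ℂ} (hX : X ∈ window J c A B m σ ε) :
    (((B + ε : ℝ) : ℂ) • 1 - X).PosSemidef := by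
  have h := posSemidef_smul_one_sub_of_norm_le ((ofReal_smul_one_isHermitian c).add hX.1) hX.2.1
  convert h using 1
  push_cast
  module

end Window

/-! ### Averaging over the unitary group -/

section Averaging

variable {J : Type*} [Fintype J] [DecidableEq J]

lemma measure_le_of_unitary_invariant {ν : Measure (Matrix J J ℂ)} [IsProbabilityMeasure ν]
    (hν : ∀ U : unitaryGroup J ℂ, ν.map (fun X => conjU X U) = ν) {S : Set (Matrix J J ℂ)}
    (hS : MeasurableSet S) {δ : ENNReal}
    (h : ∀ X, uHaar J {U | conjU X U ∈ S} ≤ δ) : ν S ≤ δ := by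
  have hc : Continuous fun p : unitaryGroup J ℂ × Matrix J J ℂ => conjU p.2 p.1 := by
    unfold conjU
    fun_prop
  have hm : MeasurableSet {p : unitaryGroup J ℂ × Matrix J J ℂ | conjU p.2 p.1 ∈ S} :=
    hc.measurable hS
  have e1 : ((uHaar J).prod ν) {p | conjU p.2 p.1 ∈ S} = ν S := by
    rw [Measure.prod_apply hm]
    have : ∀ U : unitaryGroup J ℂ,
        ν (Prod.mk U ⁻¹' {p : unitaryGroup J ℂ × Matrix J J ℂ | conjU p.2 p.1 ∈ S}) = ν S := by
      intro U
      conv_rhs => rw [← hν U]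
      have hU : Continuous fun X : Matrix J J ℂ => conjU X U := by
        unfold conjU
        fun_prop
      rw [Measure.map_apply hU.measurable hS]
      rfl
    rw [lintegral_congr this, lintegral_const, measure_univ, mul_one]
  rw [← e1, Measure.prod_apply_symm hm]
  calc _ ≤ ∫⁻ _, δ ∂ν := lintegral_mono fun X => h X
    _ = δ := by simp

end Averaging

/-! ### Conjugates of a matrix in a spectral window -/

section Conjugates

variable {n : ℕ}

/-- The threshold for the top of the spectrum of `Theta X` when `X` lies in a spectral window. -/
def thetaTop (n : ℕ) (B m σ ε : ℝ) : ℝ :=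
  (B + 2 * ε - m) + 2 * (σ + ε) * √((n : ℝ) ^ 2 - 2) + 2 * ε + ((n : ℝ) ^ 2 - 1) * (m + ε)

lemma isClosed_Theta_le {ι : Type*} [Fintype ι] [DecidableEq ι] {t : ℝ} :
    IsClosed {Y : Matrix (Fin n × ι) (Fin n × ι) ℂ | ((t : ℂ) • 1 - Theta Y).PosSemidef} :=
  isClosed_posSemidef.preimage
    (continuous_const.sub (ThetaL (n := n) (ι := ι)).continuous_of_finiteDimensional)

lemma exists_uHaar_window_le (hn : 2 ≤ n) (c A B m : ℝ) {σ ε : ℝ} (hσ : 0 ≤ σ) (hε : 0 < ε) :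
    ∃ C : ℝ, 0 ≤ C ∧ ∀ (ι : Type) [Fintype ι] [DecidableEq ι] [Nonempty (Fin n × ι)] (η : ℝ),
      0 < η → 60 * η ≤ 1 → (Fintype.card (Fin n × ι) : ℝ) * η ^ 58 = 1 →
      ∀ X : Matrix (Fin n × ι) (Fin n × ι) ℂ, (uHaar (Fin n × ι)).real
        {U | conjU X U ∈ window (Fin n × ι) c A B m σ ε ∩
          {Y | ((thetaTop n B m σ ε : ℂ) • 1 - Theta Y).PosSemidef}ᶜ} ≤ C * η ^ 87 := by
  obtain ⟨R, hR⟩ : ∃ R : ℝ, R = 1 + |c + B + ε| + |c| + (|m| + ε) + (σ + ε) + |B + 2 * ε - m| :=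
    ⟨_, rfl⟩
  have a1 := abs_nonneg (c + B + ε)
  have a2 := abs_nonneg c
  have a3 := abs_nonneg m
  have a4 := abs_nonneg (B + 2 * ε - m)
  obtain ⟨C, hC, hmain⟩ := exists_measure_outlier_le (R := R) hn (by linarith) hε
  refine ⟨C, hC, ?_⟩
  intro ι _ _ _ η hη hη60 hηN X
  have hr : 0 ≤ C * η ^ 87 := by positivity
  by_cases hX : X ∈ window (Fin n × ι) c A B m σ ε
  swap
  · have : {U | conjU X U ∈ window (Fin n × ι) c A B m σ ε ∩
        {Y | ((thetaTop n B m σ ε : ℂ) • 1 - Theta Y).PosSemidef}ᶜ} = ∅ := by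
      rw [Set.eq_empty_iff_forall_notMem]
      intro U hU
      exact hX ((conjU_mem_window_iff X U).1 hU.1)
    rw [this, measureReal_empty]
    exact hr
  have hupper := posSemidef_sub_of_mem_window' hX
  obtain ⟨hH, hplus, -, hmean, hvar⟩ := hX
  obtain ⟨τ, hτ⟩ : ∃ τ : ℝ, τ = (ntr X).re := ⟨_, rfl⟩
  rw [← hτ] at hmean hvar
  have hτ' : ntr X = (τ : ℂ) := by rw [hτ]; exact ntr_eq_re hH
  obtain ⟨hm1, hm2⟩ := abs_le.1 hmean
  obtain ⟨D, hD⟩ : ∃ D, D = X - (τ : ℂ) • (1 : Matrix (Fin n × ι) (Fin n × ι) ℂ) := ⟨_, rfl⟩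
  have hDH : D.IsHermitian := by rw [hD]; exact hH.sub (ofReal_smul_one_isHermitian τ)
  have hnorm1 : ∀ t : ℝ, ‖(t : ℂ) • (1 : Matrix (Fin n × ι) (Fin n × ι) ℂ)‖ ≤ |t| := by
    intro t
    rw [norm_smul, Complex.norm_real, Real.norm_eq_abs]
    exact mul_le_of_le_one_right (abs_nonneg t) norm_matrix_one_le
  have hτabs : |τ| ≤ |m| + ε := by
    have := abs_add_le (τ - m) m
    rw [sub_add_cancel] at this
    linarith
  have hDR : ‖D‖ ≤ R := by
    have e : D = ((c : ℂ) • 1 + X) - (c : ℂ) • 1 - (τ : ℂ) • 1 := by rw [hD]; abel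
    have h1 := norm_sub_le (((c : ℂ) • 1 + X) - (c : ℂ) • 1) ((τ : ℂ) • 1)
    have h2 := norm_sub_le ((c : ℂ) • 1 + X) ((c : ℂ) • 1)
    have h3 := hnorm1 c
    have h4 := hnorm1 τ
    have h5 := le_abs_self (c + B + ε)
    rw [e]
    linarith
  have hDB : ∀ i, hDH.eigenvalues i ≤ B + 2 * ε - m := by
    rw [← posSemidef_smul_one_sub_iff hDH]
    have h1 := hupper.add (posSemidef_ofReal_smul_one (J := Fin n × ι)
      (show 0 ≤ τ - m + ε by linarith))
    convert h1 using 1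
    rw [hD]
    push_cast
    module
  have hDtr : ∑ i, hDH.eigenvalues i = 0 := by
    have h1 : ntr D = 0 := by
      rw [hD, ntr_sub, ntr_smul, ntr_one, hτ', mul_one, sub_self]
    rw [ntr_eq_sum_eigenvalues hDH, Complex.ofReal_eq_zero] at h1
    rcases mul_eq_zero.1 h1 with h | h
    · exact absurd h (inv_ne_zero (Nat.cast_ne_zero.2 Fintype.card_ne_zero))
    · exact h
  have hDvar : (Fintype.card (Fin n × ι) : ℝ)⁻¹ * ∑ i, hDH.eigenvalues i ^ 2 ≤ (σ + ε) ^ 2 := by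
    have h1 := ntr_mul_self hDH
    have h2 : ntr (D * D) = ntr (X * X) - (τ : ℂ) ^ 2 := by
      have e : D * D = X * X - (2 * τ : ℂ) • X + ((τ : ℂ) ^ 2) • 1 := by
        rw [hD]
        simp only [mul_sub, sub_mul, smul_mul_assoc, mul_smul_comm, mul_one, one_mul]
        module
      rw [e, ntr_add, ntr_sub, ntr_smul, ntr_smul, ntr_one, hτ']
      ring
    have h3 := congrArg Complex.re (h1.symm.trans h2)
    rw [Complex.ofReal_re, Complex.sub_re, ← Complex.ofReal_pow, Complex.ofReal_re] at h3
    rw [h3]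
    exact hvar
  refine le_trans (measureReal_mono ?_ (measure_ne_top _ _)) (hmain ι D (B + 2 * ε - m)
    (σ + ε) η hDH hDR (by linarith) (by linarith) hDB (by linarith [le_abs_self (B + 2 * ε - m)]) hDtr hDvar hη hη60 hηN)
  rintro U ⟨-, hU⟩
  by_contra hcon
  apply hU
  simp only [Set.mem_ofPred_eq, not_exists, not_le] at hcon ⊢
  have h1 := (posSemidef_smul_one_sub_iff (Theta_isHermitian (conjU_isHermitian hDH U))
    (B + 2 * ε - m + 2 * (σ + ε) * √((n : ℝ) ^ 2 - 2) + 2 * ε)).2 fun i => (hcon i).le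
  have hn1 : (0 : ℝ) ≤ (n : ℝ) ^ 2 - 1 := by
    have : (2 : ℝ) ≤ n := by exact_mod_cast hn
    nlinarith
  have h2 := h1.add (posSemidef_ofReal_smul_one (J := Fin n × ι)
    (mul_nonneg hn1 (show 0 ≤ m + ε - τ by linarith)))
  convert h2 using 1
  rw [hD, conjU_sub, conjU_smul, conjU_one, Theta_sub, Theta_smul, Theta_one, thetaTop]
  push_cast
  module

end Conjugates

/-! ### Almost sure behaviour -/

section AlmostSure

variable {n : ℕ}

lemma thetaTop_le (n : ℕ) {A B m σ : ℝ}
    (h : ((n : ℝ) ^ 2 + n - 1) * A > B + m * ((n : ℝ) ^ 2 - 2) + 2 * σ * √((n : ℝ) ^ 2 - 2)) :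
    ∃ ε : ℝ, 0 < ε ∧ thetaTop n B m σ ε ≤ ((n : ℝ) ^ 2 + n - 1) * (A - ε) := by
  obtain ⟨s, hs⟩ : ∃ s, s = √((n : ℝ) ^ 2 - 2) := ⟨_, rfl⟩
  have hs0 : 0 ≤ s := hs ▸ Real.sqrt_nonneg _
  rw [← hs] at h
  obtain ⟨k, hk⟩ : ∃ k : ℝ, k = 2 * (n : ℝ) ^ 2 + n + 2 + 2 * s := ⟨_, rfl⟩
  have hk0 : 0 < k := by rw [hk]; positivity
  refine ⟨(((n : ℝ) ^ 2 + n - 1) * A - (B + m * ((n : ℝ) ^ 2 - 2) + 2 * σ * s)) / k,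
    div_pos (by linarith) hk0, ?_⟩
  obtain ⟨ε, hε⟩ : ∃ ε, ε = (((n : ℝ) ^ 2 + n - 1) * A -
    (B + m * ((n : ℝ) ^ 2 - 2) + 2 * σ * s)) / k := ⟨_, rfl⟩
  have h1 := (eq_div_iff hk0.ne').1 hε
  rw [← hε, thetaTop, ← hs]
  rw [hk] at h1
  linarith

variable {Ω : Type*} [MeasurableSpace Ω] {ℙ : Measure Ω}
  {X : (d : ℕ) → Ω → Matrix (Fin n × Fin d) (Fin n × Fin d) ℂ} {μ : Measure ℝ}

lemma polyApply_X {N : Type*} [Fintype N] [DecidableEq N] (M : Matrix N N ℂ) :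
    polyApply Polynomial.X M = M := by
  simp [polyApply]

lemma opNorm_eq_norm {N : Type*} [Fintype N] [DecidableEq N] (M : Matrix N N ℂ) :
    opNorm M = ‖M‖ := rfl

/-- A strongly convergent sequence eventually lies in every spectral window around its limit. -/
lemma eventually_mem_window (hpsd : ∀ d ω, (X d ω).PosSemidef) (hconv : StrongConv ℙ n X μ)
    {A B m σ ε : ℝ} (hσ : 0 ≤ σ) (hε : 0 < ε) (hsupp : msupport μ ⊆ Set.Icc A B)
    (hmean : (∫ x, x ∂μ) = m) (hvar : (∫ x, x ^ 2 ∂μ) - m ^ 2 = σ ^ 2) :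
    ∀ᵐ ω ∂ℙ, ∀ᶠ d : ℕ in atTop, X d ω ∈ window (Fin n × Fin d) (|A| + |B|) A B m σ ε := by
  filter_upwards [hconv] with ω hω
  obtain ⟨c, hc⟩ : ∃ c, c = |A| + |B| := ⟨_, rfl⟩
  rw [← hc]
  have hcA : |A| ≤ c := by rw [hc]; linarith [abs_nonneg B]
  have hcB : |B| ≤ c := by rw [hc]; linarith [abs_nonneg A]
  have hA := abs_le.1 hcA
  have hB := abs_le.1 hcB
  have hplus := (hω (Polynomial.C c + Polynomial.X)).2
  have hminus := (hω (Polynomial.C c - Polynomial.X)).2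
  have hone := (hω Polynomial.X).1
  have htwo := (hω (Polynomial.X ^ 2)).1
  have s1 : sSup ((fun x => |(Polynomial.C c + Polynomial.X).eval x|) '' msupport μ) ≤ c + B := by
    refine Real.sSup_le ?_ (by linarith)
    rintro _ ⟨x, hx, rfl⟩
    obtain ⟨h1, h2⟩ := hsupp hx
    simp only [eval_add, eval_C, eval_X]
    rw [abs_le]
    constructor <;> linarith
  have s2 : sSup ((fun x => |(Polynomial.C c - Polynomial.X).eval x|) '' msupport μ) ≤ c - A := by
    refine Real.sSup_le ?_ (by linarith)
    rintro _ ⟨x, hx, rfl⟩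
    obtain ⟨h1, h2⟩ := hsupp hx
    simp only [eval_sub, eval_C, eval_X]
    rw [abs_le]
    constructor <;> linarith
  have p1 : ∀ d, polyApply (Polynomial.C c + Polynomial.X) (X d ω) = (c : ℂ) • 1 + X d ω := by
    intro d
    simp [polyApply, Algebra.algebraMap_eq_smul_one]
  have p2 : ∀ d, polyApply (Polynomial.C c - Polynomial.X) (X d ω) = (c : ℂ) • 1 - X d ω := by
    intro d
    simp [polyApply, Algebra.algebraMap_eq_smul_one]
  have p3 : ∀ d, polyApply (Polynomial.X ^ 2) (X d ω) = X d ω * X d ω := by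
    intro d
    simp [polyApply, sq]
  have hcard : ∀ (d : ℕ) (M : Matrix (Fin n × Fin d) (Fin n × Fin d) ℂ),
      ((n : ℂ) * (d : ℂ))⁻¹ * M.trace = ntr M := by
    intro d M
    simp [ntr]
  simp only [polyApply_X, p3, hcard, eval_X, eval_pow, hmean] at hone htwo
  simp only [p1, p2, opNorm_eq_norm] at hplus hminus
  have hone' := (Complex.continuous_re.tendsto _).comp hone
  have htwo' := (Complex.continuous_re.tendsto _).comp htwo
  rw [Complex.ofReal_re] at hone' htwo'
  have hvar' := htwo'.sub (hone'.pow 2)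
  rw [hvar] at hvar'
  have hσε : σ ^ 2 < (σ + ε) ^ 2 := by nlinarith
  filter_upwards [hplus.eventually_lt_const (show _ < c + B + ε by linarith),
    hminus.eventually_lt_const (show _ < c - A + ε by linarith),
    hone'.eventually (Metric.ball_mem_nhds m hε), hvar'.eventually_lt_const hσε]
    with d h1 h2 h3 h4
  refine ⟨(hpsd d ω).1, h1.le, h2.le, ?_, h4.le⟩
  have h5 := Metric.mem_ball.1 h3
  rw [Real.dist_eq] at h5
  exact h5.le

lemma summable_rate (n : ℕ) (hn : 1 ≤ n) :
    Summable fun d : ℕ => (((n : ℝ) * d) ^ (-(1 / 58) : ℝ)) ^ 87 := by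
  have h : ∀ d : ℕ, (((n : ℝ) * d) ^ (-(1 / 58) : ℝ)) ^ 87 =
      (n : ℝ) ^ (-(3 / 2) : ℝ) * (d : ℝ) ^ (-(3 / 2) : ℝ) := by
    intro d
    rw [← Real.rpow_natCast, ← Real.rpow_mul (by positivity), Real.mul_rpow (by positivity)
      (by positivity)]
    norm_num
  simp_rw [h]
  exact (Real.summable_nat_rpow.2 (by norm_num)).mul_left _

/-- Almost surely, a unitarily invariant sequence has no outliers of `Theta` while in the
spectral window. -/
lemma eventually_posSemidef_of_mem_window [IsProbabilityMeasure ℙ] (hn : 2 ≤ n)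
    (hmeas : ∀ d, Measurable (X d)) (hUI : UnitInv ℙ n X) (c A B m : ℝ) {σ ε : ℝ} (hσ : 0 ≤ σ)
    (hε : 0 < ε) :
    ∀ᵐ ω ∂ℙ, ∀ᶠ d : ℕ in atTop, X d ω ∉ window (Fin n × Fin d) c A B m σ ε ∩
      {Y | ((thetaTop n B m σ ε : ℂ) • 1 - Theta Y).PosSemidef}ᶜ := by
  obtain ⟨C, hC, hmain⟩ := exists_uHaar_window_le hn c A B m hσ hε
  obtain ⟨S, hS⟩ : ∃ S : (d : ℕ) → Set (Matrix (Fin n × Fin d) (Fin n × Fin d) ℂ),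
      S = fun d => window (Fin n × Fin d) c A B m σ ε ∩
        {Y | ((thetaTop n B m σ ε : ℂ) • 1 - Theta Y).PosSemidef}ᶜ := ⟨_, rfl⟩
  have hSm : ∀ d, MeasurableSet (S d) := by
    intro d
    rw [hS]
    exact isClosed_window.measurableSet.inter isClosed_Theta_le.measurableSet.compl
  obtain ⟨ρ, hρ⟩ : ∃ ρ : ℕ → ℝ, ρ = fun d : ℕ => ((n : ℝ) * d) ^ (-(1 / 58) : ℝ) := ⟨_, rfl⟩
  have hlim : Tendsto ρ atTop (𝓝 0) := by
    rw [hρ]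
    refine (tendsto_rpow_neg_atTop (by norm_num)).comp ?_
    exact tendsto_natCast_atTop_atTop.const_mul_atTop (by positivity)
  obtain ⟨d₀, hd₀⟩ := eventually_atTop.1 ((hlim.eventually_lt_const
    (show (0 : ℝ) < 1 / 60 by norm_num)).and (eventually_ge_atTop 1))
  have hbound : ∀ d, d₀ ≤ d → ℙ (X d ⁻¹' S d) ≤ ENNReal.ofReal (C * ρ d ^ 87) := by
    intro d hd
    obtain ⟨h1, h2⟩ := hd₀ d hd
    have : Nonempty (Fin n × Fin d) := ⟨(⟨0, by omega⟩, ⟨0, by omega⟩)⟩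
    have hnd : (0 : ℝ) < (n : ℝ) * d := by
      have : 0 < n * d := Nat.mul_pos (by omega) (by omega)
      exact_mod_cast this
    have hρ0 : 0 < ρ d := by rw [hρ]; exact Real.rpow_pos_of_pos hnd _
    have hρN : (Fintype.card (Fin n × Fin d) : ℝ) * ρ d ^ 58 = 1 := by
      rw [hρ, ← Real.rpow_natCast, ← Real.rpow_mul hnd.le, Fintype.card_prod, Fintype.card_fin,
        Fintype.card_fin, Nat.cast_mul,
        show (-(1 / 58) : ℝ) * ((58 : ℕ) : ℝ) = -1 by norm_num, Real.rpow_neg_one]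
      exact mul_inv_cancel₀ hnd.ne'
    rw [← Measure.map_apply (hmeas d) (hSm d)]
    have := Measure.isProbabilityMeasure_map (μ := ℙ) (hmeas d).aemeasurable
    refine measure_le_of_unitary_invariant (fun U => ?_) (hSm d) fun Y => ?_
    · have hc : Continuous fun Y : Matrix (Fin n × Fin d) (Fin n × Fin d) ℂ => conjU Y U := by
        unfold conjU
        fun_prop
      rw [Measure.map_map hc.measurable (hmeas d)]
      exact hUI d U U.2
    · have h3 := hmain (Fin d) (ρ d) hρ0 (by linarith) hρN Y
      rw [hS, ← ofReal_measureReal]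
      exact ENNReal.ofReal_le_ofReal h3
  have hsum : Summable fun d => C * ρ d ^ 87 := by
    rw [hρ]
    exact (summable_rate n (by omega)).mul_left C
  have hBC := ae_eventually_notMem (μ := ℙ) (s := fun d => X (d + d₀) ⁻¹' S (d + d₀)) <| by
    have hs2 := (summable_nat_add_iff d₀).2 hsum
    refine ne_top_of_le_ne_top hs2.tsum_ofReal_ne_top
      (ENNReal.tsum_le_tsum fun d => hbound _ (Nat.le_add_left _ _))
  filter_upwards [hBC] with ω hω
  have h4 := (eventually_atTop.1 hω)
  obtain ⟨k, hk⟩ := h4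
  refine eventually_atTop.2 ⟨k + d₀, fun d hd => ?_⟩
  have h5 := hk (d - d₀) (by omega)
  rw [Nat.sub_add_cancel (by omega), hS] at h5
  exact h5

end AlmostSure

end Separability

/-- If `(n²+n−1)A > B + m(n²−2) + 2σ√(n²−2)`, a unitarily invariant
strongly convergent sequence of random PSD matrices is asymptotically separable. -/
theorem stmt1
    {Ω : Type*} [MeasurableSpace Ω] (ℙ : Measure Ω) [IsProbabilityMeasure ℙ]
    (n : ℕ) (hn : 2 ≤ n)
    (X : (d : ℕ) → Ω → Matrix (Fin n × Fin d) (Fin n × Fin d) ℂ)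
    (hmeas : ∀ d, Measurable (X d))
    (hpsd : ∀ d ω, (X d ω).PosSemidef)
    (hUI : UnitInv ℙ n X)
    (μ : Measure ℝ) [IsProbabilityMeasure μ]
    (A B m σ : ℝ) (hA : 0 ≤ A) (hσ : 0 ≤ σ)
    (hsupp : msupport μ ⊆ Set.Icc A B)
    (hmean : (∫ x, x ∂μ) = m)
    (hvar : (∫ x, x ^ 2 ∂μ) - m ^ 2 = σ ^ 2)
    (hconv : StrongConv ℙ n X μ)
    (hcond : ((n : ℝ) ^ 2 + n - 1) * A
        > B + m * ((n : ℝ) ^ 2 - 2) + 2 * σ * Real.sqrt ((n : ℝ) ^ 2 - 2)) :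
    (∀ᵐ ω ∂ℙ, ∀ᶠ d : ℕ in atTop, X d ω ∈ SEP n d) ∧
      Tendsto (fun d : ℕ => ℙ {ω | X d ω ∈ SEP n d}) atTop (𝓝 1) := by
  obtain ⟨ε, hε, hle⟩ := thetaTop_le n hcond
  have hsep : ∀ d ω, X d ω ∈ window (Fin n × Fin d) (|A| + |B|) A B m σ ε ∩
      {Y | ((thetaTop n B m σ ε : ℂ) • 1 - Theta Y).PosSemidef} → X d ω ∈ SEP n d :=
    fun d ω h => SEP_of_Theta_le (by omega) (posSemidef_sub_of_mem_window h.1) h.2 hle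
  have hae : ∀ᵐ ω ∂ℙ, ∀ᶠ d : ℕ in atTop,
      X d ω ∈ window (Fin n × Fin d) (|A| + |B|) A B m σ ε ∩
        {Y | ((thetaTop n B m σ ε : ℂ) • 1 - Theta Y).PosSemidef} := by
    filter_upwards [eventually_mem_window hpsd hconv hσ hε hsupp hmean hvar,
      eventually_posSemidef_of_mem_window hn hmeas hUI (|A| + |B|) A B m hσ hε] with ω h1 h2
    filter_upwards [h1, h2] with d h3 h4
    exact ⟨h3, by_contra fun h5 => h4 ⟨h3, h5⟩⟩
  refine ⟨hae.mono fun ω h => h.mono fun d => hsep d ω, ?_⟩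
  have hlim := tendsto_measure_of_ae_tendsto_indicator_of_isFiniteMeasure atTop (μ := ℙ)
    (A := Set.univ) (As := fun d => X d ⁻¹' (window (Fin n × Fin d) (|A| + |B|) A B m σ ε ∩
        {Y | ((thetaTop n B m σ ε : ℂ) • 1 - Theta Y).PosSemidef})) MeasurableSet.univ
    (fun d => hmeas d (isClosed_window.inter isClosed_Theta_le).measurableSet)
    (hae.mono fun ω h => h.mono fun d hd => by simpa using hd)
  rw [measure_univ] at hlim
  exact tendsto_of_tendsto_of_tendsto_of_le_of_le hlim tendsto_const_nhds
    (fun d => measure_mono fun ω h => hsep d ω h) fun d => prob_le_one
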